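/- For every ε > 0 there exist constants C = C(ε) and g = g(ε) such that every finite simple graph G with maximum degree Δ and girth at least g satisfies a'(G) ≤ (1+ε)Δ + C. -/

import Mathlib

open SimpleGraph

/-- `c` is an acyclic edge colouring of `G` using colours from `{0, …, n-1}`:
every edge gets a colour `< n`, the colouring is proper (distinct edges sharing an
endpoint get different colours) and every cycle of `G` receives at least three colours. -/
def IsAcyclicEdgeColoring {V : Type} (G : SimpleGraph V) (n : ℕ) (c : Sym2 V → ℕ) : Prop :=
  (∀ e ∈ G.edgeSet, c e < n) ∧
  (∀ e₁ ∈ G.edgeSet, ∀ e₂ ∈ G.edgeSet, e₁ ≠ e₂ → (∃ x, x ∈ e₁ ∧ x ∈ e₂) → c e₁ ≠ c e₂) ∧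
  (∀ (v : V) (w : G.Walk v v), w.IsCycle → 3 ≤ (w.edges.map c).toFinset.card)

namespace AEC
open scoped Classical
open Finset

section Prob
variable {Ω Ω' α β ι X : Type*} [Fintype Ω] [Fintype Ω'] [Fintype α] [Fintype β]

/-- The average of a real function on a finite type. -/
noncomputable def avg (f : Ω → ℝ) : ℝ := (∑ ω, f ω) / Fintype.card Ω

/-- The probability of an event under the uniform distribution on a finite type. -/
noncomputable def prob (p : Ω → Prop) : ℝ := avg fun ω => if p ω then (1 : ℝ) else 0

lemma avg_mono {f g : Ω → ℝ} (h : ∀ ω, f ω ≤ g ω) : avg f ≤ avg g := by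
  unfold avg
  gcongr
  exact h _

lemma avg_nonneg {f : Ω → ℝ} (h : ∀ ω, 0 ≤ f ω) : 0 ≤ avg f :=
  div_nonneg (Finset.sum_nonneg fun ω _ => h ω) (Nat.cast_nonneg _)

lemma avg_const [Nonempty Ω] (c : ℝ) : avg (fun _ : Ω => c) = c := by
  unfold avg
  simp

lemma avg_const_le {c : ℝ} (hc : 0 ≤ c) : avg (fun _ : Ω => c) ≤ c := by
  rcases isEmpty_or_nonempty Ω with h | h
  · simp [avg, hc]
  · exact (avg_const c).le

lemma avg_le_of_le {f : Ω → ℝ} {c : ℝ} (hc : 0 ≤ c) (h : ∀ ω, f ω ≤ c) : avg f ≤ c :=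
  (avg_mono h).trans (avg_const_le hc)

lemma avg_mul_left (c : ℝ) (f : Ω → ℝ) : avg (fun ω => c * f ω) = c * avg f := by
  unfold avg
  rw [← Finset.mul_sum, mul_div_assoc]

lemma avg_mul_right (c : ℝ) (f : Ω → ℝ) : avg (fun ω => f ω * c) = avg f * c := by
  simp_rw [mul_comm _ c, avg_mul_left]

lemma avg_add (f g : Ω → ℝ) : avg (fun ω => f ω + g ω) = avg f + avg g := by
  unfold avg
  rw [Finset.sum_add_distrib, add_div]

lemma avg_sum (S : Finset ι) (f : ι → Ω → ℝ) :
    avg (fun ω => ∑ i ∈ S, f i ω) = ∑ i ∈ S, avg (f i) := by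
  unfold avg
  rw [Finset.sum_comm, Finset.sum_div]

lemma avg_equiv (e : Ω ≃ Ω') (f : Ω' → ℝ) : avg (fun ω => f (e ω)) = avg f := by
  unfold avg
  rw [Equiv.sum_comp e f, Fintype.card_congr e]

lemma prob_equiv (e : Ω ≃ Ω') (p : Ω' → Prop) : prob (fun ω => p (e ω)) = prob p :=
  avg_equiv e fun ω => if p ω then (1 : ℝ) else 0

lemma avg_prod (f : α × β → ℝ) : avg f = avg fun a => avg fun b => f (a, b) := by
  unfold avg
  rw [Fintype.sum_prod_type, Fintype.card_prod, ← Finset.sum_div, div_div]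
  push_cast
  rw [mul_comm]

lemma avg_comm (f : α → β → ℝ) :
    (avg fun a => avg fun b => f a b) = avg fun b => avg fun a => f a b := by
  rw [← avg_prod (fun x : α × β => f x.1 x.2), ← avg_prod (fun x : β × α => f x.2 x.1)]
  exact avg_equiv (Equiv.prodComm α β) (fun x : β × α => f x.2 x.1)

lemma prob_nonneg (p : Ω → Prop) : 0 ≤ prob p :=
  avg_nonneg fun ω => by split_ifs <;> norm_num

lemma prob_le_one (p : Ω → Prop) : prob p ≤ 1 :=
  avg_le_of_le zero_le_one fun ω => by split_ifs <;> norm_num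

lemma prob_mono {p r : Ω → Prop} (h : ∀ ω, p ω → r ω) : prob p ≤ prob r :=
  avg_mono fun ω => by
    by_cases hp : p ω
    · simp [hp, h ω hp]
    · simp only [hp, if_false]; split_ifs <;> norm_num

lemma prob_congr {p r : Ω → Prop} (h : ∀ ω, p ω ↔ r ω) : prob p = prob r :=
  le_antisymm (prob_mono fun ω => (h ω).1) (prob_mono fun ω => (h ω).2)

lemma prob_eq_card (p : Ω → Prop) :
    prob p = ((univ.filter p).card : ℝ) / Fintype.card Ω := by
  simp [prob, avg]

lemma prob_or_le (p r : Ω → Prop) : prob (fun ω => p ω ∨ r ω) ≤ prob p + prob r := by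
  unfold prob
  rw [← avg_add]
  refine avg_mono fun ω => ?_
  by_cases hp : p ω <;> by_cases hr : r ω <;> simp [hp, hr]

lemma prob_exists_mem_le (S : Finset ι) (p : ι → Ω → Prop) :
    prob (fun ω => ∃ i ∈ S, p i ω) ≤ ∑ i ∈ S, prob (p i) := by
  unfold prob
  rw [← avg_sum]
  refine avg_mono fun ω => ?_
  split_ifs with h
  · obtain ⟨i, hi, hp⟩ := h
    calc (1 : ℝ) = if p i ω then (1 : ℝ) else 0 := by simp [hp]
      _ ≤ _ := Finset.single_le_sum (f := fun i => if p i ω then (1 : ℝ) else 0)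
        (fun j _ => by split_ifs <;> norm_num) hi
  · exact Finset.sum_nonneg fun j _ => by split_ifs <;> norm_num

lemma prob_exists_mem_le_card (S : Finset ι) (p : ι → Ω → Prop) {c : ℝ}
    (h : ∀ i ∈ S, prob (p i) ≤ c) : prob (fun ω => ∃ i ∈ S, p i ω) ≤ S.card * c := by
  refine (prob_exists_mem_le S p).trans ((Finset.sum_le_sum h).trans ?_)
  simp

lemma prob_exists_le_card [Fintype ι] (p : ι → Ω → Prop) {c : ℝ}
    (h : ∀ i, prob (p i) ≤ c) : prob (fun ω => ∃ i, p i ω) ≤ Fintype.card ι * c := by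
  have := prob_exists_mem_le_card univ p (fun i _ => h i)
  simpa using this

lemma prob_prod_le {p : α → Prop} {r : α → β → Prop} {c : ℝ}
    (h : ∀ a, p a → prob (r a) ≤ c) :
    prob (fun x : α × β => p x.1 ∧ r x.1 x.2) ≤ c * prob p := by
  unfold prob
  rw [avg_prod, ← avg_mul_left]
  refine avg_mono fun a => ?_
  by_cases hp : p a
  · simpa [hp, prob] using h a hp
  · simp [hp, avg]

lemma prob_fst_le (p : α → Prop) : prob (fun x : α × β => p x.1) ≤ prob p := by
  unfold prob
  rw [avg_prod]
  refine avg_mono fun a => ?_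
  refine avg_le_of_le (by split_ifs <;> norm_num) fun _ => le_rfl

lemma exists_of_prob_pos {p : Ω → Prop} (h : 0 < prob p) : ∃ ω, p ω := by
  by_contra hn
  push Not at hn
  simp [prob, avg, hn] at h

lemma prob_true [Nonempty Ω] : prob (fun _ : Ω => True) = 1 := by
  simp [prob, avg_const]

lemma prob_split (p r : Ω → Prop) :
    prob p = prob (fun ω => p ω ∧ r ω) + prob (fun ω => p ω ∧ ¬ r ω) := by
  unfold prob
  rw [← avg_add]
  congr 1
  funext ω
  by_cases hp : p ω <;> by_cases hr : r ω <;> simp [hp, hr]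

lemma prob_not [Nonempty Ω] (p : Ω → Prop) : prob (fun ω => ¬ p ω) = 1 - prob p := by
  have := prob_split (fun _ : Ω => True) p
  rw [prob_true] at this
  simp only [true_and] at this
  linarith

end Prob

section Pi
variable {ι X : Type*} [Fintype ι] [DecidableEq ι] [Fintype X]

lemma avg_resample (i : ι) (f : (ι → X) → ℝ) :
    avg f = avg fun ω => avg fun x => f (Function.update ω i x) := by
  rcases isEmpty_or_nonempty X with h | h
  · have : IsEmpty (ι → X) := ⟨fun ω => h.false (ω i)⟩
    simp [avg]
  set e := Equiv.funSplitAt i X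
  have key : ∀ F : (ι → X) → ℝ, avg F = avg fun y : X × ({j // j ≠ i} → X) => F (e.symm y) :=
    fun F => (avg_equiv e.symm F).symm
  have hup : ∀ (a x : X) (g : {j // j ≠ i} → X),
      Function.update (e.symm (a, g)) i x = e.symm (x, g) := by
    intro a x g
    funext j
    by_cases hj : j = i
    · subst hj; simp [e, Equiv.funSplitAt, Equiv.piSplitAt]
    · simp [e, Equiv.funSplitAt, Equiv.piSplitAt, hj]
  rw [key f, key (fun ω => _)]
  rw [avg_prod, avg_prod]
  simp_rw [hup]
  rw [avg_const, avg_comm]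

lemma avg_prod_le (F : Finset ι) (g : ι → X → ℝ) (hg : ∀ i x, 0 ≤ g i x) :
    avg (fun ω : ι → X => ∏ i ∈ F, g i (ω i)) ≤ ∏ i ∈ F, avg (g i) := by
  induction F using Finset.induction_on with
  | empty => simpa using avg_const_le (Ω := ι → X) zero_le_one
  | insert i F hi ih =>
    rw [avg_resample i, Finset.prod_insert hi]
    have : (fun ω : ι → X => avg fun x => ∏ j ∈ insert i F, g j (Function.update ω i x j))
        = fun ω => avg (g i) * ∏ j ∈ F, g j (ω j) := by
      funext ω
      rw [← avg_mul_right]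
      congr 1
      funext x
      rw [Finset.prod_insert hi]
      simp only [Function.update_self]
      congr 1
      refine Finset.prod_congr rfl fun j hj => ?_
      rw [Function.update_of_ne (by rintro rfl; exact hi hj)]
    rw [this, avg_mul_left]
    exact mul_le_mul_of_nonneg_left ih (avg_nonneg fun x => hg i x)

lemma prob_forall_mem_le (F : Finset ι) (P : ι → X → Prop) {p : ℝ}
    (h : ∀ i ∈ F, prob (P i) ≤ p) :
    prob (fun ω : ι → X => ∀ i ∈ F, P i (ω i)) ≤ p ^ F.card := by
  have := avg_prod_le F (fun i x => if P i x then (1 : ℝ) else 0)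
    (fun i x => by split_ifs <;> norm_num)
  calc prob (fun ω : ι → X => ∀ i ∈ F, P i (ω i))
      ≤ avg (fun ω : ι → X => ∏ i ∈ F, if P i (ω i) then (1 : ℝ) else 0) := by
        refine avg_mono fun ω => ?_
        split_ifs with h
        · rw [Finset.prod_congr rfl (fun i hi => if_pos (h i hi))]; simp
        · exact Finset.prod_nonneg fun i _ => by split_ifs <;> norm_num
    _ ≤ ∏ i ∈ F, avg (fun x => if P i x then (1 : ℝ) else 0) := this
    _ ≤ ∏ i ∈ F, p := Finset.prod_le_prod (fun i _ => prob_nonneg (P i)) h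
    _ = p ^ F.card := by simp

/-- Chernoff's bound for the number of hit coordinates. -/
lemma chernoff (S : Finset ι) (P : ι → X → Prop) {p x : ℝ} {n t : ℕ} (hp : 0 ≤ p) (hx : 1 ≤ x)
    (hS : S.card ≤ n) (h : ∀ i ∈ S, prob (P i) ≤ p) :
    prob (fun ω : ι → X => t ≤ (S.filter fun i => P i (ω i)).card)
      ≤ (1 + p * (x - 1)) ^ n / x ^ t := by
  have hx0 : 0 < x := by linarith
  rw [le_div_iff₀ (by positivity)]
  have hb : 1 ≤ 1 + p * (x - 1) := by nlinarith
  calc prob (fun ω : ι → X => t ≤ (S.filter fun i => P i (ω i)).card) * x ^ t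
      ≤ avg (fun ω : ι → X => ∏ i ∈ S, if P i (ω i) then x else 1) := by
        unfold prob
        rw [← avg_mul_right]
        refine avg_mono fun ω => ?_
        rw [Finset.prod_ite]
        simp only [prod_const, one_pow, mul_one]
        split_ifs with h
        · rw [one_mul]; exact pow_le_pow_right₀ hx h
        · rw [zero_mul]; positivity
    _ ≤ ∏ i ∈ S, avg (fun y => if P i y then x else 1) :=
        avg_prod_le S (fun i y => if P i y then x else 1) (fun i y => by
          split_ifs <;> linarith)
    _ ≤ ∏ i ∈ S, (1 + p * (x - 1)) := by
        refine Finset.prod_le_prod (fun i _ => avg_nonneg fun y => by split_ifs <;> linarith) ?_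
        intro i hi
        have e1 : (fun y => if P i y then x else 1)
            = fun y => 1 + (if P i y then (1 : ℝ) else 0) * (x - 1) := by
          funext y; split_ifs <;> ring
        rw [e1, avg_add, avg_mul_right]
        have := avg_const_le (Ω := X) zero_le_one
        have h2 : avg (fun y => if P i y then (1 : ℝ) else 0) ≤ p := h i hi
        nlinarith
    _ = (1 + p * (x - 1)) ^ S.card := by simp
    _ ≤ _ := pow_le_pow_right₀ hb hS

/-- Events that depend on an initial segment of the coordinates and are unlikely given the past
are jointly unlikely. -/
lemma prob_forall_seq_le {m : ℕ} (B : Fin m → (Fin m → X) → Prop) {p : ℝ} (hp : 0 ≤ p)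
    (J : Finset (Fin m))
    (hdep : ∀ j (ω ω' : Fin m → X), (∀ i ≤ j, ω i = ω' i) → B j ω → B j ω')
    (h : ∀ j ω, prob (fun x => B j (Function.update ω j x)) ≤ p) :
    prob (fun ω => ∀ j ∈ J, B j ω) ≤ p ^ J.card := by
  induction J using Finset.induction_on_max with
  | empty => simpa using prob_le_one _
  | insert j J hj ih =>
    have hjJ : j ∉ J := fun hh => lt_irrefl _ (hj j hh)
    rw [Finset.card_insert_of_notMem hjJ, pow_succ, mul_comm]
    refine le_trans ?_ (mul_le_mul_of_nonneg_left ih hp)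
    unfold prob
    rw [avg_resample j, ← avg_mul_left]
    refine avg_mono fun ω => ?_
    by_cases hJ : ∀ i ∈ J, B i ω
    · rw [if_pos hJ, mul_one]
      exact (prob_mono fun x hx => hx j (mem_insert_self _ _)).trans (h j ω)
    · rw [if_neg hJ, mul_zero]
      refine avg_le_of_le le_rfl fun x => ?_
      rw [if_neg]
      intro hx
      refine hJ fun i hi => hdep i _ _ (fun k hk => ?_) (hx i (mem_insert_of_mem hi))
      rw [Function.update_of_ne (ne_of_lt (hk.trans_lt (hj i hi)))]

/-- Events determined by disjoint sets of coordinates are independent. -/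
lemma prob_and_eq_mul (S : Set ι) (p r : (ι → X) → Prop)
    (hp : ∀ ω ω' : ι → X, (∀ i ∈ S, ω i = ω' i) → p ω → p ω')
    (hr : ∀ ω ω' : ι → X, (∀ i ∉ S, ω i = ω' i) → r ω → r ω') :
    prob (fun ω => p ω ∧ r ω) = prob p * prob r := by
  rcases isEmpty_or_nonempty (ι → X) with h | h
  · simp [prob, avg]
  let mix : (ι → X) → (ι → X) → (ι → X) := fun a b i => if i ∈ S then a i else b i
  have hmm : ∀ a b, mix (mix a b) (mix b a) = a := by
    intro a b; funext i; by_cases hi : i ∈ S <;> simp [mix, hi]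
  let e : (ι → X) × (ι → X) ≃ (ι → X) × (ι → X) :=
    ⟨fun x => (mix x.1 x.2, mix x.2 x.1), fun x => (mix x.1 x.2, mix x.2 x.1),
      fun x => Prod.ext (hmm _ _) (hmm _ _), fun x => Prod.ext (hmm _ _) (hmm _ _)⟩
  have h1 : prob (fun x : (ι → X) × (ι → X) => p x.1 ∧ r x.2) = prob p * prob r := by
    unfold prob
    rw [avg_prod, ← avg_mul_right]
    congr 1
    funext a
    rw [← avg_mul_left]
    congr 1
    funext b
    by_cases ha : p a <;> by_cases hb : r b <;> simp [ha, hb]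
  rw [← h1, ← prob_equiv e]
  have h2 : ∀ x : (ι → X) × (ι → X), (p (e x).1 ∧ r (e x).2) ↔ (p x.1 ∧ r x.1) := by
    intro x
    have ep : p (e x).1 ↔ p x.1 := by
      constructor <;> refine hp _ _ fun i hi => ?_ <;> simp [e, mix, hi]
    have er : r (e x).2 ↔ r x.1 := by
      constructor <;> refine hr _ _ fun i hi => ?_ <;> simp [e, mix, hi]
    rw [ep, er]
  rw [prob_congr h2]
  unfold prob
  rw [avg_prod]
  congr 1
  funext a
  exact (avg_const _).symm

end Pi

/-- The symmetric Lovász local lemma. -/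
lemma local_lemma {Ω V : Type*} [Fintype Ω] [Nonempty Ω] [Fintype V] (A : V → Ω → Prop)
    (Γ : V → Finset V) {p : ℝ} {n : ℕ} (hn : 1 ≤ n) (hΓ : ∀ v, (Γ v).card ≤ n)
    (hA : ∀ v, prob (A v) ≤ p) (hp : 4 * p * n ≤ 1) (hp0 : 0 ≤ p)
    (hind : ∀ v (U : Finset V), Disjoint U (Γ v) →
      prob (fun ω => A v ω ∧ ∀ u ∈ U, ¬ A u ω) ≤ prob (A v) * prob (fun ω => ∀ u ∈ U, ¬ A u ω)) :
    ∃ ω, ∀ v, ¬ A v ω := by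
  have hn' : (1 : ℝ) ≤ n := by exact_mod_cast hn
  have hp4 : 4 * p ≤ 1 := by nlinarith
  have main : ∀ k : ℕ, ∀ U : Finset V, U.card = k →
      0 < prob (fun ω => ∀ u ∈ U, ¬ A u ω) ∧
      ∀ v, prob (fun ω => A v ω ∧ ∀ u ∈ U, ¬ A u ω)
        ≤ 2 * p * prob (fun ω => ∀ u ∈ U, ¬ A u ω) := by
    intro k
    induction k using Nat.strong_induction_on with
    | _ k ih =>
    intro U hU
    have hpos : 0 < prob (fun ω => ∀ u ∈ U, ¬ A u ω) := by
      rcases U.eq_empty_or_nonempty with rfl | ⟨u, hu⟩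
      · simp [prob_true]
      · have hlt : (U.erase u).card < k := by rw [← hU]; exact card_erase_lt_of_mem hu
        obtain ⟨h1, h2⟩ := ih _ hlt _ rfl
        have h3 := prob_split (fun ω => ∀ u' ∈ U.erase u, ¬ A u' ω) (A u)
        have h4 := h2 u
        have h5 : prob (fun ω => (∀ u' ∈ U.erase u, ¬ A u' ω) ∧ A u ω)
            = prob (fun ω => A u ω ∧ ∀ u' ∈ U.erase u, ¬ A u' ω) :=
          prob_congr fun ω => and_comm
        have h6 : prob (fun ω => (∀ u' ∈ U.erase u, ¬ A u' ω) ∧ ¬ A u ω)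
            = prob (fun ω => ∀ u' ∈ U, ¬ A u' ω) := by
          refine prob_congr fun ω => ⟨fun ⟨ha, hb⟩ u' hu' => ?_, fun hh => ⟨fun u' hu' =>
            hh u' (mem_of_mem_erase hu'), hh u hu⟩⟩
          by_cases he : u' = u
          · rwa [he]
          · exact ha u' (mem_erase.2 ⟨he, hu'⟩)
        rw [h5, h6] at h3
        nlinarith
    refine ⟨hpos, fun v => ?_⟩
    have hdisj : Disjoint (U \ Γ v) (Γ v) := sdiff_disjoint
    have hstep := (hind v _ hdisj).trans
      (mul_le_mul_of_nonneg_right (hA v) (prob_nonneg _))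
    have hmono : prob (fun ω => A v ω ∧ ∀ u ∈ U, ¬ A u ω)
        ≤ prob (fun ω => A v ω ∧ ∀ u ∈ U \ Γ v, ¬ A u ω) :=
      prob_mono fun ω ⟨h1, h2⟩ => ⟨h1, fun u hu => h2 u (mem_sdiff.1 hu).1⟩
    have hhalf : prob (fun ω => ∀ u ∈ U \ Γ v, ¬ A u ω)
        ≤ 2 * prob (fun ω => ∀ u ∈ U, ¬ A u ω) := by
      rcases (U ∩ Γ v).eq_empty_or_nonempty with he | hne
      · have : U \ Γ v = U := by
          rw [← sdiff_inter_self_left, he, sdiff_empty]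
        rw [this]; linarith
      · have hlt : (U \ Γ v).card < k := by
          rw [← hU]
          refine card_lt_card ⟨sdiff_subset, fun hsub => ?_⟩
          obtain ⟨u, hu⟩ := hne
          exact (mem_sdiff.1 (hsub (mem_inter.1 hu).1)).2 (mem_inter.1 hu).2
        obtain ⟨-, h2⟩ := ih _ hlt _ rfl
        have h3 := prob_split (fun ω => ∀ u ∈ U \ Γ v, ¬ A u ω) (fun ω => ∃ u ∈ U ∩ Γ v, A u ω)
        have h4 : prob (fun ω => (∀ u ∈ U \ Γ v, ¬ A u ω) ∧ ∃ u ∈ U ∩ Γ v, A u ω)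
            ≤ (U ∩ Γ v).card * (2 * p * prob (fun ω => ∀ u ∈ U \ Γ v, ¬ A u ω)) := by
          refine le_trans (prob_mono ?_) (prob_exists_mem_le_card (U ∩ Γ v)
            (fun u ω => A u ω ∧ ∀ u ∈ U \ Γ v, ¬ A u ω) fun u _ => h2 u)
          rintro ω ⟨ha, u, hu, hb⟩
          exact ⟨u, hu, hb, ha⟩
        have h5 : prob (fun ω => (∀ u ∈ U \ Γ v, ¬ A u ω) ∧ ¬ ∃ u ∈ U ∩ Γ v, A u ω)
            ≤ prob (fun ω => ∀ u ∈ U, ¬ A u ω) := by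
          refine prob_mono ?_
          rintro ω ⟨ha, hb⟩ u hu hu'
          by_cases hv : u ∈ Γ v
          · exact hb ⟨u, mem_inter.2 ⟨hu, hv⟩, hu'⟩
          · exact ha u (mem_sdiff.2 ⟨hu, hv⟩) hu'
        have h6 : ((U ∩ Γ v).card : ℝ) ≤ n := by
          exact_mod_cast (card_le_card inter_subset_right).trans (hΓ v)
        set z := prob (fun ω => ∀ u ∈ U \ Γ v, ¬ A u ω) with hz
        have hz0 : 0 ≤ z := prob_nonneg _
        have h7 : ((U ∩ Γ v).card : ℝ) * (2 * p * z) ≤ n * (2 * p * z) :=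
          mul_le_mul_of_nonneg_right h6 (by positivity)
        have h8 : (n : ℝ) * (2 * p * z) ≤ z / 2 := by nlinarith
        linarith
    have := mul_le_mul_of_nonneg_left hhalf hp0
    linarith
  obtain ⟨h, -⟩ := main _ (univ : Finset V) rfl
  obtain ⟨ω, hω⟩ := exists_of_prob_pos h
  exact ⟨ω, fun v => hω v (mem_univ v)⟩

end AEC

namespace AEC
open scoped Classical
open Finset

section Pick
variable {s : ℕ}

/-- The first colour of `S` in the order given by the seed `σ`. -/
noncomputable def pick (σ : Equiv.Perm (Fin s)) (S : Finset (Fin s)) : Option (Fin s) :=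
  if h : (S.map σ.toEmbedding).Nonempty then some (σ.symm ((S.map σ.toEmbedding).min' h)) else none

lemma mem_of_pick {σ : Equiv.Perm (Fin s)} {S : Finset (Fin s)} {c : Fin s}
    (h : pick σ S = some c) : c ∈ S := by
  unfold pick at h
  split_ifs at h with h1
  have h2 := Finset.min'_mem _ h1
  rw [Finset.mem_map] at h2
  obtain ⟨a, ha, hb⟩ := h2
  rw [← hb] at h
  simp at h
  rwa [← h]

lemma pick_eq_none {σ : Equiv.Perm (Fin s)} {S : Finset (Fin s)} : pick σ S = none ↔ S = ∅ := by
  unfold pick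
  split_ifs with h
  · simp only [false_iff]
    rintro rfl
    simp at h
  · simp only [true_iff]
    simpa using h

lemma pick_equivariant (σ τ : Equiv.Perm (Fin s)) (S : Finset (Fin s)) :
    pick (τ.symm.trans σ) (S.map τ.toEmbedding) = (pick σ S).map τ := by
  have h1 : (S.map τ.toEmbedding).map (τ.symm.trans σ).toEmbedding = S.map σ.toEmbedding := by
    rw [Finset.map_map]
    congr 1
    ext x
    simp
  unfold pick
  simp only [h1]
  split_ifs with h
  · simp
  · simp

end Pick

section Greedy
variable {ι : Type*} {s : ℕ}

/-- The greedy colouring: an active item takes its favourite colour among those not used by the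
conflicting items of smaller time. -/
noncomputable def phi (act : ι → Prop) (K : ι → ι → Prop) (tm : ι → ℕ)
    (σ : ι → Equiv.Perm (Fin s)) (e : ι) : Option (Fin s) :=
  if act e then
    pick (σ e) (univ.filter fun c => ∀ f, (_ : tm f < tm e) → K e f → phi act K tm σ f ≠ some c)
  else none
termination_by tm e

/-- `f` precedes `e` and conflicts with it. -/
def Pred (K : ι → ι → Prop) (tm : ι → ℕ) (e f : ι) : Prop := tm f < tm e ∧ K e f

/-- The set of items that the colour of `e` depends on. -/
def Dep (K : ι → ι → Prop) (tm : ι → ℕ) (e : ι) : Set ι :=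
  {f | Relation.ReflTransGen (Pred K tm) e f}

/-- Colours not used by the predecessors. -/
noncomputable def avail (act : ι → Prop) (K : ι → ι → Prop) (tm : ι → ℕ)
    (σ : ι → Equiv.Perm (Fin s)) (e : ι) : Finset (Fin s) :=
  univ.filter fun c => ∀ f, Pred K tm e f → phi act K tm σ f ≠ some c

variable {act act' : ι → Prop} {K K' : ι → ι → Prop} {tm tm' : ι → ℕ}
  {σ σ' : ι → Equiv.Perm (Fin s)} {e f : ι}

lemma phi_eq : phi act K tm σ e = if act e then pick (σ e) (avail act K tm σ e) else none := by
  rw [phi]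
  congr 2
  ext c
  simp [avail, Pred]

lemma mem_dep_self : e ∈ Dep K tm e := Relation.ReflTransGen.refl

lemma tm_le_of_mem_dep (h : f ∈ Dep K tm e) : tm f ≤ tm e := by
  induction h with
  | refl => exact le_rfl
  | tail _ h ih => exact h.1.le.trans ih

lemma phi_act {c : Fin s} (h : phi act K tm σ e = some c) : act e := by
  rw [phi_eq] at h
  by_contra hn
  simp [hn] at h

lemma phi_ne_of_pred {c : Fin s} (h : Pred K tm e f) (h1 : phi act K tm σ e = some c) :
    phi act K tm σ f ≠ some c := by
  have ha := phi_act h1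
  rw [phi_eq, if_pos ha] at h1
  have := mem_of_pick h1
  simp only [avail, mem_filter] at this
  exact this.2 f h

lemma phi_eq_none_iff (ha : act e) : phi act K tm σ e = none ↔ avail act K tm σ e = ∅ := by
  rw [phi_eq, if_pos ha, pick_eq_none]

/-- The colouring is equivariant on a set that is closed under predecessors. -/
lemma phi_equivariant (τ : Equiv.Perm (Fin s)) (W : Set ι)
    (hcl : ∀ e ∈ W, ∀ f, Pred K tm e f → f ∈ W)
    (hact : ∀ e ∈ W, (act e ↔ act' e)) (hpr : ∀ e ∈ W, ∀ f, Pred K tm e f ↔ Pred K' tm' e f)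
    (hσ : ∀ e ∈ W, σ' e = τ.symm.trans (σ e)) :
    ∀ e ∈ W, phi act' K' tm' σ' e = (phi act K tm σ e).map τ := by
  have main : ∀ n, ∀ e ∈ W, tm e ≤ n → phi act' K' tm' σ' e = (phi act K tm σ e).map τ := by
    intro n
    induction n using Nat.strong_induction_on with
    | _ n ih =>
    intro e he hn
    rw [phi_eq, phi_eq]
    by_cases ha : act e
    · rw [if_pos ha, if_pos ((hact e he).1 ha), hσ e he, ← pick_equivariant]
      congr 1
      ext c
      simp only [avail, mem_filter, mem_univ, true_and, Finset.mem_map_equiv]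
      refine forall_congr' fun f => ?_
      rw [← hpr e he f]
      refine imp_congr_right fun hf => ?_
      rw [ih (tm f) (hf.1.trans_le hn) f (hcl e he f hf) le_rfl, not_iff_not]
      constructor
      · intro h
        rw [Option.map_eq_some_iff] at h
        obtain ⟨a, h1, h2⟩ := h
        rw [h1, ← h2]; simp
      · intro h
        rw [h]; simp
    · rw [if_neg ha, if_neg (fun h => ha ((hact e he).2 h))]
      rfl
  exact fun e he => main _ e he le_rfl

lemma phi_congr (W : Set ι)
    (hcl : ∀ e ∈ W, ∀ f, Pred K tm e f → f ∈ W)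
    (hact : ∀ e ∈ W, (act e ↔ act' e)) (hpr : ∀ e ∈ W, ∀ f, Pred K tm e f ↔ Pred K' tm' e f)
    (hσ : ∀ e ∈ W, σ' e = σ e) :
    ∀ e ∈ W, phi act' K' tm' σ' e = phi act K tm σ e := by
  intro e he
  rw [phi_equivariant (σ := σ) (Equiv.refl _) W hcl hact hpr (fun e he => by simp [hσ e he]) e he]
  simp

end Greedy

section PermLemma
variable {s : ℕ}

lemma prob_perm_le (A B : Finset (Fin s)) :
    prob (fun τ : Equiv.Perm (Fin s) => ∀ x ∈ A, τ x ∉ B)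
      ≤ (1 - (B.card : ℝ) / s) ^ A.card := by
  induction A using Finset.induction_on with
  | empty => simpa using prob_le_one _
  | insert a A ha ih =>
    rcases Nat.eq_zero_or_pos s with rfl | hs
    · exact a.elim0
    have hs' : (0 : ℝ) < s := by exact_mod_cast hs
    set Z : Equiv.Perm (Fin s) → Prop := fun τ => ∀ x ∈ A, τ x ∉ B with hZ
    -- the probability that `a` goes to `z`
    let N : Fin s → ℝ := fun z => prob (fun τ : Equiv.Perm (Fin s) => Z τ ∧ τ a = z)
    have hsum : prob Z = ∑ z, N z := by
      show _ = ∑ z, avg _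
      rw [← avg_sum]
      unfold prob
      congr 1
      funext τ
      by_cases h : Z τ
      · simp [h]
      · simp [h]
    have hle : ∀ z ∈ B, ∀ z', N z' ≤ N z := by
      intro z hz z'
      change prob _ ≤ prob _
      rw [← prob_equiv (Equiv.mulLeft (Equiv.swap z z')) fun τ => Z τ ∧ τ a = z]
      refine prob_mono fun τ ⟨h1, h2⟩ => ?_
      refine ⟨fun x hx => ?_, by simp [h2]⟩
      have h3 : τ x ≠ z := fun h => h1 x hx (h ▸ hz)
      have h4 : τ x ≠ z' := fun h => ha (τ.injective (h.trans h2.symm) ▸ hx)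
      simpa [Equiv.swap_apply_of_ne_of_ne h3 h4] using h1 x hx
    have hz : ∀ z ∈ B, prob Z / s ≤ N z := by
      intro z hz
      rw [div_le_iff₀ hs', hsum]
      calc ∑ z', N z' ≤ ∑ _z' : Fin s, N z := Finset.sum_le_sum fun z' _ => hle z hz z'
        _ = N z * s := by simp [mul_comm]
    have hB : (B.card : ℝ) / s * prob Z ≤ prob (fun τ => Z τ ∧ τ a ∈ B) := by
      have h1 : prob (fun τ => Z τ ∧ τ a ∈ B) = ∑ z ∈ B, N z := by
        change _ = ∑ z ∈ B, avg _
        rw [← avg_sum]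
        unfold prob
        congr 1
        funext τ
        by_cases h : Z τ <;> simp [h]
      rw [h1]
      calc (B.card : ℝ) / s * prob Z = ∑ _z ∈ B, prob Z / s := by simp; ring
        _ ≤ _ := Finset.sum_le_sum hz
    have h1 := prob_split Z fun τ => τ a ∈ B
    have h2 : prob (fun τ => Z τ ∧ ¬ τ a ∈ B)
        = prob (fun τ : Equiv.Perm (Fin s) => ∀ x ∈ insert a A, τ x ∉ B) :=
      prob_congr fun τ => by simp [hZ, and_comm]
    have hBs : (B.card : ℝ) / s ≤ 1 := by
      rw [div_le_one hs']
      exact_mod_cast (card_le_univ B).trans (by simp)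
    rw [card_insert_of_notMem ha, pow_succ, ← h2]
    nlinarith

end PermLemma

section Colours
variable {ι : Type*} {s : ℕ} {act : ι → Prop} {K : ι → ι → Prop} {tm : ι → ℕ}

/-- The action of a family of colour permutations on the seeds. -/
def reseed (T : ι → Equiv.Perm (Fin s)) : (ι → Equiv.Perm (Fin s)) ≃ (ι → Equiv.Perm (Fin s)) where
  toFun σ e := (T e).symm.trans (σ e)
  invFun σ e := (T e).trans (σ e)
  left_inv σ := by funext e; ext x; simp
  right_inv σ := by funext e; ext x; simp

lemma phi_reseed (T : ι → Equiv.Perm (Fin s)) (σ : ι → Equiv.Perm (Fin s)) (e : ι)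
    (τ : Equiv.Perm (Fin s)) (h : ∀ f ∈ Dep K tm e, T f = τ) :
    phi act K tm (reseed T σ) e = (phi act K tm σ e).map τ :=
  phi_equivariant τ (Dep K tm e) (fun _ hf _ hg => Relation.ReflTransGen.tail hf hg)
    (fun _ _ => Iff.rfl) (fun _ _ _ => Iff.rfl) (fun f hf => by simp [reseed, h f hf]) e mem_dep_self

variable [Fintype ι] [DecidableEq ι]

lemma prob_phi_eq_le (F : Finset ι)
    (hF : ∀ f ∈ F, ∀ f' ∈ F, f ≠ f' → Disjoint (Dep K tm f) (Dep K tm f')) (c : Fin s) :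
    prob (fun σ : ι → Equiv.Perm (Fin s) => ∀ f ∈ F, phi act K tm σ f = some c)
      ≤ (1 / s : ℝ) ^ F.card := by
  let N : (ι → Fin s) → ℝ := fun γ =>
    prob (fun σ : ι → Equiv.Perm (Fin s) => ∀ f ∈ F, phi act K tm σ f = some (γ f))
  have hN : ∀ γ, N (fun _ => c) ≤ N γ := by
    intro γ
    let T : ι → Equiv.Perm (Fin s) := fun e =>
      if h : ∃ f ∈ F, e ∈ Dep K tm f then Equiv.swap c (γ h.choose) else 1
    have hT : ∀ f ∈ F, ∀ e ∈ Dep K tm f, T e = Equiv.swap c (γ f) := by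
      intro f hf e he
      have h : ∃ f ∈ F, e ∈ Dep K tm f := ⟨f, hf, he⟩
      simp only [T, dif_pos h]
      have : h.choose = f := by
        by_contra hne
        exact Set.disjoint_left.1 (hF _ h.choose_spec.1 f hf hne) h.choose_spec.2 he
      rw [this]
    change prob _ ≤ prob _
    rw [← prob_equiv (reseed T) fun σ => ∀ f ∈ F, phi act K tm σ f = some (γ f)]
    refine prob_mono fun σ h f hf => ?_
    rw [phi_reseed T σ f _ (hT f hf), h f hf]
    simp
  have : Nonempty (ι → Fin s) := ⟨fun _ => c⟩
  calc N (fun _ => c) = avg (fun _ : ι → Fin s => N fun _ => c) := (avg_const _).symm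
    _ ≤ avg N := avg_mono hN
    _ = avg (fun σ : ι → Equiv.Perm (Fin s) => prob fun γ : ι → Fin s =>
          ∀ f ∈ F, phi act K tm σ f = some (γ f)) := avg_comm _
    _ ≤ (1 / s : ℝ) ^ F.card := by
      refine avg_le_of_le (by positivity) fun σ => ?_
      refine prob_forall_mem_le F (fun f x => phi act K tm σ f = some x) fun f _ => ?_
      rw [prob_eq_card, Fintype.card_fin]
      gcongr
      norm_cast
      refine card_le_one.2 fun a ha b hb => ?_
      simp only [mem_filter, mem_univ, true_and] at ha hb
      exact Option.some_injective _ (ha.symm.trans hb)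

lemma prob_same_colour_le (F : Finset ι)
    (hF : ∀ f ∈ F, ∀ f' ∈ F, f ≠ f' → Disjoint (Dep K tm f) (Dep K tm f')) :
    prob (fun σ : ι → Equiv.Perm (Fin s) => ∃ c, ∀ f ∈ F, phi act K tm σ f = some c)
      ≤ s * (1 / s : ℝ) ^ F.card := by
  simpa using prob_exists_le_card
    (fun (c : Fin s) (σ : ι → Equiv.Perm (Fin s)) => ∀ f ∈ F, phi act K tm σ f = some c)
    (fun c => prob_phi_eq_le F hF c)

/-- An active item whose predecessors split into two small independent groups is likely to be
coloured. -/
lemma prob_uncoloured_le {e : ι} (he : act e) (Pu Pv : Finset ι) {B b : ℕ}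
    (hP : ∀ f, Pred K tm e f → f ∈ Pu ∨ f ∈ Pv) (hu : Pu.card ≤ B) (hv : Pv.card ≤ B)
    (hb : b + B ≤ s)
    (hd : ∀ f ∈ Pu, ∀ f' ∈ Pv, Disjoint (Dep K tm f) (Dep K tm f')) :
    prob (fun σ : ι → Equiv.Perm (Fin s) => phi act K tm σ e = none)
      ≤ (1 - (b : ℝ) / s) ^ b := by
  have hbs : b ≤ s := by omega
  have hq : 0 ≤ 1 - (b : ℝ) / s := by
    rcases Nat.eq_zero_or_pos s with h | h
    · simp [h]
    · rw [sub_nonneg, div_le_one (by exact_mod_cast h)]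
      exact_mod_cast hbs
  let W : Set ι := {f | ∃ g ∈ Pu, f ∈ Dep K tm g}
  let T : Equiv.Perm (Fin s) → ι → Equiv.Perm (Fin s) := fun τ f => if f ∈ W then τ else 1
  have h0 : ∀ σ τ, ∀ f ∈ Pu, phi act K tm (reseed (T τ) σ) f = (phi act K tm σ f).map τ := by
    intro σ τ f hf
    refine phi_reseed _ _ _ _ fun g hg => ?_
    exact if_pos ⟨f, hf, hg⟩
  have h1 : ∀ σ τ, ∀ f ∈ Pv, phi act K tm (reseed (T τ) σ) f = phi act K tm σ f := by
    intro σ τ f hf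
    rw [phi_reseed _ _ _ 1 fun g hg => ?_]
    · simp
    · refine if_neg ?_
      rintro ⟨f', hf', hg'⟩
      exact Set.disjoint_left.1 (hd f' hf' f hf) hg' hg
  have hcard : ∀ (σ : ι → Equiv.Perm (Fin s)) (P : Finset ι), P.card ≤ B →
      b ≤ (univ.filter fun c => ∀ f ∈ P, phi act K tm σ f ≠ some c).card := by
    intro σ P hPB
    have h2 : (univ.filter fun c => ¬ ∀ f ∈ P, phi act K tm σ f ≠ some c).card ≤ P.card := by
      have h3 : ((univ.filter fun c => ¬ ∀ f ∈ P, phi act K tm σ f ≠ some c).map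
          ⟨some, Option.some_injective _⟩) ⊆ P.image (phi act K tm σ) := by
        intro x hx
        simp only [mem_map, mem_filter, mem_univ, true_and, Function.Embedding.coeFn_mk] at hx
        obtain ⟨c, hc, rfl⟩ := hx
        push Not at hc
        obtain ⟨f, hf, hfc⟩ := hc
        exact mem_image.2 ⟨f, hf, hfc⟩
      have := card_le_card h3
      rw [card_map] at this
      exact this.trans card_image_le
    have h3 := card_filter_add_card_filter_not (s := (univ : Finset (Fin s)))
      (fun c => ∀ f ∈ P, phi act K tm σ f ≠ some c)
    simp only [card_univ, Fintype.card_fin] at h3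
    omega
  calc prob (fun σ : ι → Equiv.Perm (Fin s) => phi act K tm σ e = none)
      = avg (fun _ : Equiv.Perm (Fin s) =>
          prob (fun σ : ι → Equiv.Perm (Fin s) => phi act K tm σ e = none)) := (avg_const _).symm
    _ = avg (fun τ : Equiv.Perm (Fin s) => prob (fun σ : ι → Equiv.Perm (Fin s) =>
          phi act K tm (reseed (T τ) σ) e = none)) := by
        congr 1
        funext τ
        exact (prob_equiv (reseed (T τ)) fun σ => phi act K tm σ e = none).symm
    _ = avg (fun σ : ι → Equiv.Perm (Fin s) => prob (fun τ : Equiv.Perm (Fin s) =>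
          phi act K tm (reseed (T τ) σ) e = none)) := avg_comm _
    _ ≤ (1 - (b : ℝ) / s) ^ b := by
      refine avg_le_of_le (by positivity) fun σ => ?_
      set Au := univ.filter fun c => ∀ f ∈ Pu, phi act K tm σ f ≠ some c with hAu
      set Av := univ.filter fun c => ∀ f ∈ Pv, phi act K tm σ f ≠ some c with hAv
      have hAub := hcard σ Pu hu
      have hAvb := hcard σ Pv hv
      rw [← hAu] at hAub
      rw [← hAv] at hAvb
      have hq1 : 1 - (Av.card : ℝ) / s ≤ 1 - (b : ℝ) / s := by gcongr
      have hq0 : 0 ≤ 1 - (Av.card : ℝ) / s := by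
        rcases Nat.eq_zero_or_pos s with h | h
        · simp [h]
        · rw [sub_nonneg, div_le_one (by exact_mod_cast h)]
          exact_mod_cast (card_le_univ Av).trans (by simp)
      calc prob (fun τ : Equiv.Perm (Fin s) => phi act K tm (reseed (T τ) σ) e = none)
          ≤ prob (fun τ : Equiv.Perm (Fin s) => ∀ x ∈ Au, τ x ∉ Av) := by
            refine prob_mono fun τ h x hx hxv => ?_
            rw [phi_eq_none_iff he] at h
            have hne : τ x ∉ avail act K tm (reseed (T τ) σ) e := by rw [h]; simp
            refine hne ?_
            simp only [avail, mem_filter, mem_univ, true_and]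
            intro f hf
            rcases hP f hf with hfu | hfv
            · rw [h0 σ τ f hfu]
              intro hh
              rw [Option.map_eq_some_iff] at hh
              obtain ⟨y, hy, hyx⟩ := hh
              rw [τ.injective hyx] at hy
              exact (mem_filter.1 hx).2 f hfu hy
            · rw [h1 σ τ f hfv]
              exact (mem_filter.1 hxv).2 f hfv
        _ ≤ (1 - (Av.card : ℝ) / s) ^ Au.card := prob_perm_le _ _
        _ ≤ (1 - (Av.card : ℝ) / s) ^ b :=
            pow_le_pow_of_le_one hq0 (by
              have : (0 : ℝ) ≤ (Av.card : ℝ) / s := by positivity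
              linarith) hAub
        _ ≤ _ := pow_le_pow_left₀ hq0 hq1 b

end Colours
end AEC

namespace AEC
open scoped Classical
open Finset SimpleGraph

section Walks
variable {V : Type*} {G : SimpleGraph V} {g : ℕ}

/-- Every cycle of `G` has length at least `g`. -/
def GirthGe (G : SimpleGraph V) (g : ℕ) : Prop :=
  ∀ (v : V) (w : G.Walk v v), w.IsCycle → g ≤ w.length

lemma GirthGe.le_of_walk (hg : GirthGe G g) {u v : V} (h : G.Adj u v) (p : G.Walk v u)
    (hp : s(u, v) ∉ p.edges) : g ≤ p.length + 1 := by
  have h1 : (Walk.cons h p.bypass).IsCycle := by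
    rw [Walk.cons_isCycle_iff]
    exact ⟨p.bypass_isPath, fun hh => hp (p.edges_bypass_subset_edges hh)⟩
  have := hg _ _ h1
  rw [Walk.length_cons] at this
  have := p.length_bypass_le_length
  omega

lemma GirthGe.le_of_walk' (hg : GirthGe G g) {u v : V} (h : G.Adj u v) (p : G.Walk u v)
    (hp : s(u, v) ∉ p.edges) : g ≤ p.length + 1 := by
  have := hg.le_of_walk h p.reverse (by simpa using hp)
  simpa using this

lemma exists_walk_of_seq (v : ℕ → V) (i n : ℕ) (h : ∀ t, i ≤ t → t < i + n → G.Adj (v t) (v (t + 1))) :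
    ∃ p : G.Walk (v i) (v (i + n)), p.length = n ∧
      ∀ e ∈ p.edges, ∃ t, i ≤ t ∧ t < i + n ∧ e = s(v t, v (t + 1)) := by
  induction n with
  | zero => exact ⟨Walk.nil, rfl, by simp⟩
  | succ n ih =>
    obtain ⟨p, hp, he⟩ := ih fun t h1 h2 => h t h1 (by omega)
    refine ⟨p.concat (h (i + n) (by omega) (by omega)), by simp [hp], ?_⟩
    intro e hh
    rw [Walk.edges_concat, List.concat_eq_append, List.mem_append] at hh
    rcases hh with hh | hh
    · obtain ⟨t, h1, h2, h3⟩ := he e hh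
      exact ⟨t, h1, by omega, h3⟩
    · simp only [List.mem_singleton] at hh
      exact ⟨i + n, by omega, by omega, hh⟩

/-- Non-backtracking walks shorter than the girth are injective. -/
lemma GirthGe.seq_ne (hg : GirthGe G g) (v : ℕ → V) (n : ℕ) (h : ∀ t < n, G.Adj (v t) (v (t + 1)))
    (hb : ∀ t, t + 2 ≤ n → v (t + 2) ≠ v t) {i k : ℕ} (hk : 0 < k) (hkg : k < g) (hn : i + k ≤ n) :
    v i ≠ v (i + k) := by
  induction k using Nat.strong_induction_on generalizing i with
  | _ k ih =>
  intro heq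
  obtain ⟨p, hp, he⟩ := exists_walk_of_seq (G := G) v (i + 1) (k - 1)
    (fun t h1 h2 => h t (by omega))
  have hik : i + 1 + (k - 1) = i + k := by omega
  have := hg.le_of_walk (h i (by omega)) (p.copy rfl (by rw [hik, ← heq])) (by
    rw [Walk.edges_copy]
    intro hh
    obtain ⟨t, h1, h2, h3⟩ := he _ hh
    rw [Sym2.eq_iff] at h3
    rcases h3 with ⟨h3, -⟩ | ⟨h3, h4⟩
    · refine ih (t - i) (by omega) (by omega) (by omega) (by omega) (i := i) ?_
      rw [h3]; congr 1; omega
    · by_cases h5 : t = i + 1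
      · subst h5
        exact hb i (by omega) h3.symm
      · refine ih (t - (i + 1)) (by omega) (by omega) (by omega) (by omega) (i := i + 1) ?_
        rw [h4]; congr 1; omega)
  rw [Walk.length_copy] at this
  omega

lemma GirthGe.seq_edge_ne (hg : GirthGe G g) (v : ℕ → V) (n : ℕ)
    (h : ∀ t < n, G.Adj (v t) (v (t + 1)))
    (hb : ∀ t, t + 2 ≤ n → v (t + 2) ≠ v t) (hn : n < g) {i j : ℕ} (hij : i < j) (hj : j < n) :
    s(v i, v (i + 1)) ≠ s(v j, v (j + 1)) := by
  intro heq
  rw [Sym2.eq_iff] at heq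
  rcases heq with ⟨h1, -⟩ | ⟨h1, -⟩
  · refine hg.seq_ne v n h hb (i := i) (k := j - i) (by omega) (by omega) (by omega) ?_
    rw [h1]; congr 1; omega
  · refine hg.seq_ne v n h hb (i := i) (k := j + 1 - i) (by omega) (by omega) (by omega) ?_
    rw [h1]; congr 1; omega

end Walks

section Colouring
variable {V : Type*} {s : ℕ}

/-- Two distinct edges of `H` that share a vertex. -/
def conf (H : SimpleGraph V) (e f : Sym2 V) : Prop :=
  e ≠ f ∧ e ∈ H.edgeSet ∧ f ∈ H.edgeSet ∧ ∃ x, x ∈ e ∧ x ∈ f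

/-- Edges of `H` with no adjacent edge of the same time. -/
def actv (H : SimpleGraph V) (tm : Sym2 V → ℕ) (e : Sym2 V) : Prop :=
  e ∈ H.edgeSet ∧ ∀ f, conf H e f → tm f ≠ tm e

/-- The greedy partial edge colouring of `H`. -/
noncomputable def col (H : SimpleGraph V) (tm : Sym2 V → ℕ) (σ : Sym2 V → Equiv.Perm (Fin s)) :
    Sym2 V → Option (Fin s) :=
  phi (actv H tm) (conf H) tm σ

/-- Edges of `H` at distance more than `W`. -/
def far (H : SimpleGraph V) (W : ℕ) (e f : Sym2 V) : Prop :=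
  ∀ x ∈ e, ∀ y ∈ f, ∀ p : H.Walk x y, W < p.length

variable {H G : SimpleGraph V} {tm : Sym2 V → ℕ} {σ : Sym2 V → Equiv.Perm (Fin s)}
  {e f : Sym2 V} {c : Fin s} {W R g : ℕ}

lemma conf.symm (h : conf H e f) : conf H f e := by
  obtain ⟨h1, h2, h3, x, h4, h5⟩ := h
  exact ⟨h1.symm, h3, h2, x, h5, h4⟩

lemma col_mem (h : col H tm σ e = some c) : e ∈ H.edgeSet := (phi_act h).1

lemma col_proper (hc : conf H e f) (h : col H tm σ e = some c) : col H tm σ f ≠ some c := by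
  intro h'
  have he : actv H tm e := phi_act h
  rcases lt_or_gt_of_ne (he.2 f hc) with hlt | hlt
  · exact phi_ne_of_pred (K := conf H) ⟨hlt, hc⟩ h h'
  · exact phi_ne_of_pred (K := conf H) ⟨hlt, hc.symm⟩ h' h

lemma exists_walk_of_mem_dep (he : e ∈ H.edgeSet) (hf : f ∈ Dep (conf H) tm e) {x y : V}
    (hx : x ∈ e) (hy : y ∈ f) :
    ∃ p : H.Walk x y, p.length + tm f ≤ tm e + 1 ∧ ∀ a ∈ p.edges, tm a ≤ tm e := by
  induction hf generalizing y with
  | refl =>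
    by_cases hxy : x = y
    · subst hxy
      exact ⟨Walk.nil, by simp, by simp⟩
    · have : e = s(x, y) := ((Sym2.mem_and_mem_iff hxy).1 ⟨hx, hy⟩)
      subst this
      have he' : H.Adj x y := he
      exact ⟨Walk.cons he' Walk.nil, by simp; omega, by simp⟩
  | @tail b c hb hc ih =>
    obtain ⟨hlt, -, -, hcH, z, hzb, hzc⟩ := hc
    obtain ⟨p, hp, hpe⟩ := ih hzb
    by_cases hzy : z = y
    · subst hzy
      exact ⟨p, by omega, hpe⟩
    · have : c = s(z, y) := ((Sym2.mem_and_mem_iff hzy).1 ⟨hzc, hy⟩)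
      subst this
      have hcH' : H.Adj z y := hcH
      have hbe := tm_le_of_mem_dep (K := conf H) hb
      refine ⟨p.concat hcH', by rw [Walk.length_concat]; omega, ?_⟩
      intro a ha
      rw [Walk.edges_concat, List.concat_eq_append, List.mem_append, List.mem_singleton] at ha
      rcases ha with ha | rfl
      · exact hpe a ha
      · omega

lemma disjoint_dep_of_far (hR : ∀ e, tm e < R) (he : e ∈ H.edgeSet) (hf : f ∈ H.edgeSet)
    (h : far H (2 * R) e f) : Disjoint (Dep (conf H) tm e) (Dep (conf H) tm f) := by
  rw [Set.disjoint_left]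
  intro a ha hb
  induction e with | _ x x' =>
  induction f with | _ y y' =>
  induction a with | _ z z' =>
  obtain ⟨p, hp, -⟩ := exists_walk_of_mem_dep he ha (Sym2.mem_mk_left x x') (Sym2.mem_mk_left z z')
  obtain ⟨r, hr, -⟩ := exists_walk_of_mem_dep hf hb (Sym2.mem_mk_left y y') (Sym2.mem_mk_left z z')
  have := h x (Sym2.mem_mk_left _ _) y (Sym2.mem_mk_left _ _) (p.append r.reverse)
  rw [Walk.length_append, Walk.length_reverse] at this
  have h1 := hR s(x, x')
  have h2 := hR s(y, y')
  omega

lemma disjoint_dep_of_girth (hR : ∀ e, tm e < R) (hg : GirthGe H g) (hRg : 2 * R + 1 < g)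
    {u v : V} (huv : H.Adj u v) {e f : Sym2 V} (he : Pred (conf H) tm s(u, v) e)
    (hf : Pred (conf H) tm s(u, v) f) (hu : u ∈ e) (hv : v ∈ f) :
    Disjoint (Dep (conf H) tm e) (Dep (conf H) tm f) := by
  rw [Set.disjoint_left]
  intro a ha hb
  induction a with | _ z z' =>
  obtain ⟨p, hp, hp'⟩ := exists_walk_of_mem_dep he.2.2.2.1 ha hu (Sym2.mem_mk_left z z')
  obtain ⟨r, hr, hr'⟩ := exists_walk_of_mem_dep hf.2.2.2.1 hb hv (Sym2.mem_mk_left z z')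
  have := hg.le_of_walk' huv (p.append r.reverse) (by
    rw [Walk.edges_append, List.mem_append]
    rintro (h | h)
    · exact absurd (hp' _ h) (by have := he.1; omega)
    · rw [Walk.edges_reverse, List.mem_reverse] at h
      exact absurd (hr' _ h) (by have := hf.1; omega))
  rw [Walk.length_append, Walk.length_reverse] at this
  have h1 := hR e
  have h2 := hR f
  omega

variable [Fintype V]

/-- An active edge whose end vertices are not overfull is likely to be coloured. -/
lemma prob_col_none_le (hR : ∀ e, tm e < R) (hg : GirthGe H g) (hRg : 2 * R + 1 < g)
    {u v : V} (huv : actv H tm s(u, v)) {B b : ℕ} (hb : b + B ≤ s)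
    (hu : (univ.filter fun f : Sym2 V => f ∈ H.edgeSet ∧ u ∈ f ∧ f ≠ s(u, v)).card ≤ B)
    (hv : (univ.filter fun f : Sym2 V => f ∈ H.edgeSet ∧ v ∈ f ∧ f ≠ s(u, v)).card ≤ B) :
    prob (fun σ : Sym2 V → Equiv.Perm (Fin s) => col H tm σ s(u, v) = none)
      ≤ (1 - (b : ℝ) / s) ^ b := by
  have sub : ∀ x, (univ.filter fun f : Sym2 V => Pred (conf H) tm s(u, v) f ∧ x ∈ f)
      ⊆ univ.filter fun f : Sym2 V => f ∈ H.edgeSet ∧ x ∈ f ∧ f ≠ s(u, v) := by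
    intro x f hf
    simp only [mem_filter, mem_univ, true_and] at hf ⊢
    exact ⟨hf.1.2.2.2.1, hf.2, hf.1.2.1.symm⟩
  refine @prob_uncoloured_le (Sym2 V) s (actv H tm) (conf H) tm inferInstance inferInstance _ huv
    (univ.filter fun f : Sym2 V => Pred (conf H) tm s(u, v) f ∧ u ∈ f)
    (univ.filter fun f : Sym2 V => Pred (conf H) tm s(u, v) f ∧ v ∈ f) B b ?_
    ((card_le_card (sub u)).trans hu) ((card_le_card (sub v)).trans hv) hb ?_
  · intro f hf
    obtain ⟨-, -, -, x, hx, hxf⟩ := hf.2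
    rw [Sym2.mem_iff] at hx
    rcases hx with rfl | rfl
    · exact Or.inl (mem_filter.2 ⟨mem_univ _, hf, hxf⟩)
    · exact Or.inr (mem_filter.2 ⟨mem_univ _, hf, hxf⟩)
  · intro f hf f' hf'
    simp only [mem_filter, mem_univ, true_and] at hf hf'
    exact disjoint_dep_of_girth hR hg hRg huv.1 hf.1 hf'.1 hf.2 hf'.2

end Colouring
end AEC

namespace AEC
open scoped Classical
open Finset SimpleGraph

section Misc
variable {α β V : Type*}

lemma prob_le_of_forall_fst [Fintype α] [Fintype β] {r : α → β → Prop} {c : ℝ} (hc : 0 ≤ c)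
    (h : ∀ a, prob (r a) ≤ c) : prob (fun x : α × β => r x.1 x.2) ≤ c := by
  unfold prob
  rw [avg_prod]
  exact avg_le_of_le hc h

lemma prob_fin_lt_le (d D : ℕ) : prob (fun x : Fin d => (x : ℕ) < D) ≤ (D : ℝ) / d := by
  rw [prob_eq_card, Fintype.card_fin]
  gcongr
  have : (univ.filter fun x : Fin d => (x : ℕ) < D).map Fin.valEmbedding ⊆ range D := by
    intro x hx
    simp only [mem_map, mem_filter, mem_univ, true_and] at hx
    obtain ⟨y, hy, rfl⟩ := hx
    exact mem_range.2 hy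
  have := card_le_card this
  rw [card_map, card_range] at this
  refine le_trans (le_of_eq ?_) this
  congr

lemma exists_neighbour_enum [Fintype V] (G : SimpleGraph V) {d : ℕ}
    (h : ∀ x, (univ.filter fun y => G.Adj x y).card ≤ d) :
    ∃ nb : V → Fin d → V, ∀ x y, G.Adj x y → ∃ i, nb x i = y := by
  refine ⟨fun x i => (univ.filter fun y => G.Adj x y).toList.getD i x, fun x y hxy => ?_⟩
  have hy : y ∈ (univ.filter fun y => G.Adj x y).toList := by simp [hxy]
  obtain ⟨i, hi, he⟩ := List.getElem_of_mem hy
  refine ⟨⟨i, ?_⟩, ?_⟩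
  · rw [length_toList] at hi
    exact hi.trans_le (h x)
  · simp only [List.getD_eq_getElem?_getD, List.getElem?_eq_getElem hi, he, Option.getD_some]

/-- The partner of `x` in the partial matching `O`. -/
noncomputable def mate (O : V → V → Prop) (x : V) : V :=
  if h : ∃ y, O x y then h.choose else x

lemma mate_eq {O : V → V → Prop} (hO : ∀ x y z, O x y → O x z → y = z) {x y : V} (h : O x y) :
    mate O x = y := by
  have h' : ∃ y, O x y := ⟨y, h⟩
  rw [mate, dif_pos h']
  exact hO _ _ _ h'.choose_spec h

/-- Decode a sequence of vertices that alternates between matching steps and free steps. -/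
def decode {d : ℕ} (mt : V → V) (nb : V → Fin d → V) (x x' : V) (i : ℕ → Fin d) : ℕ → V
  | 0 => x
  | 1 => x'
  | n + 2 => if Even n then mt (decode mt nb x x' i (n + 1))
      else nb (decode mt nb x x' i (n + 1)) (i (n / 2))

lemma decode_eq {d : ℕ} {mt : V → V} {nb : V → Fin d → V} {i : ℕ → Fin d} {v : ℕ → V} {T : ℕ}
    (h : ∀ t, t + 2 ≤ T → v (t + 2) = if Even t then mt (v (t + 1)) else nb (v (t + 1)) (i (t / 2))) :
    ∀ t ≤ T, decode mt nb (v 0) (v 1) i t = v t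
  | 0, _ => rfl
  | 1, _ => rfl
  | n + 2, hn => by
    rw [decode, decode_eq h (n + 1) (by omega), h n hn]

/-- Decode a sequence of free steps. -/
def stroll {d : ℕ} (nb : V → Fin d → V) (x : V) (i : ℕ → Fin d) : ℕ → V
  | 0 => x
  | n + 1 => nb (stroll nb x i n) (i n)

lemma stroll_eq {d : ℕ} {nb : V → Fin d → V} {i : ℕ → Fin d} {v : ℕ → V} {T : ℕ}
    (h : ∀ t, t < T → v (t + 1) = nb (v t) (i t)) :
    ∀ t ≤ T, stroll nb (v 0) i t = v t
  | 0, _ => rfl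
  | n + 1, hn => by
    rw [stroll, stroll_eq h n (by omega), h n (by omega)]

/-- Extend a finite code. -/
def extend {d k : ℕ} (hd : 0 < d) (i : Fin k → Fin d) (l : ℕ) : Fin d :=
  if h : l < k then i ⟨l, h⟩ else ⟨0, hd⟩

lemma exists_extend {d : ℕ} (hd : 0 < d) (k : ℕ) (Pr : ℕ → Fin d → Prop)
    (h : ∀ l < k, ∃ i, Pr l i) : ∃ i : Fin k → Fin d, ∀ l < k, Pr l (extend hd i l) := by
  choose f hf using h
  refine ⟨fun l => f l l.2, fun l hl => ?_⟩
  rw [extend, dif_pos hl]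
  exact hf l hl

lemma exists_lt_of_mem_edges {H : SimpleGraph V} {x y : V} (p : H.Walk x y) {e : Sym2 V}
    (he : e ∈ p.edges) : ∃ t < p.length, e = s(p.getVert t, p.getVert (t + 1)) := by
  induction p with
  | nil => simp at he
  | cons h p ih =>
    rw [Walk.edges_cons, List.mem_cons] at he
    rcases he with rfl | he
    · exact ⟨0, by simp, by simp⟩
    · obtain ⟨t, ht, hh⟩ := ih he
      exact ⟨t + 1, by simpa using ht, by simpa using hh⟩

lemma mem_edges_getVert {H : SimpleGraph V} {x y : V} (p : H.Walk x y) {t : ℕ}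
    (ht : t < p.length) : s(p.getVert t, p.getVert (t + 1)) ∈ p.edges := by
  induction p generalizing t with
  | nil => simp at ht
  | cons h p ih =>
    rw [Walk.edges_cons, List.mem_cons]
    cases t with
    | zero => left; simp
    | succ t => right; simpa using ih (by simpa using ht)

end Misc

section Part
variable {V : Type*} {d R P s : ℕ}

/-- The random choices of one part: selection value, time, mark and seed of every edge. -/
abbrev Seed (V : Type*) (d R P s : ℕ) : Type _ :=
  (Sym2 V → Fin d) × (Sym2 V → Fin R) × (Sym2 V → Fin P) × (Sym2 V → Equiv.Perm (Fin s))

/-- The subgraph of the edges with a property. -/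
def edgeSub (G : SimpleGraph V) (p : Sym2 V → Prop) : SimpleGraph V where
  Adj x y := G.Adj x y ∧ p s(x, y)
  symm := ⟨fun x y h => ⟨h.1.symm, by rw [Sym2.eq_swap]; exact h.2⟩⟩
  loopless := ⟨fun x h => G.loopless.irrefl x h.1⟩

lemma mem_edgeSub {G : SimpleGraph V} {p : Sym2 V → Prop} {e : Sym2 V} :
    e ∈ (edgeSub G p).edgeSet ↔ e ∈ G.edgeSet ∧ p e := by
  induction e with | _ x y => rfl

/-- The selected subgraph. -/
def selGraph (G : SimpleGraph V) (D : ℕ) (y : Seed V d R P s) : SimpleGraph V :=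
  edgeSub G fun e => (y.1 e : ℕ) < D

/-- The tentative colouring of one part. -/
noncomputable def tcol (G : SimpleGraph V) (D : ℕ) (y : Seed V d R P s) :
    Sym2 V → Option (Fin s) :=
  col (selGraph G D y) (fun e => (y.2.1 e : ℕ)) y.2.2.2

variable (G : SimpleGraph V) (D : ℕ)

/-- A long alternating unmarked sequence inside one part starts with the dart `(x, x')`. -/
def FBad (ℓ : ℕ) (y : Seed V d R P s) (x x' : V) : Prop :=
  ∃ (c c' : Fin s) (v : ℕ → V), v 0 = x ∧ v 1 = x' ∧
    (∀ t < ℓ, tcol G D y s(v t, v (t + 1)) = some (if Even t then c else c')) ∧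
    (∀ i j, i < j → j < ℓ → s(v i, v (i + 1)) ≠ s(v j, v (j + 1))) ∧
    ∀ t < ℓ, (y.2.2.1 s(v t, v (t + 1)) : ℕ) ≠ 0

/-- The sequence `v` alternates between the tentative colour `c` and the matching `O` for `n`
edges of colour `c`, which are pairwise far. -/
def AltFar (O : V → V → Prop) (y : Seed V d R P s) (c : Fin s) (v : ℕ → V) (n : ℕ) : Prop :=
  (∀ l < n, tcol G D y s(v (2 * l), v (2 * l + 1)) = some c) ∧
  (∀ l, l + 1 < n → O (v (2 * l + 1)) (v (2 * l + 2))) ∧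
  ∀ i j, i < j → j < n → far (selGraph G D y) (2 * R) s(v (2 * i), v (2 * i + 1))
    s(v (2 * j), v (2 * j + 1))

/-- The alternating sequence comes back near its start after `n` edges. -/
def EBadReturn (O : V → V → Prop) (n : ℕ) (y : Seed V d R P s) (x x' : V) : Prop :=
  ∃ (c : Fin s) (v : ℕ → V), v 0 = x ∧ v 1 = x' ∧ AltFar G D O y c v n ∧
    O (v (2 * (n - 1) + 1)) (v (2 * (n - 1) + 2)) ∧
    ∃ z, (z = x ∨ z = x') ∧ ∃ p : (selGraph G D y).Walk z (v (2 * (n - 1) + 2)), p.length ≤ 2 * R + 1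

/-- The alternating sequence is long. -/
def EBadLong (O : V → V → Prop) (n : ℕ) (y : Seed V d R P s) (x x' : V) : Prop :=
  ∃ (c : Fin s) (v : ℕ → V), v 0 = x ∧ v 1 = x' ∧ AltFar G D O y c v n

/-- An alternating sequence with an old colour starts with the dart `(x, x')`. -/
def EBad {α : Type*} (O : α → V → V → Prop) (n₀ K : ℕ) (y : Seed V d R P s) (x x' : V) : Prop :=
  ∃ a, (∃ n, n₀ ≤ n ∧ n ≤ K ∧ EBadReturn G D (O a) n y x x') ∨ EBadLong G D (O a) K y x x'

variable {G D} {y : Seed V d R P s}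

lemma tcol_mem {e : Sym2 V} {c : Fin s} (h : tcol G D y e = some c) :
    e ∈ G.edgeSet ∧ (y.1 e : ℕ) < D := mem_edgeSub.1 (col_mem h)

lemma not_far_of_mem {H : SimpleGraph V} {W : ℕ} {e f : Sym2 V} {x : V} (h : x ∈ e) (h' : x ∈ f) :
    ¬ far H W e f := fun hf => absurd (hf x h x h' Walk.nil) (by simp)

variable [Fintype V]

/-- Selected far edges rarely have the same colour. -/
lemma prob_far_same_le (F Q : Finset (Sym2 V)) :
    prob (fun y : Seed V d R P s => (∀ e ∈ F ∪ Q, (y.1 e : ℕ) < D) ∧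
      (∀ f ∈ F, ∀ f' ∈ F, f ≠ f' → far (selGraph G D y) (2 * R) f f') ∧
      ∃ c, ∀ f ∈ F, tcol G D y f = some c)
      ≤ ((D : ℝ) / d) ^ (F ∪ Q).card * (s * (1 / s : ℝ) ^ F.card) := by
  rw [mul_comm (_ ^ _) (_ * _)]
  have h0 : (0 : ℝ) ≤ s * (1 / s : ℝ) ^ F.card := by positivity
  refine (prob_prod_le (α := Sym2 V → Fin d)
    (β := (Sym2 V → Fin R) × (Sym2 V → Fin P) × (Sym2 V → Equiv.Perm (Fin s)))
    (p := fun z => ∀ e ∈ F ∪ Q, (z e : ℕ) < D)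
    (r := fun z w => (∀ f ∈ F, ∀ f' ∈ F, f ≠ f' → far (selGraph G D (z, w)) (2 * R) f f') ∧
      ∃ c, ∀ f ∈ F, tcol G D (z, w) f = some c) (c := s * (1 / s : ℝ) ^ F.card) ?_).trans ?_
  · intro z _
    refine prob_le_of_forall_fst (r := fun tm w =>
      (∀ f ∈ F, ∀ f' ∈ F, f ≠ f' → far (selGraph G D (z, tm, w)) (2 * R) f f') ∧
      ∃ c, ∀ f ∈ F, tcol G D (z, tm, w) f = some c) h0 fun tm => ?_
    refine prob_le_of_forall_fst (r := fun mk σ =>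
      (∀ f ∈ F, ∀ f' ∈ F, f ≠ f' → far (selGraph G D (z, tm, mk, σ)) (2 * R) f f') ∧
      ∃ c, ∀ f ∈ F, tcol G D (z, tm, mk, σ) f = some c) h0 fun mk => ?_
    set H := edgeSub G fun e => (z e : ℕ) < D with hH
    by_cases hF : (∀ f ∈ F, ∀ f' ∈ F, f ≠ f' → far H (2 * R) f f') ∧ ∀ f ∈ F, f ∈ H.edgeSet
    · refine (prob_mono fun σ h => h.2).trans ?_
      refine prob_same_colour_le (act := actv H fun e => (tm e : ℕ)) (K := conf H)
        (tm := fun e => (tm e : ℕ)) F fun f hf f' hf' hne => ?_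
      exact disjoint_dep_of_far (fun e => (tm e).2) (hF.2 f hf) (hF.2 f' hf')
        (hF.1 f hf f' hf' hne)
    · refine le_trans (prob_mono (r := fun _ => False) fun σ h => hF ⟨h.1, fun f hf => ?_⟩) ?_
      · obtain ⟨c, hc⟩ := h.2
        exact col_mem (hc f hf)
      · simpa [prob, avg] using h0
  · exact mul_le_mul_of_nonneg_left ((prob_forall_mem_le (F ∪ Q) (fun _ (x : Fin d) => (x : ℕ) < D)
      fun _ _ => prob_fin_lt_le d D)) h0

end Part
end AEC

namespace AEC
open scoped Classical
open Finset SimpleGraph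

section Codes
variable {V : Type*} {d R P s : ℕ} {G : SimpleGraph V} {D : ℕ} {y : Seed V d R P s}
  {O : V → V → Prop} {c : Fin s} {v : ℕ → V} {n : ℕ}

lemma tcol_adj {x x' : V} (h : tcol G D y s(x, x') = some c) :
    (selGraph G D y).Adj x x' := by
  have := col_mem h
  rwa [mem_edgeSet] at this

lemma AltFar.exists_code (hO : ∀ x y z, O x y → O x z → y = z) (h : AltFar G D O y c v n)
    {nb : V → Fin d → V} (hnb : ∀ x y, G.Adj x y → ∃ i, nb x i = y) (hd : 0 < d) {m T : ℕ}
    (hT : T ≤ 2 * n - 1) (hm : T ≤ 2 * m + 2) :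
    ∃ i : Fin m → Fin d, ∀ t ≤ T, decode (mate O) nb (v 0) (v 1) (extend hd i) t = v t := by
  obtain ⟨i, hi⟩ := exists_extend hd m (fun l i => 2 * l + 3 ≤ T → nb (v (2 * l + 2)) i = v (2 * l + 3))
    (fun l hl => by
      by_cases hT' : 2 * l + 3 ≤ T
      · obtain ⟨i, hi⟩ := hnb (v (2 * l + 2)) (v (2 * l + 3)) (tcol_adj (h.1 (l + 1) (by omega))).1
        exact ⟨i, fun _ => hi⟩
      · exact ⟨⟨0, hd⟩, fun hh => absurd hh hT'⟩)
  refine ⟨i, decode_eq fun t ht => ?_⟩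
  split_ifs with hte
  · obtain ⟨l, rfl⟩ := hte
    have := h.2.1 l (by omega)
    rw [show l + l + 2 = 2 * l + 2 by omega, show l + l + 1 = 2 * l + 1 by omega]
    exact (mate_eq hO this).symm
  · rw [Nat.not_even_iff_odd] at hte
    obtain ⟨l, rfl⟩ := hte
    rw [show (2 * l + 1) / 2 = l by omega]
    exact (hi l (by omega) (by omega)).symm

/-- The edges at even positions of a sequence. -/
noncomputable def evenEdges (v : ℕ → V) (n : ℕ) : Finset (Sym2 V) :=
  (range n).image fun l => s(v (2 * l), v (2 * l + 1))

lemma evenEdges_congr {v' : ℕ → V} (h : ∀ t ≤ 2 * n - 1, v' t = v t) :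
    evenEdges v' n = evenEdges v n := by
  refine image_congr fun l hl => ?_
  rw [coe_range, Set.mem_Iio] at hl
  simp only [h (2 * l) (by omega), h (2 * l + 1) (by omega)]

lemma mem_evenEdges {e : Sym2 V} :
    e ∈ evenEdges v n ↔ ∃ l < n, s(v (2 * l), v (2 * l + 1)) = e := by
  simp [evenEdges]

lemma AltFar.far_ne (h : AltFar G D O y c v n) {i j : ℕ} (hi : i < n) (hj : j < n) (hij : i ≠ j) :
    far (selGraph G D y) (2 * R) s(v (2 * i), v (2 * i + 1)) s(v (2 * j), v (2 * j + 1)) := by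
  rcases lt_or_gt_of_ne hij with h1 | h1
  · exact h.2.2 i j h1 hj
  · intro a ha b hb p
    simpa using h.2.2 j i h1 hi b hb a ha p.reverse

lemma AltFar.card (h : AltFar G D O y c v n) : (evenEdges v n).card = n := by
  rw [evenEdges, card_image_of_injOn, card_range]
  intro i hi j hj hij
  by_contra hne
  have := h.far_ne (mem_range.1 hi) (mem_range.1 hj) hne
  simp only at hij
  rw [hij] at this
  exact not_far_of_mem (Sym2.mem_mk_left _ _) (Sym2.mem_mk_left _ _) this

/-- The event that is estimated by `prob_far_same_le`. -/
def FarSame (G : SimpleGraph V) (D : ℕ) (F Q : Finset (Sym2 V)) (y : Seed V d R P s) : Prop :=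
  (∀ e ∈ F ∪ Q, (y.1 e : ℕ) < D) ∧
    (∀ f ∈ F, ∀ f' ∈ F, f ≠ f' → far (selGraph G D y) (2 * R) f f') ∧
    ∃ c, ∀ f ∈ F, tcol G D y f = some c

lemma AltFar.farSame (h : AltFar G D O y c v n) {Q : Finset (Sym2 V)}
    (hQ : ∀ e ∈ Q, (y.1 e : ℕ) < D) : FarSame G D (evenEdges v n) Q y := by
  refine ⟨fun e he => ?_, fun f hf f' hf' hne => ?_, c, fun f hf => ?_⟩
  · rcases mem_union.1 he with he | he
    · obtain ⟨l, hl, rfl⟩ := mem_evenEdges.1 he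
      exact (tcol_mem (h.1 l hl)).2
    · exact hQ e he
  · obtain ⟨l, hl, rfl⟩ := mem_evenEdges.1 hf
    obtain ⟨l', hl', rfl⟩ := mem_evenEdges.1 hf'
    exact h.far_ne hl hl' fun hh => hne (by rw [hh])
  · obtain ⟨l, hl, rfl⟩ := mem_evenEdges.1 hf
    exact h.1 l hl

variable [Fintype V]

lemma prob_farSame_le (F Q : Finset (Sym2 V)) (k w : ℕ) :
    prob (fun y : Seed V d R P s => FarSame G D F Q y ∧ F.card = k ∧ (F ∪ Q).card = k + w)
      ≤ ((D : ℝ) / d) ^ (k + w) * (s * (1 / s : ℝ) ^ k) := by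
  by_cases h : F.card = k ∧ (F ∪ Q).card = k + w
  · refine (prob_mono fun y hy => hy.1).trans ?_
    have := prob_far_same_le (R := R) (P := P) (G := G) (D := D) (d := d) (s := s) F Q
    rw [h.1, h.2] at this
    exact this
  · refine le_trans (prob_mono (r := fun _ => False) fun y hy => h hy.2) ?_
    simp [prob, avg]
    positivity

lemma prob_long_le {α : Type*} [Fintype α] {O : α → V → V → Prop}
    (hO : ∀ a x y z, O a x y → O a x z → y = z)
    (hG : ∀ x, (univ.filter fun y => G.Adj x y).card ≤ d) (hd : 0 < d) (hs : 0 < s) (x x' : V) (K : ℕ) :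
    prob (fun y : Seed V d R P s => ∃ a, EBadLong G D (O a) (K + 1) y x x')
      ≤ Fintype.card α * (D / d) * ((D : ℝ) / s) ^ K := by
  obtain ⟨nb, hnb⟩ := exists_neighbour_enum G hG
  let F : α × (Fin K → Fin d) → Finset (Sym2 V) := fun k =>
    evenEdges (decode (mate (O k.1)) nb x x' (extend hd k.2)) (K + 1)
  have h1 : ∀ y : Seed V d R P s, (∃ a, EBadLong G D (O a) (K + 1) y x x') →
      ∃ k, FarSame G D (F k) ∅ y ∧ (F k).card = K + 1 ∧ (F k ∪ ∅).card = K + 1 + 0 := by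
    rintro y ⟨a, c, v, rfl, rfl, h⟩
    obtain ⟨i, hi⟩ := h.exists_code (hO a) hnb hd (m := K) le_rfl (by omega)
    have : F (a, i) = evenEdges v (K + 1) := evenEdges_congr hi
    refine ⟨(a, i), ?_⟩
    rw [this, union_empty]
    exact ⟨h.farSame (by simp), h.card, h.card⟩
  refine (prob_mono h1).trans ((prob_exists_le_card _ fun k => prob_farSame_le (F k) ∅ (K + 1) 0).trans
    (le_of_eq ?_))
  have hd' : (d : ℝ) ≠ 0 := by positivity
  simp only [Fintype.card_prod, Fintype.card_fun, Fintype.card_fin]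
  have hs' : (s : ℝ) ≠ 0 := by positivity
  push_cast
  simp only [add_zero, pow_succ, div_pow, one_pow]
  field_simp

omit [Fintype V] in
/-- A shortest walk from `{x, x'}` to `z` uses neither the edge `s(x, x')` nor edges far from it. -/
lemma walk_avoids {H : SimpleGraph V} {W : ℕ} {x x' a z : V} (ha : a = x ∨ a = x') (p : H.Walk a z)
    (hp : p.length ≤ W + 1)
    (hmin : ∀ a', (a' = x ∨ a' = x') → ∀ p' : H.Walk a' z, p.length ≤ p'.length) {f : Sym2 V}
    (hf : f = s(x, x') ∨ far H W s(x, x') f) : f ∉ p.edges := by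
  intro hfp
  obtain ⟨t, ht, rfl⟩ := exists_lt_of_mem_edges p hfp
  rcases hf with hf | hf
  · have : p.getVert (t + 1) ∈ s(x, x') := hf ▸ Sym2.mem_mk_right _ _
    have := hmin _ (Sym2.mem_iff.1 this) (p.drop (t + 1))
    rw [Walk.drop_length] at this
    omega
  · have := hf a (Sym2.mem_iff.2 ha) _ (Sym2.mem_mk_left _ _) (p.take t)
    rw [Walk.take_length] at this
    omega

lemma exists_shortest {H : SimpleGraph V} {x x' z : V}
    (h : ∃ a, (a = x ∨ a = x') ∧ ∃ p : H.Walk a z, p.length ≤ n) :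
    ∃ a, (a = x ∨ a = x') ∧ ∃ p : H.Walk a z, p.IsPath ∧ p.length ≤ n ∧
      ∀ a', (a' = x ∨ a' = x') → ∀ p' : H.Walk a' z, p.length ≤ p'.length := by
  obtain ⟨a, ha, p, hp⟩ := h
  have hex : ∃ k, ∃ a, (a = x ∨ a = x') ∧ ∃ p : H.Walk a z, p.length = k := ⟨_, a, ha, p, rfl⟩
  obtain ⟨b, hb, q, hq⟩ := Nat.find_spec hex
  have hmin : ∀ a', (a' = x ∨ a' = x') → ∀ p' : H.Walk a' z, q.length ≤ p'.length :=
    fun a' ha' p' => hq ▸ Nat.find_min' hex ⟨a', ha', p', rfl⟩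
  have hby : q.bypass.length = q.length :=
    le_antisymm q.length_bypass_le_length (hmin b hb q.bypass)
  refine ⟨b, hb, q.bypass, q.bypass_isPath, ?_, ?_⟩
  · rw [hby]
    exact (hmin a ha p).trans hp
  · rw [hby]
    exact hmin

lemma prob_return_le {α : Type*} [Fintype α] {O : α → V → V → Prop}
    (hO : ∀ a x y z, O a x y → O a x z → y = z) (hsymm : ∀ a x y, O a x y → O a y x)
    (hG : ∀ x, (univ.filter fun y => G.Adj x y).card ≤ d) (hd : 0 < d) (hs : 0 < s) (x x' : V)
    (n : ℕ) :
    prob (fun y : Seed V d R P s => ∃ a, EBadReturn G D (O a) (n + 2) y x x')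
      ≤ ∑ w ∈ range (2 * R + 2),
        Fintype.card α * (D / d) * (2 / d * (D : ℝ) ^ w * ((D : ℝ) / s) ^ (n + 1)) := by
  obtain ⟨nb, hnb⟩ := exists_neighbour_enum G hG
  let st : ∀ w, α × Bool × (Fin n → Fin d) × (Fin w → Fin d) → ℕ → V := fun w k =>
    stroll nb (if k.2.1 then x else x') (extend hd k.2.2.2)
  let u : ∀ w, α × Bool × (Fin n → Fin d) × (Fin w → Fin d) → ℕ → V := fun w k t =>
    if t ≤ 2 * n + 2 then decode (mate (O k.1)) nb x x' (extend hd k.2.2.1) t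
      else mate (O k.1) (st w k w)
  let F : ∀ w, α × Bool × (Fin n → Fin d) × (Fin w → Fin d) → Finset (Sym2 V) := fun w k =>
    evenEdges (u w k) (n + 2)
  let Q : ∀ w, α × Bool × (Fin n → Fin d) × (Fin w → Fin d) → Finset (Sym2 V) := fun w k =>
    (range w).image fun t => s(st w k t, st w k (t + 1))
  have h1 : ∀ y : Seed V d R P s, (∃ a, EBadReturn G D (O a) (n + 2) y x x') →
      ∃ w ∈ range (2 * R + 2), ∃ k, FarSame G D (F w k) (Q w k) y ∧ (F w k).card = n + 2 ∧
        (F w k ∪ Q w k).card = n + 2 + w := by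
    rintro y ⟨a, c, v, rfl, rfl, h, hlast, hz⟩
    obtain ⟨z, hz, p, hpath, hp, hmin⟩ := exists_shortest hz
    refine ⟨p.length, by simp; omega, ?_⟩
    obtain ⟨i, hi⟩ := h.exists_code (hO a) hnb hd (m := n) (T := 2 * n + 2) (by omega) (by omega)
    obtain ⟨j, hj⟩ := exists_extend hd p.length
      (fun t i => nb (p.getVert t) i = p.getVert (t + 1))
      (fun t ht => hnb _ _ (p.adj_getVert_succ ht).1)
    have hst : ∃ b : Bool, ∀ t ≤ p.length, st p.length (a, b, i, j) t = p.getVert t := by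
      have : ∃ b : Bool, (if b then v 0 else v 1) = p.getVert 0 := by
        rw [Walk.getVert_zero]
        rcases hz with rfl | rfl
        · exact ⟨true, rfl⟩
        · exact ⟨false, rfl⟩
      obtain ⟨b, hb⟩ := this
      refine ⟨b, ?_⟩
      have := stroll_eq (nb := nb) (i := extend hd j) (v := p.getVert) (T := p.length)
        fun t ht => (hj t ht).symm
      rw [← hb] at this
      exact this
    obtain ⟨b, hst⟩ := hst
    have hF : F p.length (a, b, i, j) = evenEdges v (n + 2) := by
      refine evenEdges_congr fun t ht => ?_
      simp only [u]
      split_ifs with htn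
      · exact hi t htn
      · rw [hst _ le_rfl, Walk.getVert_length]
        obtain rfl : t = 2 * (n + 2 - 1) + 1 := by omega
        exact mate_eq (hO a) (hsymm _ _ _ hlast)
    have hQ : Q p.length (a, b, i, j) = p.edges.toFinset := by
      ext e
      simp only [Q, mem_image, mem_range, List.mem_toFinset]
      constructor
      · rintro ⟨t, ht, rfl⟩
        rw [hst t ht.le, hst (t + 1) ht]
        exact mem_edges_getVert p ht
      · intro he
        obtain ⟨t, ht, rfl⟩ := exists_lt_of_mem_edges p he
        exact ⟨t, ht, by rw [hst t ht.le, hst (t + 1) ht]⟩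
    refine ⟨(a, b, i, j), ?_⟩
    rw [hF, hQ]
    refine ⟨h.farSame fun e he => ?_, h.card, ?_⟩
    · exact (mem_edgeSub.1 (p.edges_subset_edgeSet (List.mem_toFinset.1 he))).2
    · rw [card_union_of_disjoint, h.card, List.toFinset_card_of_nodup hpath.edges_nodup,
        Walk.length_edges]
      rw [Finset.disjoint_left]
      intro f hf
      obtain ⟨l, hl, rfl⟩ := mem_evenEdges.1 hf
      rw [List.mem_toFinset]
      refine walk_avoids hz p hp hmin ?_
      rcases Nat.eq_zero_or_pos l with rfl | hl0
      · left; simp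
      · right
        exact h.far_ne (i := 0) (by omega) hl hl0.ne
  refine (prob_mono h1).trans ((prob_exists_mem_le _ _).trans (sum_le_sum fun w _ => ?_))
  refine (prob_exists_le_card _ fun k => prob_farSame_le (F w k) (Q w k) (n + 2) w).trans
    (le_of_eq ?_)
  have hd' : (d : ℝ) ≠ 0 := by positivity
  have hs' : (s : ℝ) ≠ 0 := by positivity
  simp only [Fintype.card_prod, Fintype.card_fun, Fintype.card_fin, Fintype.card_bool]
  push_cast
  simp only [pow_add, div_pow, one_pow]
  field_simp

end Codes
end AEC

namespace AEC
open scoped Classical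
open Finset SimpleGraph

section Bounds

lemma prob_le_of_forall_snd {α β : Type*} [Fintype α] [Fintype β] {r : α → β → Prop} {c : ℝ}
    (hc : 0 ≤ c) (h : ∀ b, prob (fun a => r a b) ≤ c) :
    prob (fun x : α × β => r x.1 x.2) ≤ c := by
  unfold prob
  rw [avg_prod, avg_comm (fun a b => if r a b then (1 : ℝ) else 0)]
  exact avg_le_of_le hc h

lemma prob_eq_const_le (P : ℕ) (a : ℕ) : prob (fun x : Fin P => (x : ℕ) = a) ≤ 1 / (P : ℝ) := by
  rw [prob_eq_card, Fintype.card_fin]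
  gcongr
  have : (univ.filter fun x : Fin P => (x : ℕ) = a).card ≤ 1 :=
    card_le_one.2 fun x hx y hy => by
      simp only [mem_filter, mem_univ, true_and] at hx hy
      exact Fin.ext (hx.trans hy.symm)
  have := (Nat.cast_le (α := ℝ)).2 this
  rw [Nat.cast_one] at this
  refine le_trans (le_of_eq ?_) this
  congr

lemma prob_ne_const_le {P : ℕ} (hP : 0 < P) :
    prob (fun x : Fin P => (x : ℕ) ≠ 0) ≤ 1 - 1 / (P : ℝ) := by
  rw [prob_eq_card, Fintype.card_fin, le_sub_iff_add_le, ← add_div]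
  rw [div_le_one (by positivity)]
  have : (univ.filter fun x : Fin P => (x : ℕ) ≠ 0).card < Fintype.card (Fin P) := by
    refine card_lt_univ_of_notMem (x := ⟨0, hP⟩) ?_
    simp
  rw [Fintype.card_fin] at this
  exact_mod_cast this

lemma prob_eq_le {ι : Type*} [Fintype ι] [DecidableEq ι] (R : ℕ) {e f : ι} (h : f ≠ e) :
    prob (fun tm : ι → Fin R => (tm f : ℕ) = tm e) ≤ 1 / (R : ℝ) := by
  unfold prob
  rw [avg_resample f]
  refine avg_le_of_le (by positivity) fun ω => ?_
  refine le_of_eq_of_le ?_ (prob_eq_const_le R (ω e))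
  unfold prob
  congr 1
  funext x
  simp [Function.update_of_ne h.symm]

variable {V : Type*} {d R P s : ℕ} {G : SimpleGraph V} {D : ℕ}

/-- The edges at `x`. -/
noncomputable def inc [Fintype V] (G : SimpleGraph V) (x : V) : Finset (Sym2 V) :=
  univ.filter fun f => f ∈ G.edgeSet ∧ x ∈ f

variable [Fintype V]

lemma mem_inc {x : V} {e : Sym2 V} : e ∈ inc G x ↔ e ∈ G.edgeSet ∧ x ∈ e := by simp [inc]

lemma card_inc (G : SimpleGraph V) (x : V) :
    (inc G x).card = (univ.filter fun y => G.Adj x y).card := by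
  have : inc G x = (univ.filter fun y => G.Adj x y).image fun y => s(x, y) := by
    ext e
    simp only [mem_inc, mem_image, mem_filter, mem_univ, true_and]
    constructor
    · rintro ⟨he, hx⟩
      obtain ⟨y, rfl⟩ := Sym2.mem_iff_exists.1 hx
      exact ⟨y, he, rfl⟩
    · rintro ⟨y, hy, rfl⟩
      exact ⟨hy, Sym2.mem_mk_left _ _⟩
  rw [this, card_image_of_injective]
  intro a b hab
  have : a = b ∨ x = b ∧ a = x := by simpa using hab
  rcases this with h | ⟨h, h'⟩
  · exact h
  · exact h'.trans h

lemma prob_mark_le (e : Sym2 V) :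
    prob (fun y : Seed V d R P s => (y.1 e : ℕ) < D ∧ (y.2.2.1 e : ℕ) = 0) ≤ D / d * (1 / P) := by
  have h := prob_prod_le (α := Sym2 V → Fin d)
    (β := (Sym2 V → Fin R) × (Sym2 V → Fin P) × (Sym2 V → Equiv.Perm (Fin s)))
    (p := fun z => (z e : ℕ) < D) (r := fun _ (w : (Sym2 V → Fin R) × (Sym2 V → Fin P) × (Sym2 V → Equiv.Perm (Fin s))) =>
      (w.2.1 e : ℕ) = 0) (c := 1 / P) (fun z _ => by
      refine prob_le_of_forall_fst (r := fun _ (w : (Sym2 V → Fin P) × (Sym2 V → Equiv.Perm (Fin s))) =>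
        (w.1 e : ℕ) = 0) (by positivity) fun tm => ?_
      refine (prob_fst_le fun mk : Sym2 V → Fin P => (mk e : ℕ) = 0).trans ?_
      have := prob_forall_mem_le (X := Fin P) {e} (fun _ x => (x : ℕ) = 0)
        fun _ _ => prob_eq_const_le P 0
      simpa using this)
  refine h.trans ?_
  rw [mul_comm]
  gcongr
  have := prob_forall_mem_le {e} (fun _ (x : Fin d) => (x : ℕ) < D) fun _ _ => prob_fin_lt_le d D
  simpa using this

lemma prob_clash_le {e f : Sym2 V} (hef : f ≠ e) :
    prob (fun y : Seed V d R P s => ((y.1 e : ℕ) < D ∧ (y.1 f : ℕ) < D) ∧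
      (y.2.1 f : ℕ) = y.2.1 e) ≤ D / d * (D / d * (1 / R)) := by
  have h := prob_prod_le (α := Sym2 V → Fin d)
    (β := (Sym2 V → Fin R) × (Sym2 V → Fin P) × (Sym2 V → Equiv.Perm (Fin s)))
    (p := fun z => (z e : ℕ) < D ∧ (z f : ℕ) < D) (r := fun z w => (w.1 f : ℕ) = w.1 e) (c := 1 / R)
    (fun z _ => (prob_fst_le fun tm : Sym2 V → Fin R => (tm f : ℕ) = tm e).trans (prob_eq_le R hef))
  refine h.trans ?_
  rw [mul_comm, ← mul_assoc]
  gcongr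
  have := prob_forall_mem_le {e, f} (fun _ (x : Fin d) => (x : ℕ) < D) fun _ _ => prob_fin_lt_le d D
  rw [card_pair hef.symm] at this
  simpa [pow_two] using this

lemma prob_over_le (hdeg : ∀ x, (inc G x).card ≤ d) {e : Sym2 V} (u : V) {x : ℝ} (hx : 1 ≤ x)
    (B : ℕ) :
    prob (fun y : Seed V d R P s => (y.1 e : ℕ) < D ∧
      B + 1 ≤ (((inc G u).erase e).filter fun f => (y.1 f : ℕ) < D).card)
      ≤ D / d * ((1 + (D : ℝ) / d * (x - 1)) ^ d / x ^ (B + 1)) := by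
  refine (prob_fst_le fun z : Sym2 V → Fin d => (z e : ℕ) < D ∧
      B + 1 ≤ (((inc G u).erase e).filter fun f => (z f : ℕ) < D).card).trans ?_
  have key : prob (fun z : Sym2 V → Fin d => (z e : ℕ) < D ∧
      B + 1 ≤ (((inc G u).erase e).filter fun f => (z f : ℕ) < D).card) =
      prob (fun z : Sym2 V → Fin d => (z e : ℕ) < D) * prob (fun z : Sym2 V → Fin d =>
        B + 1 ≤ (((inc G u).erase e).filter fun f => (z f : ℕ) < D).card) := by
    refine prob_and_eq_mul (ι := Sym2 V) (X := Fin d) {f | f = e} _ _ ?_ ?_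
    · intro ω ω' h h'
      rwa [← h e rfl]
    · intro ω ω' h h'
      refine h'.trans (le_of_eq ?_)
      congr 1
      refine filter_congr fun f hf => ?_
      rw [h f (mem_erase.1 hf).1]
  rw [key]
  refine mul_le_mul ?_ ?_ (prob_nonneg _) (by positivity)
  · have := prob_forall_mem_le {e} (fun _ (x : Fin d) => (x : ℕ) < D)
      fun _ _ => prob_fin_lt_le d D
    simpa using this
  · have hch := chernoff (t := B + 1) ((inc G u).erase e) (fun _ (x : Fin d) => (x : ℕ) < D)
      (by positivity) hx ((card_le_card (erase_subset _ _)).trans (hdeg u))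
      fun _ _ => prob_fin_lt_le d D
    refine le_trans (prob_mono fun z hz => ?_) hch
    refine hz.trans (le_of_eq ?_)
    congr

end Bounds
end AEC

namespace AEC
open scoped Classical
open Finset SimpleGraph

lemma GirthGe.mono {V : Type*} {G H : SimpleGraph V} {g : ℕ} (hg : GirthGe G g) (h : H ≤ G) :
    GirthGe H g := by
  intro v w hw
  have := hg v (w.mapLe h) (hw.mapLe h)
  simpa using this

section Bounds
variable {V : Type*} {d R P s : ℕ} {G : SimpleGraph V} {D : ℕ}

lemma selGraph_le (y : Seed V d R P s) : selGraph G D y ≤ G := fun _ _ h => h.1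

lemma tcol_next {y : Seed V d R P s} {a b b' : V} {c : Fin s} (h : tcol G D y s(a, b) = some c)
    (h' : tcol G D y s(a, b') = some c) : b = b' := by
  by_contra hne
  refine col_proper (conf.symm ⟨?_, col_mem h', col_mem h, a, Sym2.mem_mk_left _ _,
    Sym2.mem_mk_left _ _⟩) h h'
  rintro heq
  rcases Sym2.eq_iff.1 heq with ⟨_, h1⟩ | ⟨h1, h2⟩
  · exact hne h1.symm
  · exact hne (h1.symm.trans h2.symm)

variable [Fintype V]

lemma prob_sel_single_le (e : Sym2 V) :
    prob (fun z : Sym2 V → Fin d => (z e : ℕ) < D) ≤ (D : ℝ) / d := by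
  have := prob_forall_mem_le {e} (fun _ (x : Fin d) => (x : ℕ) < D) fun _ _ => prob_fin_lt_le d D
  simpa using this

lemma prob_none_le {g : ℕ} (hg : GirthGe G g) (hRg : 2 * R + 1 < g) {u v : V} {B b : ℕ}
    (hb : b + B ≤ s) :
    prob (fun y : Seed V d R P s => (y.1 s(u, v) : ℕ) < D ∧
      (actv (selGraph G D y) (fun e => (y.2.1 e : ℕ)) s(u, v) ∧
      (((inc G u).erase s(u, v)).filter fun f => (y.1 f : ℕ) < D).card ≤ B ∧
      (((inc G v).erase s(u, v)).filter fun f => (y.1 f : ℕ) < D).card ≤ B ∧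
      tcol G D y s(u, v) = none)) ≤ D / d * (1 - (b : ℝ) / s) ^ b := by
  have hbs : (0 : ℝ) ≤ 1 - (b : ℝ) / s := by
    rcases Nat.eq_zero_or_pos s with rfl | hs
    · simp
    · rw [sub_nonneg, div_le_one (by positivity)]
      exact_mod_cast (by omega : b ≤ s)
  have h := prob_prod_le (α := Sym2 V → Fin d)
    (β := (Sym2 V → Fin R) × (Sym2 V → Fin P) × (Sym2 V → Equiv.Perm (Fin s)))
    (p := fun z => (z s(u, v) : ℕ) < D) (r := fun z w =>
      (actv (selGraph G D (z, w)) (fun e => (w.1 e : ℕ)) s(u, v) ∧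
      (((inc G u).erase s(u, v)).filter fun f => (z f : ℕ) < D).card ≤ B ∧
      (((inc G v).erase s(u, v)).filter fun f => (z f : ℕ) < D).card ≤ B ∧
      tcol G D (z, w) s(u, v) = none)) (c := (1 - (b : ℝ) / s) ^ b) (fun z _ => by
      refine prob_le_of_forall_fst (r := fun tm w =>
        (actv (selGraph G D (z, tm, w)) (fun e => (tm e : ℕ)) s(u, v) ∧
        (((inc G u).erase s(u, v)).filter fun f => (z f : ℕ) < D).card ≤ B ∧
        (((inc G v).erase s(u, v)).filter fun f => (z f : ℕ) < D).card ≤ B ∧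
        tcol G D (z, tm, w) s(u, v) = none)) (by positivity) fun tm => ?_
      refine prob_le_of_forall_fst (r := fun mk σ =>
        (actv (selGraph G D (z, tm, mk, σ)) (fun e => (tm e : ℕ)) s(u, v) ∧
        (((inc G u).erase s(u, v)).filter fun f => (z f : ℕ) < D).card ≤ B ∧
        (((inc G v).erase s(u, v)).filter fun f => (z f : ℕ) < D).card ≤ B ∧
        tcol G D (z, tm, mk, σ) s(u, v) = none)) (by positivity) fun mk => ?_
      set H := edgeSub G fun e => (z e : ℕ) < D with hH
      have hsub : ∀ x, (univ.filter fun f : Sym2 V => f ∈ H.edgeSet ∧ x ∈ f ∧ f ≠ s(u, v)) ⊆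
          (((inc G x).erase s(u, v)).filter fun f => (z f : ℕ) < D) := by
        intro x f hf
        simp only [mem_filter, mem_univ, true_and, hH, mem_edgeSub] at hf
        simp only [mem_filter, mem_erase, mem_inc]
        tauto
      by_cases hA : actv H (fun e => (tm e : ℕ)) s(u, v) ∧
          (((inc G u).erase s(u, v)).filter fun f => (z f : ℕ) < D).card ≤ B ∧
          (((inc G v).erase s(u, v)).filter fun f => (z f : ℕ) < D).card ≤ B
      · refine (prob_mono fun σ hσ => hσ.2.2.2).trans ?_
        exact prob_col_none_le (H := H) (fun e => (tm e).2) (hg.mono fun _ _ h => h.1) hRg hA.1 hb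
          ((card_le_card (hsub u)).trans hA.2.1) ((card_le_card (hsub v)).trans hA.2.2)
      · refine le_trans (prob_mono (r := fun _ => False) fun σ h => hA ⟨h.1, h.2.1, h.2.2.1⟩) ?_
        simp only [prob, avg]
        simpa using pow_nonneg hbs b)
  refine h.trans ?_
  rw [mul_comm]
  gcongr
  exact prob_sel_single_le _

lemma prob_fbad_le (hP : 0 < P) {ℓ : ℕ} (hℓ : 0 < ℓ) (x x' : V) :
    prob (fun y : Seed V d R P s => (y.1 s(x, x') : ℕ) < D ∧ FBad G D ℓ y x x') ≤
      D / d * (s * (1 - 1 / (P : ℝ)) ^ ℓ) := by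
  have hP1 : (0 : ℝ) ≤ 1 - 1 / P := by
    rw [sub_nonneg, div_le_one (by positivity)]
    exact_mod_cast hP
  have h := prob_prod_le (α := Sym2 V → Fin d)
    (β := (Sym2 V → Fin R) × (Sym2 V → Fin P) × (Sym2 V → Equiv.Perm (Fin s)))
    (p := fun z => (z s(x, x') : ℕ) < D) (r := fun z w => FBad G D ℓ (z, w) x x')
    (c := (s * (1 - 1 / (P : ℝ)) ^ ℓ)) (fun z _ => by
      refine prob_le_of_forall_fst (r := fun tm w => FBad G D ℓ (z, tm, w) x x')
        (by positivity) fun tm => ?_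
      refine prob_le_of_forall_snd (r := fun mk σ => FBad G D ℓ (z, tm, mk, σ) x x')
        (by positivity) fun σ => ?_
      let κ : Sym2 V → Option (Fin s) := fun e =>
        col (edgeSub G fun e => (z e : ℕ) < D) (fun e => (tm e : ℕ)) σ e
      have hκ : ∀ mk, tcol G D ((z, tm, mk, σ) : Seed V d R P s) = κ := fun _ => rfl
      let Alt : Fin s → Fin s → (ℕ → V) → Prop := fun c c' v => v 0 = x ∧ v 1 = x' ∧
        (∀ t < ℓ, κ s(v t, v (t + 1)) = some (if Even t then c else c')) ∧
        (∀ i j, i < j → j < ℓ → s(v i, v (i + 1)) ≠ s(v j, v (j + 1)))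
      have huniq : ∀ c c₁ c' v v', Alt c c' v → Alt c₁ c' v' → ∀ t ≤ ℓ, v t = v' t := by
        intro c c₁ c' v v' h h'
        have hc : c = c₁ := by
          have h1 := h.2.2.1 0 hℓ
          have h2 := h'.2.2.1 0 hℓ
          rw [h.1, zero_add, h.2.1] at h1
          rw [h'.1, zero_add, h'.2.1] at h2
          simpa using h1.symm.trans h2
        subst hc
        intro t
        induction t with
        | zero => intro _; rw [h.1, h'.1]
        | succ t ih =>
          intro ht
          have h1 := h.2.2.1 t ht
          have h2 := h'.2.2.1 t ht
          rw [← ih (by omega)] at h2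
          have mk : Sym2 V → Fin P := fun _ => ⟨0, hP⟩
          rw [← hκ mk] at h1 h2
          exact tcol_next h1 h2
      have hc' : ∀ c' : Fin s, prob (fun mk : Sym2 V → Fin P => ∃ c v, Alt c c' v ∧
          ∀ t < ℓ, (mk s(v t, v (t + 1)) : ℕ) ≠ 0) ≤ (1 - 1 / (P : ℝ)) ^ ℓ := by
        intro c'
        by_cases hex : ∃ c v, Alt c c' v
        · obtain ⟨c, v, hv⟩ := hex
          have hcard : ((range ℓ).image fun t => s(v t, v (t + 1))).card = ℓ := by
            rw [card_image_of_injOn, card_range]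
            intro i hi j hj hij
            simp only [coe_range, Set.mem_Iio] at hi hj
            rcases lt_trichotomy i j with hlt | rfl | hlt
            · exact absurd hij (hv.2.2.2 i j hlt hj)
            · rfl
            · exact absurd hij.symm (hv.2.2.2 j i hlt hi)
          have := prob_forall_mem_le ((range ℓ).image fun t => s(v t, v (t + 1)))
            (fun _ (a : Fin P) => (a : ℕ) ≠ 0) fun _ _ => prob_ne_const_le hP
          rw [hcard] at this
          refine (prob_mono ?_).trans this
          rintro mk ⟨c₁, v', hv', hmk⟩ e he
          obtain ⟨t, ht, rfl⟩ := mem_image.1 he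
          have ht := mem_range.1 ht
          rw [huniq _ _ _ _ _ hv hv' t ht.le, huniq _ _ _ _ _ hv hv' (t + 1) ht]
          exact hmk t ht
        · refine le_trans (prob_mono (r := fun _ => False) ?_) ?_
          · rintro mk ⟨c, v, hv, -⟩
            exact hex ⟨c, v, hv⟩
          · simp only [prob, avg]
            simpa using pow_nonneg hP1 ℓ
      have := prob_exists_le_card (fun (c' : Fin s) (mk : Sym2 V → Fin P) => ∃ c v, Alt c c' v ∧
          ∀ t < ℓ, (mk s(v t, v (t + 1)) : ℕ) ≠ 0) hc'
      rw [Fintype.card_fin] at this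
      refine (prob_mono ?_).trans this
      rintro mk ⟨c, c', v, h0, h1, h2, h3, h4⟩
      exact ⟨c', c, v, ⟨h0, h1, h2, h3⟩, h4⟩)
  refine h.trans ?_
  rw [mul_comm]
  gcongr
  exact prob_sel_single_le _

end Bounds
end AEC

namespace AEC
open scoped Classical
open Finset SimpleGraph

section Fail
variable {V α : Type*} {d R P s : ℕ}

/-- The tentative colour of `e` has to be discarded. -/
def Fail (G : SimpleGraph V) (D : ℕ) (O : α → V → V → Prop) (ℓ n₀ K : ℕ) (y : Seed V d R P s)
    (e : Sym2 V) : Prop :=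
  tcol G D y e = none ∨ (y.2.2.1 e : ℕ) = 0 ∨
    ∃ x z, e = s(x, z) ∧ (FBad G D ℓ y x z ∨ EBad G D O n₀ (K + 1) y x z)

/-- The upper bound for the conditional failure probability of a selected edge. -/
noncomputable def failBound (N d D R P s ℓ n₀ K B b : ℕ) (x : ℝ) : ℝ :=
  2 * d * (D / d * (1 / R)) + 2 * ((1 + (D : ℝ) / d * (x - 1)) ^ d / x ^ (B + 1)) +
  (1 - (b : ℝ) / s) ^ b + 1 / P + 2 * (s * (1 - 1 / (P : ℝ)) ^ ℓ) + 2 * (N * ((D : ℝ) / s) ^ K) +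
  2 * ∑ n ∈ Icc n₀ (K + 1), ∑ w ∈ range (2 * R + 2),
    N * (2 / d * (D : ℝ) ^ w * ((D : ℝ) / s) ^ (n - 1))

variable {G : SimpleGraph V} {D : ℕ} {O : α → V → V → Prop} [Fintype V] [Fintype α]

lemma prob_ebad_le (hO : ∀ a x y z, O a x y → O a x z → y = z) (hsymm : ∀ a x y, O a x y → O a y x)
    (hdeg : ∀ x, (inc G x).card ≤ d) (hd : 0 < d) (hs : 0 < s) {n₀ : ℕ} (hn₀ : 2 ≤ n₀) (K : ℕ)
    (x x' : V) :
    prob (fun y : Seed V d R P s => EBad G D O n₀ (K + 1) y x x') ≤ D / d *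
      (Fintype.card α * ((D : ℝ) / s) ^ K + ∑ n ∈ Icc n₀ (K + 1), ∑ w ∈ range (2 * R + 2),
        Fintype.card α * (2 / d * (D : ℝ) ^ w * ((D : ℝ) / s) ^ (n - 1))) := by
  have hG : ∀ x, (univ.filter fun y => G.Adj x y).card ≤ d := fun x => card_inc G x ▸ hdeg x
  have h1 : ∀ y : Seed V d R P s, EBad G D O n₀ (K + 1) y x x' →
      (∃ a, EBadLong G D (O a) (K + 1) y x x') ∨
        ∃ n ∈ Icc n₀ (K + 1), ∃ a, EBadReturn G D (O a) n y x x' := by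
    rintro y ⟨a, ⟨n, hn, hn', h⟩ | h⟩
    · exact Or.inr ⟨n, mem_Icc.2 ⟨hn, hn'⟩, a, h⟩
    · exact Or.inl ⟨a, h⟩
  refine (prob_mono h1).trans ((prob_or_le _ _).trans ?_)
  rw [mul_add, mul_sum]
  refine add_le_add ((prob_long_le hO hG hd hs x x' K).trans (le_of_eq (by ring)))
    ((prob_exists_mem_le _ _).trans (sum_le_sum fun n hn => ?_))
  obtain ⟨m, rfl⟩ : ∃ m, n = m + 2 := ⟨n - 2, by have := (mem_Icc.1 hn).1; omega⟩
  refine (prob_return_le hO hsymm hG hd hs x x' m).trans (le_of_eq ?_)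
  rw [mul_sum]
  refine sum_congr rfl fun w _ => ?_
  rw [show m + 2 - 1 = m + 1 by omega]
  ring

lemma prob_tcol_none_le {g : ℕ} (hg : GirthGe G g) (hRg : 2 * R + 1 < g)
    (hdeg : ∀ x, (inc G x).card ≤ d) {u v : V} (huv : G.Adj u v) {B b : ℕ} (hb : b + B ≤ s) {x : ℝ}
    (hx : 1 ≤ x) :
    prob (fun y : Seed V d R P s => (y.1 s(u, v) : ℕ) < D ∧ tcol G D y s(u, v) = none) ≤ D / d *
      (2 * d * (D / d * (1 / R)) + 2 * ((1 + (D : ℝ) / d * (x - 1)) ^ d / x ^ (B + 1)) +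
        (1 - (b : ℝ) / s) ^ b) := by
  set e := s(u, v) with he
  set S := (inc G u).erase e ∪ (inc G v).erase e with hS
  have hcard : (S.card : ℝ) ≤ 2 * d := by
    have h1 : ∀ x, ((inc G x).erase e).card ≤ d := fun x =>
      (card_le_card (erase_subset _ _)).trans (hdeg x)
    have := (card_union_le _ _).trans (add_le_add (h1 u) (h1 v))
    rw [two_mul]
    exact_mod_cast this
  let E₁ : Seed V d R P s → Prop := fun y => ∃ f ∈ S, ((y.1 e : ℕ) < D ∧ (y.1 f : ℕ) < D) ∧
      (y.2.1 f : ℕ) = y.2.1 e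
  let E₂ : V → Seed V d R P s → Prop := fun w y => (y.1 e : ℕ) < D ∧
      B + 1 ≤ (((inc G w).erase e).filter fun f => (y.1 f : ℕ) < D).card
  let E₃ : Seed V d R P s → Prop := fun y => (y.1 s(u, v) : ℕ) < D ∧
      (actv (selGraph G D y) (fun e => (y.2.1 e : ℕ)) s(u, v) ∧
      (((inc G u).erase s(u, v)).filter fun f => (y.1 f : ℕ) < D).card ≤ B ∧
      (((inc G v).erase s(u, v)).filter fun f => (y.1 f : ℕ) < D).card ≤ B ∧
      tcol G D y s(u, v) = none)
  have h1 : ∀ y : Seed V d R P s, ((y.1 e : ℕ) < D ∧ tcol G D y e = none) →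
      (E₁ y ∨ (E₂ u y ∨ E₂ v y)) ∨ E₃ y := by
    rintro y ⟨hy, hn⟩
    by_cases ha : actv (selGraph G D y) (fun e => (y.2.1 e : ℕ)) e
    · by_cases hu : (((inc G u).erase e).filter fun f => (y.1 f : ℕ) < D).card ≤ B
      · by_cases hv : (((inc G v).erase e).filter fun f => (y.1 f : ℕ) < D).card ≤ B
        · exact Or.inr ⟨hy, ha, hu, hv, hn⟩
        · exact Or.inl (Or.inr (Or.inr ⟨hy, not_le.1 hv⟩))
      · exact Or.inl (Or.inr (Or.inl ⟨hy, not_le.1 hu⟩))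
    · left; left
      have : ∃ f, conf (selGraph G D y) e f ∧ (y.2.1 f : ℕ) = y.2.1 e := by
        by_contra hcon
        push Not at hcon
        exact ha ⟨mem_edgeSub.2 ⟨huv, hy⟩, hcon⟩
      obtain ⟨f, ⟨hne, -, hf, w, hwe, hwf⟩, htm⟩ := this
      have hf' := mem_edgeSub.1 hf
      refine ⟨f, ?_, ⟨hy, hf'.2⟩, htm⟩
      rw [hS, mem_union, mem_erase, mem_erase, mem_inc, mem_inc]
      rcases Sym2.mem_iff.1 hwe with rfl | rfl
      · exact Or.inl ⟨hne.symm, hf'.1, hwf⟩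
      · exact Or.inr ⟨hne.symm, hf'.1, hwf⟩
  have b1 : prob E₁ ≤ 2 * d * (D / d * (D / d * (1 / R))) := by
    refine (prob_exists_mem_le_card S _ fun f hf => prob_clash_le ?_).trans ?_
    · rw [hS, mem_union, mem_erase, mem_erase] at hf
      rcases hf with hf | hf
      · exact hf.1
      · exact hf.1
    · gcongr
  have b2 : ∀ w, prob (E₂ w) ≤ _ := fun w => prob_over_le (R := R) (P := P) (s := s) hdeg w hx B
  have b3 : prob E₃ ≤ _ := prob_none_le hg hRg hb
  refine (prob_mono h1).trans ((prob_or_le _ _).trans ?_)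
  refine (add_le_add ((prob_or_le _ _).trans (add_le_add b1 ((prob_or_le _ _).trans
    (add_le_add (b2 u) (b2 v))))) b3).trans (le_of_eq ?_)
  ring

theorem prob_fail_le {g : ℕ} (hg : GirthGe G g) (hRg : 2 * R + 1 < g)
    (hdeg : ∀ x, (inc G x).card ≤ d) (hd : 0 < d) (hs : 0 < s) (hP : 0 < P)
    (hO : ∀ a x y z, O a x y → O a x z → y = z) (hsymm : ∀ a x y, O a x y → O a y x)
    {ℓ n₀ K B b : ℕ} (hℓ : 0 < ℓ) (hn₀ : 2 ≤ n₀) (hb : b + B ≤ s) {x : ℝ} (hx : 1 ≤ x)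
    {e : Sym2 V} (he : e ∈ G.edgeSet) :
    prob (fun y : Seed V d R P s => (y.1 e : ℕ) < D ∧ Fail G D O ℓ n₀ K y e) ≤
      D / d * failBound (Fintype.card α) d D R P s ℓ n₀ K B b x := by
  induction e with | _ u v =>
  have huv : G.Adj u v := he
  have h1 : ∀ y : Seed V d R P s, ((y.1 s(u, v) : ℕ) < D ∧ Fail G D O ℓ n₀ K y s(u, v)) →
      (((y.1 s(u, v) : ℕ) < D ∧ tcol G D y s(u, v) = none) ∨
        ((y.1 s(u, v) : ℕ) < D ∧ (y.2.2.1 s(u, v) : ℕ) = 0)) ∨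
      ((((y.1 s(u, v) : ℕ) < D ∧ FBad G D ℓ y u v) ∨ ((y.1 s(v, u) : ℕ) < D ∧ FBad G D ℓ y v u)) ∨
       (EBad G D O n₀ (K + 1) y u v ∨ EBad G D O n₀ (K + 1) y v u)) := by
    rintro y ⟨hy, h | h | ⟨a, a', haa, h⟩⟩
    · exact Or.inl (Or.inl ⟨hy, h⟩)
    · exact Or.inl (Or.inr ⟨hy, h⟩)
    · right
      have hy' := hy
      rw [Sym2.eq_swap] at hy'
      rcases Sym2.eq_iff.1 haa with ⟨rfl, rfl⟩ | ⟨rfl, rfl⟩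
      · rcases h with h | h
        · exact Or.inl (Or.inl ⟨hy, h⟩)
        · exact Or.inr (Or.inl h)
      · rcases h with h | h
        · exact Or.inl (Or.inr ⟨hy', h⟩)
        · exact Or.inr (Or.inr h)
  have be := prob_ebad_le (R := R) (P := P) (D := D) hO hsymm hdeg hd hs hn₀ K
  refine (prob_mono h1).trans ((prob_or_le _ _).trans ?_)
  refine (add_le_add ((prob_or_le _ _).trans (add_le_add
      (prob_tcol_none_le hg hRg hdeg huv hb hx) (prob_mark_le _)))
    ((prob_or_le _ _).trans (add_le_add
      ((prob_or_le _ _).trans (add_le_add (prob_fbad_le hP hℓ u v) (prob_fbad_le hP hℓ v u)))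
      ((prob_or_le _ _).trans (add_le_add (be u v) (be v u)))))).trans (le_of_eq ?_)
  rw [failBound]
  ring

end Fail
end AEC

namespace AEC
open scoped Classical
open Finset SimpleGraph

section Deterministic
variable {V α : Type*} {d R P s : ℕ} {G G₀ : SimpleGraph V} {D g : ℕ} {y : Seed V d R P s}

lemma fbad_of_alternating (hg : GirthGe G g) {ℓ : ℕ} (hℓ : ℓ < g) {c c' : Fin s} (hcc : c ≠ c')
    {v : ℕ → V} (h : ∀ t, tcol G D y s(v t, v (t + 1)) = some (if Even t then c else c'))
    (hm : ∀ t, (y.2.2.1 s(v t, v (t + 1)) : ℕ) ≠ 0) : FBad G D ℓ y (v 0) (v 1) := by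
  refine ⟨c, c', v, rfl, rfl, fun t _ => h t, fun i j hij hj => ?_, fun t _ => hm t⟩
  refine hg.seq_edge_ne v ℓ (fun t _ => (tcol_adj (h t)).1) (fun t _ hback => ?_) hℓ hij hj
  have h1 := h t
  have h2 := h (t + 1)
  rw [show t + 1 + 1 = t + 2 by omega, hback, Sym2.eq_swap, h1] at h2
  by_cases ht : Even t
  · simp [ht, Nat.even_add_one, hcc] at h2
  · simp [ht, Nat.even_add_one, Ne.symm hcc] at h2

lemma exists_ebad_of_alternating [Finite V] (hg : GirthGe G₀ g) (hG : G ≤ G₀)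
    {O : α → V → V → Prop} (hO : ∀ a x y, O a x y → G₀.Adj x y ∧ ¬ G.Adj x y) {n₀ K : ℕ}
    (hn₀ : 2 * n₀ + 2 * R ≤ g) {a : α} {c : Fin s}
    {v : ℕ → V} (h : ∀ l, tcol G D y s(v (2 * l), v (2 * l + 1)) = some c)
    (h' : ∀ l, O a (v (2 * l + 1)) (v (2 * l + 2))) :
    ∃ l, EBad G D O n₀ K y (v (2 * l)) (v (2 * l + 1)) := by
  let f : ℕ → Sym2 V := fun l => s(v (2 * l), v (2 * l + 1))
  set H := selGraph G D y with hH
  have hadj : ∀ l, H.Adj (v (2 * l)) (v (2 * l + 1)) := fun l => tcol_adj (h l)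
  have hex : ∃ n, 0 < n ∧ ∃ l, ¬ far H (2 * R) (f l) (f (l + n)) := by
    obtain ⟨i, j, hij, he⟩ := Finite.exists_ne_map_eq_of_infinite fun l => v (2 * l)
    have key : ∀ i j, i < j → v (2 * i) = v (2 * j) →
        ∃ n, 0 < n ∧ ∃ l, ¬ far H (2 * R) (f l) (f (l + n)) := by
      intro i j hij he
      refine ⟨j - i, by omega, i, not_far_of_mem (x := v (2 * i)) (Sym2.mem_mk_left _ _) ?_⟩
      rw [show i + (j - i) = j by omega, he]
      exact Sym2.mem_mk_left _ _
    rcases lt_or_gt_of_ne hij with hlt | hlt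
    · exact key i j hlt he
    · exact key j i hlt he.symm
  obtain ⟨n, ⟨hn, l, hl⟩, hmin⟩ : ∃ n, (0 < n ∧ ∃ l, ¬ far H (2 * R) (f l) (f (l + n))) ∧
      ∀ m, 0 < m → m < n → ∀ l, far H (2 * R) (f l) (f (l + m)) := by
    refine ⟨Nat.find hex, Nat.find_spec hex, fun m hm hmn l => ?_⟩
    by_contra hc
    exact Nat.find_min hex hmn ⟨hm, l, hc⟩
  have hfar : ∀ i j, i < j → j < i + n → far H (2 * R) (f i) (f j) := by
    intro i j hij hj
    have := hmin (j - i) (by omega) (by omega) i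
    rwa [show i + (j - i) = j by omega] at this
  refine ⟨l, a, ?_⟩
  have halt : ∀ m ≤ n, AltFar G D (O a) y c (fun t => v (2 * l + t)) m := by
    intro m hm
    refine ⟨fun i _ => ?_, fun i _ => ?_, fun i j hij hj => ?_⟩
    · have := h (l + i)
      rwa [mul_add] at this
    · have := h' (l + i)
      rwa [mul_add] at this
    · have := hfar (l + i) (l + j) (by omega) (by omega)
      simpa only [f, mul_add, add_assoc] using this
  rcases Nat.lt_or_ge n K with hnK | hnK
  swap
  · exact Or.inr ⟨c, fun t => v (2 * l + t), rfl, rfl, halt K hnK⟩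
  have hret : ∃ z, (z = v (2 * l) ∨ z = v (2 * l + 1)) ∧ ∃ p : H.Walk z (v (2 * (l + n))),
      p.length ≤ 2 * R + 1 := by
    simp only [far] at hl
    push Not at hl
    obtain ⟨z, hz, b, hb, p, hp⟩ := hl
    refine ⟨z, Sym2.mem_iff.1 hz, ?_⟩
    rcases Sym2.mem_iff.1 hb with rfl | rfl
    · exact ⟨p, by omega⟩
    · exact ⟨p.concat (hadj (l + n)).symm, by simpa using hp⟩
  have hlast : 2 * l + (2 * (n - 1) + 2) = 2 * (l + n) := by omega
  left
  refine ⟨n, ?_, hnK.le, c, fun t => v (2 * l + t), rfl, rfl, halt n le_rfl, ?_, ?_⟩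
  swap
  · have := h' (l + (n - 1))
    rwa [mul_add] at this
  swap
  · change ∃ z, (z = v (2 * l) ∨ z = v (2 * l + 1)) ∧
      ∃ p : H.Walk z (v (2 * l + (2 * (n - 1) + 2))), p.length ≤ 2 * R + 1
    rw [hlast]
    exact hret
  by_contra hnn
  obtain ⟨z, hz, p, hp⟩ := hret
  have hHG : H ≤ G₀ := (selGraph_le y).trans hG
  obtain ⟨q, hq, hqe⟩ := exists_walk_of_seq (G := G₀) v (2 * l + 2) (2 * (n - 1)) (fun t _ _ => by
    rcases Nat.even_or_odd' t with ⟨k, rfl | rfl⟩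
    · exact hHG (hadj k)
    · exact (hO _ _ _ (h' k)).1)
  have hq' : 2 * l + 2 + 2 * (n - 1) = 2 * (l + n) := by omega
  obtain ⟨r, hr, hre⟩ : ∃ r : H.Walk z (v (2 * l + 1)), r.length ≤ 1 ∧ True := by
    rcases hz with rfl | rfl
    · exact ⟨Walk.cons (hadj l) Walk.nil, by simp⟩
    · exact ⟨Walk.nil, by simp⟩
  have hOl := hO _ _ _ (h' l)
  have hnotH : ∀ {x x' : V} (p : H.Walk x x'), s(v (2 * l + 1), v (2 * l + 2)) ∉ p.edges := by
    intro x x' p hp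
    exact hOl.2 (selGraph_le y (p.edges_subset_edgeSet hp))
  have := hg.le_of_walk hOl.1 ((q.copy rfl (by rw [hq'])).append ((p.reverse.append r).mapLe hHG)) (by
    rw [Walk.edges_append, List.mem_append, Walk.edges_copy, Walk.edges_mapLe_eq_edges]
    rintro (hh | hh)
    swap
    · exact hnotH _ hh
    obtain ⟨t, ht1, ht2, hh⟩ := hqe _ hh
    rcases Nat.even_or_odd' t with ⟨k, rfl | rfl⟩
    · have : s(v (2 * l + 1), v (2 * l + 2)) ∈ H.edgeSet := hh ▸ hadj k
      exact hOl.2 (selGraph_le y this)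
    · rcases Sym2.eq_iff.1 hh with ⟨h1, -⟩ | ⟨h1, h2⟩
      · refine not_far_of_mem (x := v (2 * l + 1)) (Sym2.mem_mk_right _ _) ?_
          (hfar l k (by omega) (by omega))
        rw [h1]
        exact Sym2.mem_mk_right _ _
      · rcases Nat.lt_or_ge (l + 1) k with hk | hk
        · refine not_far_of_mem (x := v (2 * l + 2)) (Sym2.mem_mk_left _ _) ?_
            (hfar (l + 1) k hk (by omega))
          rw [h2]
          exact Sym2.mem_mk_right _ _
        · obtain rfl : k = l + 1 := by omega
          refine (hadj (l + 1)).ne ?_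
          rw [← h2]
          rfl)
  rw [Walk.length_append, Walk.length_copy, Walk.length_map, Walk.length_append,
    Walk.length_reverse] at this
  omega

end Deterministic
end AEC

namespace AEC
open scoped Classical
open Finset SimpleGraph

section Stage
variable {V A : Type*} {d R P s m : ℕ}

/-- A partial proper edge colouring without infinite alternating sequences of two colours. -/
structure PartialColouring (G : SimpleGraph V) (χ : Sym2 V → Option A) : Prop where
  mem : ∀ e a, χ e = some a → e ∈ G.edgeSet
  proper : ∀ a x y z, χ s(x, y) = some a → χ s(x, z) = some a → y = z
  noAlt : ∀ (v : ℕ → V) (a b : A), a ≠ b →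
    ¬ ∀ l, χ s(v (2 * l), v (2 * l + 1)) = some a ∧ χ s(v (2 * l + 1), v (2 * l + 2)) = some b

variable (G : SimpleGraph V) (χ : Sym2 V → Option A) (D : ℕ) (ω : Fin m → Seed V d R P s)

/-- The uncoloured edges that were not selected by the parts before `j`. -/
def partGraph (j : Fin m) : SimpleGraph V :=
  edgeSub G fun e => χ e = none ∧ ∀ i < j, ¬ ((ω i).1 e : ℕ) < D

/-- The tentative colouring of part `j`. -/
noncomputable def pcol (j : Fin m) : Sym2 V → Option (Fin s) :=
  tcol (partGraph G χ D ω j) D (ω j)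

/-- The colour classes that are present before part `j`. -/
def oldRel (j : Fin m) : A ⊕ (Fin m × Fin s) → V → V → Prop
  | .inl a, x, y => χ s(x, y) = some a
  | .inr (i, c), x, y => i < j ∧ pcol G χ D ω i s(x, y) = some c

/-- The edge `e` fails in part `j`. -/
def PartFail (ℓ n₀ K : ℕ) (j : Fin m) (e : Sym2 V) : Prop :=
  Fail (partGraph G χ D ω j) D (oldRel G χ D ω j) ℓ n₀ K (ω j) e

/-- The edge `e` gets the colour `b` in the new colouring. -/
def Gets (ℓ n₀ K : ℕ) : A ⊕ (Fin m × Fin s) → Sym2 V → Prop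
  | .inl a, e => χ e = some a
  | .inr (j, c), e => pcol G χ D ω j e = some c ∧ ¬ PartFail G χ D ω ℓ n₀ K j e

/-- The colouring after the stage. -/
noncomputable def newCol (ℓ n₀ K : ℕ) (e : Sym2 V) : Option (A ⊕ (Fin m × Fin s)) :=
  if h : ∃ b, Gets G χ D ω ℓ n₀ K b e then some h.choose else none

variable {G χ D ω} {ℓ n₀ K : ℕ}

lemma pcol_mem {j : Fin m} {e : Sym2 V} {c : Fin s} (h : pcol G χ D ω j e = some c) :
    e ∈ G.edgeSet ∧ χ e = none ∧ (∀ i < j, ¬ ((ω i).1 e : ℕ) < D) ∧ ((ω j).1 e : ℕ) < D := by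
  obtain ⟨h1, h2⟩ := tcol_mem h
  obtain ⟨h3, h4, h5⟩ := mem_edgeSub.1 h1
  exact ⟨h3, h4, h5, h2⟩

lemma gets_unique {b b' : A ⊕ (Fin m × Fin s)} {e : Sym2 V} (h : Gets G χ D ω ℓ n₀ K b e)
    (h' : Gets G χ D ω ℓ n₀ K b' e) : b = b' := by
  rcases b with a | ⟨i, c⟩ <;> rcases b' with a' | ⟨i', c'⟩
  · have : some a = some a' := h.symm.trans h'
    simpa using this
  · exact absurd (h.symm.trans (pcol_mem h'.1).2.1) (by simp)
  · exact absurd (h'.symm.trans (pcol_mem h.1).2.1) (by simp)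
  · obtain ⟨-, -, h1, h2⟩ := pcol_mem h.1
    obtain ⟨-, -, h1', h2'⟩ := pcol_mem h'.1
    rcases lt_trichotomy i i' with hlt | rfl | hlt
    · exact absurd h2 (h1' i hlt)
    · have := h.1.symm.trans h'.1
      simp only [Option.some.injEq] at this
      rw [this]
    · exact absurd h2' (h1 i' hlt)

lemma newCol_eq_some {e : Sym2 V} {b : A ⊕ (Fin m × Fin s)} :
    newCol G χ D ω ℓ n₀ K e = some b ↔ Gets G χ D ω ℓ n₀ K b e := by
  unfold newCol
  split_ifs with h
  · rw [Option.some.injEq]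
    constructor
    · rintro rfl
      exact h.choose_spec
    · exact fun h' => gets_unique h.choose_spec h'
  · simp only [false_iff]
    exact fun h' => h ⟨b, h'⟩

lemma oldRel_functional (hχ : PartialColouring G χ) (j : Fin m) (a : A ⊕ (Fin m × Fin s))
    (x y z : V) (h : oldRel G χ D ω j a x y) (h' : oldRel G χ D ω j a x z) : y = z := by
  rcases a with a | ⟨i, c⟩
  · exact hχ.proper a x y z h h'
  · exact tcol_next h.2 h'.2

lemma oldRel_symm (j : Fin m) (a : A ⊕ (Fin m × Fin s)) (x y : V)
    (h : oldRel G χ D ω j a x y) : oldRel G χ D ω j a y x := by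
  rcases a with a | ⟨i, c⟩
  · change χ s(y, x) = some a
    rw [Sym2.eq_swap]
    exact h
  · refine ⟨h.1, ?_⟩
    rw [Sym2.eq_swap]
    exact h.2

lemma oldRel_adj (hχ : PartialColouring G χ) (j : Fin m) (a : A ⊕ (Fin m × Fin s)) (x y : V)
    (h : oldRel G χ D ω j a x y) : G.Adj x y ∧ ¬ (partGraph G χ D ω j).Adj x y := by
  rcases a with a | ⟨i, c⟩
  · exact ⟨hχ.mem _ _ h, fun h' => absurd (h.symm.trans h'.2.1) (by simp)⟩
  · obtain ⟨h1, -, -, h4⟩ := pcol_mem h.2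
    exact ⟨h1, fun h' => h'.2.2 i h.1 h4⟩

lemma partGraph_le (j : Fin m) : partGraph G χ D ω j ≤ G := fun _ _ h => h.1

/-- The new colouring has the required properties. -/
lemma newCol_partialColouring [Finite V] (hχ : PartialColouring G χ) {g : ℕ} (hg : GirthGe G g)
    (hℓ : ℓ < g) (hn₀ : 2 * n₀ + 2 * R ≤ g) :
    PartialColouring G (newCol G χ D ω ℓ n₀ K) := by
  refine ⟨fun e b h => ?_, fun b x y z h h' => ?_, ?_⟩
  · rw [newCol_eq_some] at h
    rcases b with a | ⟨i, c⟩
    · exact hχ.mem _ _ h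
    · exact (pcol_mem h.1).1
  · rw [newCol_eq_some] at h h'
    rcases b with a | ⟨i, c⟩
    · exact hχ.proper a x y z h h'
    · exact tcol_next h.1 h'.1
  · simp only [newCol_eq_some]
    have key : ∀ (v : ℕ → V) (j : Fin m) (c : Fin s) (a : A ⊕ (Fin m × Fin s)),
        (∀ l, Gets G χ D ω ℓ n₀ K (.inr (j, c)) s(v (2 * l), v (2 * l + 1))) →
        (∀ l, oldRel G χ D ω j a (v (2 * l + 1)) (v (2 * l + 2))) → False := by
      intro v j c a h h'
      obtain ⟨l, hl⟩ := exists_ebad_of_alternating (K := K + 1) hg (partGraph_le j)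
        (oldRel_adj hχ j) hn₀ (fun l => (h l).1) h'
      exact (h l).2 (Or.inr (Or.inr ⟨_, _, rfl, Or.inr hl⟩))
    have shift : ∀ {v : ℕ → V} {a b : A ⊕ (Fin m × Fin s)},
        (∀ l, Gets G χ D ω ℓ n₀ K a s(v (2 * l), v (2 * l + 1)) ∧
          Gets G χ D ω ℓ n₀ K b s(v (2 * l + 1), v (2 * l + 2))) →
        (∀ l, Gets G χ D ω ℓ n₀ K b s(v (2 * l + 1), v (2 * l + 1 + 1)) ∧
          Gets G χ D ω ℓ n₀ K a s(v (2 * l + 1 + 1), v (2 * l + 2 + 1))) :=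
      fun h l => ⟨(h l).2, (h (l + 1)).1⟩
    intro v a b hab h
    rcases a with a | ⟨i, c⟩ <;> rcases b with b | ⟨j, c'⟩
    · exact hχ.noAlt v a b (fun hh => hab (by rw [hh])) h
    · exact key (fun t => v (t + 1)) j c' (.inl a) (fun l => (shift h l).1) fun l => (shift h l).2
    · exact key v i c (.inl b) (fun l => (h l).1) fun l => (h l).2
    · rcases lt_trichotomy i j with hlt | rfl | hlt
      · exact key (fun t => v (t + 1)) j c' (.inr (i, c)) (fun l => (shift h l).1)
          fun l => ⟨hlt, (shift h l).2.1⟩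
      · have hcc : c ≠ c' := fun hh => hab (by rw [hh])
        have h' : ∀ t, Gets G χ D ω ℓ n₀ K (.inr (i, if Even t then c else c'))
            s(v t, v (t + 1)) := by
          intro t
          rcases Nat.even_or_odd' t with ⟨k, rfl | rfl⟩
          · simpa using (h k).1
          · simpa [Nat.even_add_one] using (h k).2
        have := fbad_of_alternating (y := ω i) (hg.mono (partGraph_le i)) hℓ hcc
          (fun t => (h' t).1) fun t hm => (h' t).2 (Or.inr (Or.inl hm))
        exact (h' 0).2 (Or.inr (Or.inr ⟨_, _, rfl, Or.inl this⟩))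
      · exact key v i c (.inr (j, c')) (fun l => (h l).1) fun l => ⟨hlt, (h l).2.1⟩

lemma newCol_eq_none {e : Sym2 V} (he : e ∈ G.edgeSet) (h : newCol G χ D ω ℓ n₀ K e = none) :
    χ e = none ∧ ((∀ j, ¬ ((ω j).1 e : ℕ) < D) ∨
      ∃ j, e ∈ (partGraph G χ D ω j).edgeSet ∧ ((ω j).1 e : ℕ) < D ∧
        PartFail G χ D ω ℓ n₀ K j e) := by
  have h' : ∀ b, ¬ Gets G χ D ω ℓ n₀ K b e := fun b hb => by
    rw [newCol_eq_some.2 hb] at h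
    simp at h
  have hχ : χ e = none := by
    rw [Option.eq_none_iff_forall_ne_some]
    exact fun a => h' (.inl a)
  refine ⟨hχ, ?_⟩
  by_cases hs : ∀ j, ¬ ((ω j).1 e : ℕ) < D
  · exact Or.inl hs
  · right
    push Not at hs
    have hne : (univ.filter fun j => ((ω j).1 e : ℕ) < D).Nonempty := by
      obtain ⟨j, hj⟩ := hs
      exact ⟨j, by simpa using hj⟩
    obtain ⟨j, hj, hmin⟩ := exists_min_image _ id hne
    simp only [mem_filter, mem_univ, true_and, id] at hj hmin
    have hmem : e ∈ (partGraph G χ D ω j).edgeSet :=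
      mem_edgeSub.2 ⟨he, hχ, fun i hi hsel => absurd (hmin i hsel) (not_le.2 hi)⟩
    refine ⟨j, hmem, hj, ?_⟩
    by_contra hf
    rcases hc : pcol G χ D ω j e with _ | c
    · exact hf (Or.inl hc)
    · exact h' (.inr (j, c)) ⟨hc, hf⟩

end Stage
end AEC

namespace AEC
open scoped Classical
open Finset SimpleGraph

section Local
variable {V A : Type*} {d R P s m : ℕ}

/-- The vertex `x` has distance at most `r` from `v`. -/
def reach (G : SimpleGraph V) (v : V) (r : ℕ) (x : V) : Prop := ∃ p : G.Walk v x, p.length ≤ r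

/-- All random choices agree on the edges with an endpoint at distance at most `r` from `v`. -/
def Agree (G : SimpleGraph V) (v : V) (r : ℕ) (ω ω' : Fin m → Seed V d R P s) : Prop :=
  ∀ e ∈ G.edgeSet, ∀ x ∈ e, reach G v r x → ∀ j, (ω j).1 e = (ω' j).1 e ∧
    (ω j).2.1 e = (ω' j).2.1 e ∧ (ω j).2.2.1 e = (ω' j).2.2.1 e ∧
    (ω j).2.2.2 e = (ω' j).2.2.2 e

variable {G H : SimpleGraph V} {χ : Sym2 V → Option A} {D : ℕ} {ω ω' : Fin m → Seed V d R P s}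
  {v x y : V} {r r' k ℓ n₀ K : ℕ} {j : Fin m} {e : Sym2 V}

lemma reach_self : reach G v r v := ⟨.nil, by simp⟩

lemma reach.mono (h : reach G v r x) (hr : r ≤ r') : reach G v r' x := h.imp fun _ hp => hp.trans hr

lemma reach.walk (h : reach G v r x) (hH : H ≤ G) (p : H.Walk x y) (hr : r + p.length ≤ r') :
    reach G v r' y := by
  obtain ⟨q, hq⟩ := h
  refine ⟨q.append (p.mapLe hH), ?_⟩
  simp only [Walk.length_append, Walk.length_map, Walk.mapLe]
  omega

lemma reach.adj (h : reach G v r x) (ha : G.Adj x y) (hr : r < r') : reach G v r' y :=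
  h.walk le_rfl ha.toWalk (by simpa using hr)

lemma Agree.mono (h : Agree G v r ω ω') (hr : r' ≤ r) : Agree G v r' ω ω' :=
  fun e he x hx hv => h e he x hx (hv.mono hr)

lemma Agree.symm (h : Agree G v r ω ω') : Agree G v r ω' ω := fun e he x hx hv j => by
  obtain ⟨h1, h2, h3, h4⟩ := h e he x hx hv j
  exact ⟨h1.symm, h2.symm, h3.symm, h4.symm⟩

lemma mem_partGraph (j : Fin m) (ha : Agree G v r ω ω') (hx : x ∈ e) (hr : reach G v r x) :
    e ∈ (partGraph G χ D ω j).edgeSet ↔ e ∈ (partGraph G χ D ω' j).edgeSet := by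
  simp only [partGraph, mem_edgeSub]
  refine and_congr_right fun he => and_congr_right fun _ => ?_
  exact forall_congr' fun i => by rw [(ha e he x hx hr i).1]

lemma mem_selGraph (j : Fin m) (ha : Agree G v r ω ω') (hx : x ∈ e) (hr : reach G v r x) :
    e ∈ (selGraph (partGraph G χ D ω j) D (ω j)).edgeSet ↔
      e ∈ (selGraph (partGraph G χ D ω' j) D (ω' j)).edgeSet := by
  simp only [selGraph, mem_edgeSub]
  rw [mem_partGraph j ha hx hr]
  refine and_congr_right fun he => ?_
  rw [(ha e (mem_edgeSub.1 he).1 x hx hr j).1]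

lemma selGraph_part_le (j : Fin m) : selGraph (partGraph G χ D ω j) D (ω j) ≤ G :=
  (selGraph_le ..).trans (partGraph_le j)

lemma exists_walk_selGraph (ha : Agree G v r ω ω') :
    ∀ {x y : V} (p : (selGraph (partGraph G χ D ω j) D (ω j)).Walk x y) (k : ℕ),
      reach G v k x → k + p.length ≤ r →
      ∃ p' : (selGraph (partGraph G χ D ω' j) D (ω' j)).Walk x y, p'.length = p.length
  | _, _, .nil, _, _, _ => ⟨.nil, rfl⟩
  | x, _, .cons (v := z) h p, k, hk, hr => by
    rw [Walk.length_cons] at hr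
    obtain ⟨p', hp'⟩ := exists_walk_selGraph ha p (k + 1)
      (hk.adj (selGraph_part_le j h) (by omega)) (by omega)
    have h' : (selGraph (partGraph G χ D ω' j) D (ω' j)).Adj x z :=
      (mem_selGraph (e := s(x, z)) j ha (Sym2.mem_mk_left x z) (hk.mono (by omega))).1 h
    exact ⟨.cons h' p', by simp [hp']⟩

lemma far_congr (ha : Agree G v r ω ω') {e f : Sym2 V} {W : ℕ}
    (he : ∀ x ∈ e, reach G v k x) (hk : k + W ≤ r)
    (h : far (selGraph (partGraph G χ D ω j) D (ω j)) W e f) :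
    far (selGraph (partGraph G χ D ω' j) D (ω' j)) W e f := by
  intro x hx y hy p
  by_contra hp
  obtain ⟨p', hp'⟩ := exists_walk_selGraph ha.symm p k (he x hx) (by omega)
  have := h x hx y hy p'
  omega

lemma pcol_congr (j : Fin m) (ha : Agree G v r ω ω') (hx : x ∈ e) (hr : reach G v k x)
    (hk : k + R ≤ r) : pcol G χ D ω' j e = pcol G χ D ω j e := by
  have hxr : reach G v r x := hr.mono (by omega)
  by_cases he : e ∈ (selGraph (partGraph G χ D ω j) D (ω j)).edgeSet
  · have hW : ∀ f ∈ Dep (conf (selGraph (partGraph G χ D ω j) D (ω j)))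
        (fun e => ((ω j).2.1 e : ℕ)) e, ∀ y ∈ f, reach G v r y := by
      intro f hf y hy
      obtain ⟨p, hp, -⟩ := exists_walk_of_mem_dep he hf hx hy
      have := ((ω j).2.1 e).2
      refine hr.walk (selGraph_part_le j) p ?_
      omega
    have hWG : ∀ f ∈ Dep (conf (selGraph (partGraph G χ D ω j) D (ω j)))
        (fun e => ((ω j).2.1 e : ℕ)) e, f ∈ G.edgeSet := by
      intro f hf
      have : f ∈ (selGraph (partGraph G χ D ω j) D (ω j)).edgeSet := by
        induction hf with
        | refl => exact he
        | tail _ h _ => exact h.2.2.2.1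
      exact edgeSet_mono (selGraph_part_le j) this
    have hconf : ∀ f ∈ Dep (conf (selGraph (partGraph G χ D ω j) D (ω j)))
        (fun e => ((ω j).2.1 e : ℕ)) e, ∀ f',
        (conf (selGraph (partGraph G χ D ω j) D (ω j)) f f' ↔
          conf (selGraph (partGraph G χ D ω' j) D (ω' j)) f f') := by
      intro f hf f'
      constructor
      · rintro ⟨h1, h2, h3, y, hy, hy'⟩
        exact ⟨h1, (mem_selGraph j ha hy (hW f hf y hy)).1 h2,
          (mem_selGraph j ha hy' (hW f hf y hy)).1 h3, y, hy, hy'⟩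
      · rintro ⟨h1, h2, h3, y, hy, hy'⟩
        exact ⟨h1, (mem_selGraph j ha hy (hW f hf y hy)).2 h2,
          (mem_selGraph j ha hy' (hW f hf y hy)).2 h3, y, hy, hy'⟩
    have htm : ∀ f ∈ Dep (conf (selGraph (partGraph G χ D ω j) D (ω j)))
        (fun e => ((ω j).2.1 e : ℕ)) e, ∀ f',
        (conf (selGraph (partGraph G χ D ω j) D (ω j)) f f') →
        (ω j).2.1 f = (ω' j).2.1 f ∧ (ω j).2.1 f' = (ω' j).2.1 f' := by
      rintro f hf f' ⟨h1, h2, h3, y, hy, hy'⟩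
      exact ⟨(ha f (hWG f hf) y hy (hW f hf y hy) j).2.1,
        (ha f' (edgeSet_mono (selGraph_part_le j) h3) y hy' (hW f hf y hy) j).2.1⟩
    refine phi_congr (Dep (conf (selGraph (partGraph G χ D ω j) D (ω j)))
        (fun e => ((ω j).2.1 e : ℕ)) e) ?_ ?_ ?_ ?_ e mem_dep_self
    · exact fun f hf f' h => Relation.ReflTransGen.tail hf h
    · intro f hf
      have hfx : ∃ y, y ∈ f := by induction f with | _ a b => exact ⟨a, Sym2.mem_mk_left a b⟩
      obtain ⟨y, hy⟩ := hfx
      refine and_congr (mem_selGraph j ha hy (hW f hf y hy)) (forall_congr' fun f' => ?_)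
      rw [← hconf f hf f']
      refine forall_congr' fun h => ?_
      beta_reduce
      rw [(htm f hf f' h).1, (htm f hf f' h).2]
    · intro f hf f'
      unfold Pred
      rw [← hconf f hf f', and_comm, and_comm (b := conf _ _ _)]
      refine and_congr_right fun h => ?_
      beta_reduce
      rw [(htm f hf f' h).1, (htm f hf f' h).2]
    · intro f hf
      have hfx : ∃ y, y ∈ f := by induction f with | _ a b => exact ⟨a, Sym2.mem_mk_left a b⟩
      obtain ⟨y, hy⟩ := hfx
      exact (ha f (hWG f hf) y hy (hW f hf y hy) j).2.2.2.symm
  · have he' : e ∉ (selGraph (partGraph G χ D ω' j) D (ω' j)).edgeSet := by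
      rwa [← mem_selGraph j ha hx hxr]
    have h1 : pcol G χ D ω j e = none := by
      rw [Option.eq_none_iff_forall_ne_some]
      exact fun c hc => he (col_mem hc)
    have h2 : pcol G χ D ω' j e = none := by
      rw [Option.eq_none_iff_forall_ne_some]
      exact fun c hc => he' (col_mem hc)
    rw [h1, h2]

lemma oldRel_congr (ha : Agree G v r ω ω') (hr : reach G v k x) (hk : k + R ≤ r)
    {a : A ⊕ (Fin m × Fin s)} (h : oldRel G χ D ω j a x y) : oldRel G χ D ω' j a x y := by
  rcases a with a | ⟨i, c⟩
  · exact h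
  · exact ⟨h.1, by rw [pcol_congr i ha (Sym2.mem_mk_left x y) hr hk]; exact h.2⟩

lemma fBad_congr (ha : Agree G v r ω ω') (hr : reach G v k x) (hk : k + ℓ + R ≤ r)
    (h : FBad (partGraph G χ D ω j) D ℓ (ω j) x y) :
    FBad (partGraph G χ D ω' j) D ℓ (ω' j) x y := by
  obtain ⟨c, c', w, h0, h1, h2, h3, h4⟩ := h
  have hG : ∀ t < ℓ, s(w t, w (t + 1)) ∈ G.edgeSet := fun t ht => (pcol_mem (h2 t ht)).1
  have hw : ∀ t, t < ℓ → reach G v (k + t) (w t) := by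
    intro t
    induction t with
    | zero => intro _; rw [h0]; exact hr
    | succ t ih => exact fun ht => (ih (by omega)).adj (hG t (by omega)) (by omega)
  refine ⟨c, c', w, h0, h1, fun t ht => ?_, h3, fun t ht => ?_⟩
  · rw [← h2 t ht]
    exact pcol_congr j ha (Sym2.mem_mk_left ..) (hw t ht) (by omega)
  · rw [← (ha _ (hG t ht) _ (Sym2.mem_mk_left ..) ((hw t ht).mono (by omega)) j).2.2.1]
    exact h4 t ht

lemma altFar_reach (hχ : PartialColouring G χ) {n : ℕ} {c : Fin s} {a : A ⊕ (Fin m × Fin s)}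
    {w : ℕ → V} (hr : reach G v k (w 0))
    (h : AltFar (partGraph G χ D ω j) D (oldRel G χ D ω j a) (ω j) c w n) :
    ∀ l < n, reach G v (k + 2 * l) (w (2 * l)) ∧ reach G v (k + 2 * l + 1) (w (2 * l + 1)) := by
  obtain ⟨h1, h2, -⟩ := h
  intro l
  induction l with
  | zero => exact fun hl => ⟨hr, hr.adj (pcol_mem (h1 0 hl)).1 (by omega)⟩
  | succ l ih =>
    intro hl
    have h3 : reach G v (k + 2 * (l + 1)) (w (2 * (l + 1))) :=
      (ih (by omega)).2.adj (oldRel_adj hχ j _ _ _ (h2 l hl)).1 (by omega)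
    exact ⟨h3, h3.adj (pcol_mem (h1 _ hl)).1 (by omega)⟩

lemma altFar_congr (hχ : PartialColouring G χ) {n : ℕ} {c : Fin s} {a : A ⊕ (Fin m × Fin s)}
    {w : ℕ → V} (ha : Agree G v r ω ω') (hr : reach G v k (w 0)) (hk : k + 2 * n + 2 * R ≤ r)
    (h : AltFar (partGraph G χ D ω j) D (oldRel G χ D ω j a) (ω j) c w n) :
    AltFar (partGraph G χ D ω' j) D (oldRel G χ D ω' j a) (ω' j) c w n := by
  have hw := altFar_reach hχ hr h
  obtain ⟨h1, h2, h3⟩ := h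
  refine ⟨fun l hl => ?_, fun l hl => ?_, fun i i' hi hi' => ?_⟩
  · rw [← h1 l hl]
    exact pcol_congr j ha (Sym2.mem_mk_left ..) (hw l hl).1 (by omega)
  · exact oldRel_congr ha (hw l (by omega)).2 (by omega) (h2 l hl)
  · refine far_congr (k := k + 2 * i + 1) ha (fun x hx => ?_) (by omega) (h3 i i' hi hi')
    rcases Sym2.mem_iff.1 hx with rfl | rfl
    · exact (hw i (by omega)).1.mono (by omega)
    · exact (hw i (by omega)).2

lemma eBad_congr (hχ : PartialColouring G χ) (ha : Agree G v r ω ω') (hr : reach G v k x)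
    (hk : k + 2 * K + 2 * R + 2 ≤ r) (hn₀ : 1 ≤ n₀)
    (h : EBad (partGraph G χ D ω j) D (oldRel G χ D ω j) n₀ K (ω j) x y) :
    EBad (partGraph G χ D ω' j) D (oldRel G χ D ω' j) n₀ K (ω' j) x y := by
  obtain ⟨a, h⟩ := h
  refine ⟨a, ?_⟩
  rcases h with ⟨n, hn, hnK, c, w, h0, h1, h2, h3, z, hz, p, hp⟩ | ⟨c, w, h0, h1, h2⟩
  · left
    have hr0 : reach G v k (w 0) := by rw [h0]; exact hr
    have hw := altFar_reach hχ hr0 h2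
    refine ⟨n, hn, hnK, c, w, h0, h1, altFar_congr hχ ha hr0 (by omega) h2,
      oldRel_congr ha (hw (n - 1) (by omega)).2 (by omega) h3, z, hz, ?_⟩
    have hzr : reach G v (k + 1) z := by
      rcases hz with rfl | rfl
      · exact hr.mono (by omega)
      · rw [← h1]
        exact (hw 0 (by omega)).2
    obtain ⟨p', hp'⟩ := exists_walk_selGraph ha p (k + 1) hzr (by omega)
    exact ⟨p', by omega⟩
  · right
    exact ⟨c, w, h0, h1, altFar_congr hχ ha (by rw [h0]; exact hr) (by omega) h2⟩

lemma partFail_congr (hχ : PartialColouring G χ) (ha : Agree G v r ω ω')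
    (hx : ∀ x ∈ e, reach G v k x) (he : e ∈ G.edgeSet) (hk : k + ℓ + 2 * K + 2 * R + 4 ≤ r)
    (hn₀ : 1 ≤ n₀)
    (h : PartFail G χ D ω ℓ n₀ K j e) : PartFail G χ D ω' ℓ n₀ K j e := by
  obtain ⟨x, hxe⟩ : ∃ y, y ∈ e := by
    induction e with | _ a b => exact ⟨a, Sym2.mem_mk_left a b⟩
  rcases h with h | h | ⟨x, y, rfl, h⟩
  · left
    rw [← h]
    exact pcol_congr j ha hxe (hx x hxe) (by omega)
  · right; left
    rw [← h, (ha e he x hxe ((hx x hxe).mono (by omega)) j).2.2.1]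
  · have hr := hx x (Sym2.mem_mk_left x y)
    right; right
    refine ⟨x, y, rfl, ?_⟩
    rcases h with h | h
    · exact Or.inl (fBad_congr ha hr (by omega) h)
    · exact Or.inr (eBad_congr hχ ha hr (by omega) hn₀ h)

lemma gets_congr (hχ : PartialColouring G χ) (ha : Agree G v r ω ω')
    (hx : ∀ x ∈ e, reach G v k x) (hk : k + ℓ + 2 * K + 2 * R + 4 ≤ r)
    (hn₀ : 1 ≤ n₀) {b : A ⊕ (Fin m × Fin s)}
    (h : Gets G χ D ω ℓ n₀ K b e) : Gets G χ D ω' ℓ n₀ K b e := by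
  rcases b with a | ⟨i, c⟩
  · exact h
  · obtain ⟨x, hxe⟩ : ∃ y, y ∈ e := by
      induction e with | _ a b => exact ⟨a, Sym2.mem_mk_left a b⟩
    refine ⟨?_, fun h' => h.2 (partFail_congr hχ ha.symm hx (pcol_mem h.1).1 hk hn₀ h')⟩
    rw [← h.1]
    exact pcol_congr i ha hxe (hx x hxe) (by omega)

lemma newCol_congr (hχ : PartialColouring G χ) (ha : Agree G v r ω ω')
    (hx : ∀ x ∈ e, reach G v k x) (hk : k + ℓ + 2 * K + 2 * R + 4 ≤ r)
    (hn₀ : 1 ≤ n₀) : newCol G χ D ω ℓ n₀ K e = newCol G χ D ω' ℓ n₀ K e := by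
  ext b
  simp only [newCol_eq_some]
  exact ⟨gets_congr hχ ha hx hk hn₀, gets_congr hχ ha.symm hx hk hn₀⟩

end Local
end AEC

namespace AEC
open scoped Classical
open Finset SimpleGraph

section Past
variable {V A : Type*} {d R P s m : ℕ} {G : SimpleGraph V} {χ : Sym2 V → Option A} {D : ℕ}
  {ω ω' : Fin m → Seed V d R P s} {ℓ n₀ K : ℕ}

lemma partGraph_eq_of_past {j : Fin m} (h : ∀ i < j, ω i = ω' i) :
    partGraph G χ D ω j = partGraph G χ D ω' j := by
  have : (fun e => χ e = none ∧ ∀ i < j, ¬ ((ω i).1 e : ℕ) < D) =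
      fun e => χ e = none ∧ ∀ i < j, ¬ ((ω' i).1 e : ℕ) < D := by
    funext e
    refine propext (and_congr_right fun _ => forall_congr' fun i => forall_congr' fun hi => ?_)
    rw [h i hi]
  rw [partGraph, partGraph, this]

lemma oldRel_eq_of_past {j : Fin m} (h : ∀ i < j, ω i = ω' i) :
    oldRel G χ D ω j = oldRel G χ D ω' j := by
  funext a x y
  rcases a with a | ⟨i, c⟩
  · rfl
  · refine propext (and_congr_right fun hi => ?_)
    rw [pcol, pcol, partGraph_eq_of_past fun i' hi' => h i' (hi'.trans hi), h i hi]

/-- Some edge at `v` that is selected by part `j` fails. -/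
def BadPart (G : SimpleGraph V) (χ : Sym2 V → Option A) (D : ℕ) (ℓ n₀ K : ℕ) (v : V) (j : Fin m)
    (ω : Fin m → Seed V d R P s) : Prop :=
  ∃ e, e ∈ (partGraph G χ D ω j).edgeSet ∧ v ∈ e ∧ ((ω j).1 e : ℕ) < D ∧
    PartFail G χ D ω ℓ n₀ K j e

lemma BadPart.of_past {v : V} {j : Fin m} (h : ∀ i ≤ j, ω i = ω' i)
    (hb : BadPart G χ D ℓ n₀ K v j ω) : BadPart G χ D ℓ n₀ K v j ω' := by
  obtain ⟨e, h1, h2, h3, h4⟩ := hb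
  have h' : ∀ i < j, ω i = ω' i := fun i hi => h i hi.le
  unfold PartFail at h4
  rw [partGraph_eq_of_past h'] at h1 h4
  rw [oldRel_eq_of_past h'] at h4
  rw [h j le_rfl] at h3 h4
  exact ⟨e, h1, h2, h3, h4⟩

variable [Fintype V] [Fintype A]

lemma prob_badPart_le (hχ : PartialColouring G χ) {g : ℕ} (hg : GirthGe G g) (hRg : 2 * R + 1 < g)
    (hdeg : ∀ x, (inc (edgeSub G fun e => χ e = none) x).card ≤ d) (hd : 0 < d) (hs : 0 < s)
    (hP : 0 < P) {B b : ℕ} (hℓ : 0 < ℓ) (hn₀ : 2 ≤ n₀) (hb : b + B ≤ s) {x : ℝ} (hx : 1 ≤ x)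
    (hf : 0 ≤ failBound (Fintype.card A + m * s) d D R P s ℓ n₀ K B b x)
    (v : V) (j : Fin m) (ω : Fin m → Seed V d R P s) :
    prob (fun y : Seed V d R P s => BadPart G χ D ℓ n₀ K v j (Function.update ω j y)) ≤
      D * failBound (Fintype.card A + m * s) d D R P s ℓ n₀ K B b x := by
  have hpast : ∀ y, ∀ i < j, Function.update ω j y i = ω i := fun y i hi =>
    Function.update_of_ne hi.ne _ _
  have hle : partGraph G χ D ω j ≤ edgeSub G fun e => χ e = none :=
    fun _ _ h => ⟨h.1, h.2.1⟩
  have hinc : ∀ x, (inc (partGraph G χ D ω j) x).card ≤ d := fun x => by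
    refine le_trans (card_le_card fun e he => ?_) (hdeg x)
    rw [mem_inc] at he ⊢
    exact ⟨edgeSet_mono hle he.1, he.2⟩
  have h1 : prob (fun y : Seed V d R P s => BadPart G χ D ℓ n₀ K v j (Function.update ω j y)) ≤
      prob (fun y : Seed V d R P s => ∃ e ∈ inc (partGraph G χ D ω j) v, (y.1 e : ℕ) < D ∧
        Fail (partGraph G χ D ω j) D (oldRel G χ D ω j) ℓ n₀ K y e) := by
    refine prob_mono fun y => ?_
    rintro ⟨e, h1, h2, h3, h4⟩
    unfold PartFail at h4
    rw [partGraph_eq_of_past (hpast y)] at h1 h4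
    rw [oldRel_eq_of_past (hpast y)] at h4
    rw [Function.update_self] at h3 h4
    exact ⟨e, mem_inc.2 ⟨h1, h2⟩, h3, h4⟩
  have hN : Fintype.card (A ⊕ (Fin m × Fin s)) = Fintype.card A + m * s := by simp
  have hd' : (0 : ℝ) < d := by exact_mod_cast hd
  refine h1.trans ((prob_exists_mem_le_card _ _
    (c := D / d * failBound (Fintype.card A + m * s) d D R P s ℓ n₀ K B b x) fun e he => ?_).trans ?_)
  · rw [← hN]
    exact prob_fail_le (hg.mono (partGraph_le j)) hRg hinc hd hs hP (oldRel_functional hχ j)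
      (oldRel_symm j) hℓ hn₀ hb hx (mem_inc.1 he).1
  · have : ((inc (partGraph G χ D ω j) v).card : ℝ) ≤ d := by exact_mod_cast hinc v
    calc ((inc (partGraph G χ D ω j) v).card : ℝ) *
          (D / d * failBound (Fintype.card A + m * s) d D R P s ℓ n₀ K B b x)
        ≤ d * (D / d * failBound (Fintype.card A + m * s) d D R P s ℓ n₀ K B b x) := by gcongr
      _ = _ := by field_simp

end Past

section Transport
variable {V : Type*} {d R P s m : ℕ}

/-- The random choices of all parts, listed edge by edge. -/
def byEdge : (Fin m → Seed V d R P s) ≃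
    (Sym2 V → Fin m → Fin d × Fin R × Fin P × Equiv.Perm (Fin s)) where
  toFun ω e j := ((ω j).1 e, (ω j).2.1 e, (ω j).2.2.1 e, (ω j).2.2.2 e)
  invFun η j := (fun e => (η e j).1, fun e => (η e j).2.1, fun e => (η e j).2.2.1,
    fun e => (η e j).2.2.2)
  left_inv _ := rfl
  right_inv _ := rfl

variable [Fintype V]

lemma prob_edgewise_le {n t : ℕ} (S : Finset (Sym2 V)) (hS : S.card ≤ n) {p x : ℝ} (hp : 0 ≤ p)
    (hx : 1 ≤ x) (Q : (Fin m → Fin d) → Prop) (hQ : prob Q ≤ p) :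
    prob (fun ω : Fin m → Seed V d R P s => t ≤ (S.filter fun e => Q fun j => (ω j).1 e).card) ≤
      (1 + p * (x - 1)) ^ n / x ^ t := by
  have h := chernoff (ι := Sym2 V) (X := Fin m → Fin d × Fin R × Fin P × Equiv.Perm (Fin s)) S
    (fun _ z => Q fun j => (z j).1) (t := t) hp hx hS (fun e _ => ?_)
  · rw [← prob_equiv (byEdge (V := V) (d := d) (R := R) (P := P) (s := s) (m := m))] at h
    exact h
  · let E : (Fin m → Fin d × Fin R × Fin P × Equiv.Perm (Fin s)) ≃
        (Fin m → Fin d) × (Fin m → Fin R × Fin P × Equiv.Perm (Fin s)) :=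
      Equiv.arrowProdEquivProdArrow _ _ _
    have h1 := prob_equiv E fun z => Q z.1
    have h2 : prob (fun z : (Fin m → Fin d) × (Fin m → Fin R × Fin P × Equiv.Perm (Fin s)) =>
        Q z.1) ≤ prob Q := prob_fst_le ..
    exact (h1.le.trans h2).trans hQ

lemma card_filter_lt {d D : ℕ} (hD : D ≤ d) :
    (univ.filter fun x : Fin d => (x : ℕ) < D).card = D := by
  have : (univ.filter fun x : Fin d => (x : ℕ) < D) =
      (univ : Finset (Fin D)).map (Fin.castLEEmb hD) := by
    ext x
    simp only [mem_filter, mem_univ, true_and, mem_map, Fin.castLEEmb_apply]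
    constructor
    · exact fun hx => ⟨⟨x, hx⟩, rfl⟩
    · rintro ⟨y, rfl⟩
      exact y.2
  rw [this]
  simp

lemma prob_unselected_le {D : ℕ} (hD : D ≤ d) (hd : 0 < d) :
    prob (fun z : Fin m → Fin d => ∀ j, ¬ (z j : ℕ) < D) ≤ (1 - (D : ℝ) / d) ^ m := by
  have h := prob_forall_mem_le (univ : Finset (Fin m)) (fun _ (x : Fin d) => ¬ (x : ℕ) < D)
    (p := 1 - (D : ℝ) / d) (fun _ _ => ?_)
  · simpa using h
  · have : Nonempty (Fin d) := ⟨⟨0, hd⟩⟩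
    rw [prob_not]
    have : prob (fun x : Fin d => (x : ℕ) < D) = (D : ℝ) / d := by
      rw [prob_eq_card, Fintype.card_fin]
      congr 2
      convert card_filter_lt hD using 2
      ext x
      simp
    refine le_of_eq ?_
    rw [← this]

lemma prob_selected_le {D : ℕ} (J : Finset (Fin m)) :
    prob (fun z : Fin m → Fin d => ∃ j ∈ J, (z j : ℕ) < D) ≤ J.card * ((D : ℝ) / d) := by
  refine prob_exists_mem_le_card _ _ fun j _ => ?_
  have h := prob_forall_mem_le {j} (fun _ (x : Fin d) => (x : ℕ) < D) fun _ _ => prob_fin_lt_le d D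
  simpa using h

end Transport
end AEC

namespace AEC
open scoped Classical
open Finset SimpleGraph

section Ball
variable {V : Type*} [Fintype V] {G : SimpleGraph V} {Δ : ℕ}

lemma card_reach_le (hΔ : ∀ x, (inc G x).card ≤ Δ) (v : V) (r : ℕ) :
    (univ.filter fun x => reach G v r x).card ≤ (Δ + 1) ^ r := by
  induction r with
  | zero =>
    rw [pow_zero, card_le_one]
    intro a ha b hb
    simp only [mem_filter, mem_univ, true_and] at ha hb
    obtain ⟨p, hp⟩ := ha
    obtain ⟨q, hq⟩ := hb
    rw [← Walk.eq_of_length_eq_zero (Nat.le_zero.1 hp), ← Walk.eq_of_length_eq_zero (Nat.le_zero.1 hq)]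
  | succ r ih =>
    have hsub : (univ.filter fun x => reach G v (r + 1) x) ⊆
        (univ.filter fun x => reach G v r x).biUnion
          fun x => insert x (univ.filter fun y => G.Adj x y) := by
      intro x hx
      simp only [mem_filter, mem_univ, true_and] at hx
      obtain ⟨p, hp⟩ := hx
      simp only [mem_biUnion, mem_filter, mem_univ, true_and, mem_insert]
      by_cases hr : p.length ≤ r
      · exact ⟨x, ⟨p, hr⟩, Or.inl rfl⟩
      · have hl : p.length = r + 1 := by omega
        refine ⟨p.getVert r, ⟨p.take r, ?_⟩, Or.inr ?_⟩
        · simp [Walk.take_length]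
        · have := p.adj_getVert_succ (i := r) (by omega)
          rwa [← hl, Walk.getVert_length] at this
    refine (card_le_card hsub).trans ((card_biUnion_le_card_mul _ _ (Δ + 1) fun x _ => ?_).trans ?_)
    · refine (card_insert_le _ _).trans ?_
      have := hΔ x
      rw [card_inc] at this
      omega
    · rw [pow_succ]
      exact Nat.mul_le_mul_right _ ih

end Ball

section Stage
variable {V A : Type*} {d R P s m : ℕ} {G : SimpleGraph V} {χ : Sym2 V → Option A} {D : ℕ}
  {ℓ n₀ K : ℕ} [Fintype V] [Fintype A]

lemma prob_degree_le (hχ : PartialColouring G χ) {g : ℕ} (hg : GirthGe G g) (hRg : 2 * R + 1 < g)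
    (hdeg : ∀ x, (inc (edgeSub G fun e => χ e = none) x).card ≤ d) (hd : 0 < d) (hs : 0 < s)
    (hP : 0 < P) (hDd : D ≤ d) {B b : ℕ} (hℓ : 0 < ℓ) (hn₀ : 2 ≤ n₀) (hb : b + B ≤ s) {x : ℝ}
    (hx : 1 ≤ x) {κ : ℝ} (hκ : κ ≤ 1)
    (hf : 0 ≤ failBound (Fintype.card A + m * s) d D R P s ℓ n₀ K B b x)
    (hfκ : D * failBound (Fintype.card A + m * s) d D R P s ℓ n₀ K B b x ≤ κ)
    {ta tb tc : ℕ} {xa xc : ℝ} (hxa : 1 ≤ xa) (hxc : 1 ≤ xc) (v : V) :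
    prob (fun ω : Fin m → Seed V d R P s =>
      ta + tc ≤ ((inc G v).filter fun e => newCol G χ D ω ℓ n₀ K e = none).card) ≤
    (1 + (1 - (D : ℝ) / d) ^ m * (xa - 1)) ^ d / xa ^ ta +
      (2 ^ m * κ ^ tb + 2 ^ m * ((1 + tb * ((D : ℝ) / d) * (xc - 1)) ^ d / xc ^ tc)) := by
  have hd' : (0 : ℝ) < d := by exact_mod_cast hd
  have hκ0 : 0 ≤ κ := le_trans (by positivity) hfκ
  set U := inc (edgeSub G fun e => χ e = none) v with hU
  obtain ⟨S₁, hS₁⟩ : ∃ S : Finset (Finset (Fin m)), ∀ J, J ∈ S ↔ tb ≤ J.card :=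
    ⟨univ.filter fun J => tb ≤ J.card, by simp⟩
  obtain ⟨S₂, hS₂⟩ : ∃ S : Finset (Finset (Fin m)), ∀ J, J ∈ S ↔ J.card ≤ tb :=
    ⟨univ.filter fun J => J.card ≤ tb, by simp⟩
  have hsub : ∀ ω : Fin m → Seed V d R P s,
      ta + tc ≤ ((inc G v).filter fun e => newCol G χ D ω ℓ n₀ K e = none).card →
      ta ≤ (U.filter fun e => ∀ j, ¬ ((ω j).1 e : ℕ) < D).card ∨
      ((∃ J ∈ S₁,
          ∀ j ∈ J, BadPart G χ D ℓ n₀ K v j ω) ∨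
        ∃ J ∈ S₂,
          tc ≤ (U.filter fun e => ∃ j ∈ J, ((ω j).1 e : ℕ) < D).card) := by
    intro ω hω
    by_contra hcon
    push Not at hcon
    obtain ⟨h1, h2, h3⟩ := hcon
    set J := univ.filter fun j => BadPart G χ D ℓ n₀ K v j ω with hJ
    have hJt : J.card < tb := by
      by_contra hlt
      obtain ⟨j, hj, hj'⟩ := h2 J ((hS₁ J).2 (not_lt.1 hlt))
      exact hj' (by simpa [hJ] using hj)
    have h4 := h3 J ((hS₂ J).2 hJt.le)
    have hss : ((inc G v).filter fun e => newCol G χ D ω ℓ n₀ K e = none) ⊆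
        (U.filter fun e => ∀ j, ¬ ((ω j).1 e : ℕ) < D) ∪
        (U.filter fun e => ∃ j ∈ J, ((ω j).1 e : ℕ) < D) := by
      intro e he
      rw [mem_filter, mem_inc] at he
      obtain ⟨⟨he, hv⟩, hn⟩ := he
      obtain ⟨h5, h6⟩ := newCol_eq_none he hn
      have heU : e ∈ U := mem_inc.2 ⟨mem_edgeSub.2 ⟨he, h5⟩, hv⟩
      rw [mem_union, mem_filter, mem_filter]
      rcases h6 with h6 | ⟨j, h6, h7, h8⟩
      · exact Or.inl ⟨heU, h6⟩
      · exact Or.inr ⟨heU, j, by simpa [hJ] using ⟨e, h6, hv, h7, h8⟩, h7⟩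
    have h5 := (card_le_card hss).trans (card_union_le _ _)
    have h1' : (U.filter fun e => ∀ j, ¬ ((ω j).1 e : ℕ) < D).card < ta := by
      refine lt_of_le_of_lt (le_of_eq ?_) h1
      congr 1
      ext e
      simp
    omega
  have hcard : ∀ S : Finset (Finset (Fin m)), (S.card : ℝ) ≤ 2 ^ m := fun S => by
    have : S.card ≤ 2 ^ m := (card_le_univ S).trans (by simp)
    exact_mod_cast this
  have hq0 : 0 ≤ 1 - (D : ℝ) / d := by
    rw [sub_nonneg, div_le_one hd']
    exact_mod_cast hDd
  refine (prob_mono hsub).trans ((prob_or_le _ _).trans (add_le_add ?_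
    ((prob_or_le _ _).trans (add_le_add ?_ ?_))))
  · refine le_trans (prob_mono fun ω h => h.trans (le_of_eq ?_)) (prob_edgewise_le U (hdeg v)
      (pow_nonneg hq0 m) hxa (fun z : Fin m → Fin d => ∀ j, ¬ (z j : ℕ) < D)
      (prob_unselected_le hDd hd))
    congr 1
    ext e
    simp only [mem_filter]
  · refine (prob_exists_mem_le_card S₁ (fun J ω => ∀ j ∈ J, BadPart G χ D ℓ n₀ K v j ω)
      (c := κ ^ tb) fun J hJ => ?_).trans
      (mul_le_mul_of_nonneg_right (hcard _) (by positivity))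
    refine (prob_forall_seq_le (fun j ω => BadPart G χ D ℓ n₀ K v j ω) hκ0 J
      (fun j ω ω' h hB => hB.of_past h) fun j ω => ?_).trans ?_
    · exact (prob_badPart_le hχ hg hRg hdeg hd hs hP hℓ hn₀ hb hx hf v j ω).trans hfκ
    · exact pow_le_pow_of_le_one hκ0 hκ ((hS₁ J).1 hJ)
  · refine (prob_exists_mem_le_card S₂ (fun J (ω : Fin m → Seed V d R P s) =>
      tc ≤ (U.filter fun e => ∃ j ∈ J, ((ω j).1 e : ℕ) < D).card)
      (c := (1 + tb * ((D : ℝ) / d) * (xc - 1)) ^ d / xc ^ tc) fun J hJ => ?_).trans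
      (mul_le_mul_of_nonneg_right (hcard _) ?_)
    · refine le_trans (prob_mono fun ω h => h.trans (le_of_eq ?_)) (prob_edgewise_le U (hdeg v)
        (p := tb * ((D : ℝ) / d)) (by positivity) hxc
        (fun z : Fin m → Fin d => ∃ j ∈ J, (z j : ℕ) < D) ((prob_selected_le J).trans ?_))
      · congr 1
        ext e
        simp only [mem_filter]
      have : J.card ≤ tb := (hS₂ J).1 hJ
      gcongr
    · have : 0 ≤ xc - 1 := by linarith
      positivity

/-- One stage, with all numerical conditions as hypotheses. -/
theorem exists_stage (hχ : PartialColouring G χ) {g : ℕ} (hg : GirthGe G g)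
    (hRg : 2 * R + 1 < g) (hℓg : ℓ < g) (hn₀g : 2 * n₀ + 2 * R ≤ g)
    (hdeg : ∀ x, (inc (edgeSub G fun e => χ e = none) x).card ≤ d) (hd : 0 < d) (hR : 0 < R)
    (hs : 0 < s) (hP : 0 < P) (hDd : D ≤ d) {B b : ℕ} (hℓ : 0 < ℓ) (hn₀ : 2 ≤ n₀)
    (hb : b + B ≤ s) {x : ℝ} (hx : 1 ≤ x) {κ : ℝ} (hκ : κ ≤ 1)
    (hf : 0 ≤ failBound (Fintype.card A + m * s) d D R P s ℓ n₀ K B b x)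
    (hfκ : D * failBound (Fintype.card A + m * s) d D R P s ℓ n₀ K B b x ≤ κ)
    {ta tb tc : ℕ} {xa xc : ℝ} (hxa : 1 ≤ xa) (hxc : 1 ≤ xc) {Δ : ℕ}
    (hΔ : ∀ x, (inc G x).card ≤ Δ)
    (hLLL : 4 * ((1 + (1 - (D : ℝ) / d) ^ m * (xa - 1)) ^ d / xa ^ ta +
      (2 ^ m * κ ^ tb + 2 ^ m * ((1 + tb * ((D : ℝ) / d) * (xc - 1)) ^ d / xc ^ tc))) *
      ((Δ + 1) ^ (2 * (ℓ + 2 * K + 2 * R + 5) + 1) : ℕ) ≤ 1) :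
    ∃ χ' : Sym2 V → Option (A ⊕ (Fin m × Fin s)), PartialColouring G χ' ∧
      ∀ v, (inc (edgeSub G fun e => χ' e = none) v).card < ta + tc := by
  set r := ℓ + 2 * K + 2 * R + 5 with hr
  set p := (1 + (1 - (D : ℝ) / d) ^ m * (xa - 1)) ^ d / xa ^ ta +
      (2 ^ m * κ ^ tb + 2 ^ m * ((1 + tb * ((D : ℝ) / d) * (xc - 1)) ^ d / xc ^ tc)) with hp
  have hd' : (0 : ℝ) < d := by exact_mod_cast hd
  have hprob := fun v => prob_degree_le hχ hg hRg hdeg hd hs hP hDd hℓ hn₀ hb hx hκ hf hfκ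
    (ta := ta) (tb := tb) (tc := tc) hxa hxc v
  have hp0 : 0 ≤ p := by
    rcases isEmpty_or_nonempty V with hV | ⟨⟨v⟩⟩
    · have hκ0 : 0 ≤ κ := le_trans (by positivity) hfκ
      have hq0 : 0 ≤ 1 - (D : ℝ) / d := by
        rw [sub_nonneg, div_le_one hd']
        exact_mod_cast hDd
      have : 0 ≤ xc - 1 := by linarith
      have : 0 ≤ xa - 1 := by linarith
      positivity
    · exact (prob_nonneg _).trans (hprob v)
  have : Nonempty (Fin d) := ⟨⟨0, hd⟩⟩
  have : Nonempty (Fin R) := ⟨⟨0, hR⟩⟩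
  have : Nonempty (Fin P) := ⟨⟨0, hP⟩⟩
  let bad : V → (Fin m → Seed V d R P s) → Prop := fun v ω =>
    ta + tc ≤ ((inc G v).filter fun e => newCol G χ D ω ℓ n₀ K e = none).card
  have hloc : ∀ v ω ω', Agree G v r ω ω' → bad v ω → bad v ω' := by
    intro v ω ω' ha hb
    refine le_trans hb (le_of_eq ?_)
    congr 1
    refine filter_congr fun e he => ?_
    rw [mem_inc] at he
    rw [newCol_congr hχ ha (k := 1) (fun x hx => ?_) (by omega) (by omega)]
    by_cases hxv : x = v
    · subst hxv
      exact (reach_self (r := 0)).mono (Nat.zero_le _)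
    · have : G.Adj v x := by
        have h := (Sym2.mem_and_mem_iff (Ne.symm hxv)).1 ⟨he.2, hx⟩
        rw [h] at he
        exact he.1
      exact (reach_self (r := 0)).adj this Nat.one_pos
  obtain ⟨η, hη⟩ := local_lemma (Ω := Sym2 V → Fin m → Fin d × Fin R × Fin P × Equiv.Perm (Fin s))
    (fun v η => bad v (byEdge.symm η)) (fun v => univ.filter fun u => reach G v (2 * r + 1) u)
    (p := p) (n := (Δ + 1) ^ (2 * r + 1)) (Nat.one_le_pow _ _ (by omega))
    (fun v => card_reach_le hΔ v _)
    (fun v => by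
      rw [prob_equiv (byEdge (V := V) (d := d) (R := R) (P := P) (s := s) (m := m)).symm (bad v)]
      exact hprob v) hLLL hp0 (fun v U hU => by
      refine le_of_eq (prob_and_eq_mul
        (ι := Sym2 V) (X := Fin m → Fin d × Fin R × Fin P × Equiv.Perm (Fin s))
        {e | e ∈ G.edgeSet ∧ ∃ x ∈ e, reach G v r x} (fun η => bad v (byEdge.symm η))
        (fun η => ∀ u ∈ U, ¬ bad u (byEdge.symm η)) ?_ ?_)
      · intro η η' h
        refine hloc v _ _ fun e he x hx hv j => ?_
        have := congrFun (h e ⟨he, x, hx, hv⟩) j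
        change (η e j).1 = (η' e j).1 ∧ (η e j).2.1 = (η' e j).2.1 ∧
          (η e j).2.2.1 = (η' e j).2.2.1 ∧ (η e j).2.2.2 = (η' e j).2.2.2
        rw [this]
        exact ⟨rfl, rfl, rfl, rfl⟩
      · intro η η' h hη u hu hbad
        refine hη u hu (hloc u _ _ (fun e he x hx hv j => ?_) hbad)
        have hne : e ∉ {e | e ∈ G.edgeSet ∧ ∃ x ∈ e, reach G v r x} := by
          rintro ⟨-, y, hy, hvy⟩
          have hnu : u ∉ univ.filter fun u => reach G v (2 * r + 1) u :=
            disjoint_left.1 hU hu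
          apply hnu
          rw [mem_filter]
          refine ⟨mem_univ _, ?_⟩
          obtain ⟨q, hq⟩ := hv
          have hxr : reach G v (r + 1) x := by
            by_cases hxy : x = y
            · subst hxy
              exact hvy.mono (by omega)
            · have : G.Adj y x := by
                have h := (Sym2.mem_and_mem_iff (Ne.symm hxy)).1 ⟨hy, hx⟩
                rw [h] at he
                exact he
              exact hvy.adj this (by omega)
          exact hxr.walk le_rfl q.reverse (by rw [Walk.length_reverse]; omega)
        have := congrFun (h e hne) j
        change (η' e j).1 = (η e j).1 ∧ (η' e j).2.1 = (η e j).2.1 ∧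
          (η' e j).2.2.1 = (η e j).2.2.1 ∧ (η' e j).2.2.2 = (η e j).2.2.2
        rw [this]
        exact ⟨rfl, rfl, rfl, rfl⟩)
  refine ⟨newCol G χ D (byEdge.symm η) ℓ n₀ K, newCol_partialColouring hχ hg hℓg hn₀g, fun v => ?_⟩
  refine lt_of_le_of_lt (le_of_eq ?_) (not_le.1 (hη v))
  congr 1
  ext e
  rw [mem_inc, mem_edgeSub, mem_filter, mem_inc]
  tauto

end Stage
end AEC

namespace AEC
open scoped Classical
open Finset Filter Topology

section Numerics

lemma chernoff_exp_le {p z : ℝ} (hp : 0 ≤ p) (hz : 0 ≤ z) (d t : ℕ) :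
    (1 + p * z) ^ d / (1 + z) ^ t ≤ Real.exp (p * z * d - t * (z / (1 + z))) := by
  have h1 : (1 + p * z) ^ d ≤ Real.exp (p * z * d) := by
    rw [mul_comm (p * z) (d : ℝ), Real.exp_nat_mul]
    refine pow_le_pow_left₀ (by positivity) ?_ _
    linarith [Real.add_one_le_exp (p * z)]
  have h2 : ((1 + z) ^ t)⁻¹ ≤ Real.exp (-(t * (z / (1 + z)))) := by
    rw [← mul_neg, Real.exp_nat_mul, ← inv_pow]
    refine pow_le_pow_left₀ (by positivity) ?_ _
    have h3 := Real.add_one_le_exp (-(z / (1 + z)))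
    have h4 : (1 + z)⁻¹ = -(z / (1 + z)) + 1 := by field_simp; ring
    rw [h4]
    exact h3
  rw [div_eq_mul_inv, sub_eq_add_neg, Real.exp_add]
  gcongr

lemma failBound_nonneg {N d D R P s ℓ n₀ K B b : ℕ} {x : ℝ} (hx : 1 ≤ x) (hb : b ≤ s)
    (hP : 0 < P) : 0 ≤ failBound N d D R P s ℓ n₀ K B b x := by
  have h1 : (0 : ℝ) ≤ 1 - (b : ℝ) / s := by
    rw [sub_nonneg]
    exact div_le_one_of_le₀ (by exact_mod_cast hb) (by positivity)
  have h2 : (0 : ℝ) ≤ 1 - 1 / (P : ℝ) := by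
    rw [sub_nonneg]
    exact div_le_one_of_le₀ (by exact_mod_cast hP) (by positivity)
  have h3 : 0 ≤ x - 1 := by linarith
  have h4 : 0 < x := by linarith
  unfold failBound
  have h5 : 0 ≤ ∑ n ∈ Icc n₀ (K + 1), ∑ w ∈ range (2 * R + 2),
      (N : ℝ) * (2 / d * D ^ w * ((D : ℝ) / s) ^ (n - 1)) :=
    sum_nonneg fun _ _ => sum_nonneg fun _ _ => by positivity
  positivity

lemma eventually_mul_exp_le {c κ : ℝ} (hc : 0 < c) (hκ : 0 < κ) :
    ∀ᶠ D : ℕ in atTop, (D : ℝ) * (2 * Real.exp (-(c * D))) ≤ κ := by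
  have h := (Real.tendsto_pow_mul_exp_neg_atTop_nhds_zero 1).comp
    ((tendsto_natCast_atTop_atTop (R := ℝ)).const_mul_atTop hc)
  have h2 := h.const_mul (2 / c)
  rw [mul_zero] at h2
  filter_upwards [h2.eventually_le_const hκ] with D hD
  refine le_trans (le_of_eq ?_) hD
  simp only [Function.comp_apply, pow_one]
  field_simp

lemma sum_pow_le {lam : ℝ} (h0 : 0 ≤ lam) (h1 : lam < 1) (n₀ M : ℕ) (hn₀ : 1 ≤ n₀) :
    ∑ n ∈ Icc n₀ M, lam ^ (n - 1) ≤ lam ^ (n₀ - 1) * (1 - lam)⁻¹ := by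
  have h2 : ∑ n ∈ Icc n₀ M, lam ^ (n - 1) ≤ ∑ i ∈ range (M + 1), lam ^ (n₀ - 1) * lam ^ i := by
    have : Icc n₀ M ⊆ (range (M + 1)).image fun i => n₀ + i := by
      intro n hn
      rw [Finset.mem_Icc] at hn
      exact mem_image.2 ⟨n - n₀, by rw [Finset.mem_range]; omega, by omega⟩
    refine (sum_le_sum_of_subset_of_nonneg this fun _ _ _ => by positivity).trans ?_
    rw [sum_image fun a _ b _ hab => by simpa using hab]
    refine le_of_eq (sum_congr rfl fun i _ => ?_)
    rw [← pow_add]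
    congr 1
    omega
  rw [← mul_sum] at h2
  refine h2.trans (mul_le_mul_of_nonneg_left ?_ (by positivity))
  rw [← tsum_geometric_of_lt_one h0 h1]
  exact (summable_geometric_of_lt_one h0 h1).sum_le_tsum _ fun _ _ => by positivity

lemma eventually_mul_pow_sqrt_le {lam c κ : ℝ} (h0 : 0 ≤ lam) (h1 : lam < 1) (hc : 0 ≤ c)
    (hκ : 0 < κ) : ∀ᶠ d : ℕ in atTop, c * d * lam ^ (Nat.sqrt d) ≤ κ := by
  have h := tendsto_pow_const_mul_const_pow_of_abs_lt_one 2 (r := lam) (by rwa [abs_of_nonneg h0])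
  have h2 := h.const_mul (c * 4)
  rw [mul_zero] at h2
  have hs : Tendsto Nat.sqrt atTop atTop :=
    tendsto_atTop_atTop.2 fun b => ⟨b * b, fun a ha => Nat.le_sqrt.2 ha⟩
  filter_upwards [hs.eventually (h2.eventually_le_const hκ), eventually_ge_atTop 1] with d hd hd1
  refine le_trans ?_ hd
  have h3 : (d : ℝ) ≤ 4 * (Nat.sqrt d : ℝ) ^ 2 := by
    have h4 := Nat.sqrt_le_add d
    have h5 : 1 ≤ Nat.sqrt d := Nat.le_sqrt.2 (by omega)
    have h6 : d ≤ 4 * (Nat.sqrt d) ^ 2 := by nlinarith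
    exact_mod_cast h6
  calc c * d * lam ^ (Nat.sqrt d) ≤ c * (4 * (Nat.sqrt d : ℝ) ^ 2) * lam ^ (Nat.sqrt d) := by
        gcongr
    _ = _ := by ring

set_option maxHeartbeats 1000000 in
/-- The parameters of a part can be chosen such that the failure probability is small. -/
lemma exists_failBound_le {ε ρ κ : ℝ} (hε : 0 < ε) (hε1 : ε ≤ 1 / 2) (hρ : 0 ≤ ρ) (hκ : 0 < κ)
    (D₀ : ℕ) :
    ∃ D R P s ℓ n₀ B b d₁ : ℕ, ∃ x : ℝ, D₀ ≤ D ∧ 0 < D ∧ 0 < R ∧ 0 < P ∧ 0 < s ∧ 0 < ℓ ∧ 2 ≤ n₀ ∧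
      b + B ≤ s ∧ 1 ≤ x ∧ (s : ℝ) ≤ (1 + ε) * D + 1 ∧
      ∀ d N : ℕ, d₁ ≤ d → (N : ℝ) ≤ ρ * d →
        D * failBound N d D R P s ℓ n₀ (Nat.sqrt d) B b x ≤ κ := by
  have hκ8 : 0 < κ / 8 := by positivity
  obtain ⟨D, hD, hD0, hD1⟩ := ((eventually_mul_exp_le (c := ε ^ 2 / 32) (by positivity) hκ8).and
    ((eventually_ge_atTop D₀).and (eventually_ge_atTop 2))).exists
  have hDr : (2 : ℝ) ≤ D := by exact_mod_cast hD1
  obtain ⟨R, hR⟩ := exists_nat_gt (2 * D ^ 2 / (κ / 8) : ℝ)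
  obtain ⟨P, hP⟩ := exists_nat_gt (D / (κ / 8) : ℝ)
  set s := ⌈(1 + ε) * D⌉₊ with hs
  set B := ⌊(1 + ε / 2) * D⌋₊ with hB
  have hsl : (1 + ε) * D ≤ s := Nat.le_ceil _
  have hsu : (s : ℝ) ≤ (1 + ε) * D + 1 := (Nat.ceil_lt_add_one (by positivity)).le
  have hBl : (1 + ε / 2) * D ≤ (B : ℝ) + 1 := (Nat.lt_floor_add_one _).le
  have hBu : (B : ℝ) ≤ (1 + ε / 2) * D := Nat.floor_le (by positivity)
  have hBs : B ≤ s := by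
    have : (B : ℝ) ≤ s := by nlinarith
    exact_mod_cast this
  have hs0 : (0 : ℝ) < s := lt_of_lt_of_le (by positivity) hsl
  have hR0 : (0 : ℝ) < R := lt_of_le_of_lt (by positivity) hR
  have hP0 : (0 : ℝ) < P := lt_of_le_of_lt (by positivity) hP
  have hP1 : (1 : ℝ) ≤ P := by exact_mod_cast (by exact_mod_cast hP0 : 0 < P)
  set lam : ℝ := (D : ℝ) / s with hlam
  have hlam0 : 0 ≤ lam := by positivity
  have hlam1 : lam < 1 := by
    rw [hlam, div_lt_one hs0]
    nlinarith
  have hpow := fun {r : ℝ} (h0 : 0 ≤ r) (h1 : r < 1) (c : ℝ) (k : ℝ) (hk : 0 < k) =>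
    ((tendsto_pow_atTop_nhds_zero_of_lt_one h0 h1).const_mul c).eventually_le_const
      (by rw [mul_zero]; exact hk)
  obtain ⟨ℓ, hℓ, hℓ0⟩ := ((hpow (r := 1 - 1 / (P : ℝ))
    (by rw [sub_nonneg]; exact div_le_one_of_le₀ hP1 (by positivity))
    (by linarith [show 0 < 1 / (P : ℝ) by positivity]) (D * (2 * s)) _ hκ8).and
    (eventually_gt_atTop 0)).exists
  obtain ⟨n₁, hn₁, hn₁0⟩ := ((hpow hlam0 hlam1
    (D * (2 * ((2 * R + 2 : ℕ) * (ρ * (2 * D ^ (2 * R + 1))))) * (1 - lam)⁻¹) _ hκ8).and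
    (eventually_gt_atTop 0)).exists
  obtain ⟨d₁, hd₁⟩ := eventually_atTop.1
    (eventually_mul_pow_sqrt_le (c := D * (2 * ρ)) hlam0 hlam1 (by positivity) hκ8)
  refine ⟨D, R, P, s, ℓ, n₁ + 1, B, s - B, d₁ + 1, 1 + ε / 4, hD0, by omega, by exact_mod_cast hR0,
    by exact_mod_cast hP0, by exact_mod_cast hs0, hℓ0, by omega, by omega, by linarith, hsu,
    fun d N hd hN => ?_⟩
  have hd0 : (0 : ℝ) < d := by exact_mod_cast (by omega : 0 < d)
  have hexp : Real.exp (-(ε ^ 2 / 32 * D)) * D ≤ κ / 8 / 2 := by linarith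
  have t1 : (D : ℝ) * (2 * d * (D / d * (1 / R))) ≤ κ / 8 := by
    have : (D : ℝ) * (2 * d * (D / d * (1 / R))) = 2 * D ^ 2 / R := by field_simp
    rw [this, div_le_iff₀ hR0]
    rw [div_lt_iff₀ hκ8] at hR
    linarith
  have t2 : (D : ℝ) * (2 * ((1 + (D : ℝ) / d * (1 + ε / 4 - 1)) ^ d / (1 + ε / 4) ^ (B + 1))) ≤
      κ / 8 := by
    refine le_trans ?_ hD
    have h := chernoff_exp_le (p := (D : ℝ) / d) (z := ε / 4) (by positivity) (by positivity) d
      (B + 1)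
    rw [add_sub_cancel_left]
    have h' : (D : ℝ) / d * (ε / 4) * d - ((B + 1 : ℕ) : ℝ) * (ε / 4 / (1 + ε / 4)) ≤
        -(ε ^ 2 / 32 * D) := by
      have h1 : (D : ℝ) / d * (ε / 4) * d = D * (ε / 4) := by field_simp
      have h2 : ((1 + ε / 2) * D) * (ε / 4 / (1 + ε / 4)) ≤
          ((B + 1 : ℕ) : ℝ) * (ε / 4 / (1 + ε / 4)) := by
        push_cast
        gcongr
      have h3 : D * (ε / 4) - ((1 + ε / 2) * D) * (ε / 4 / (1 + ε / 4)) =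
          -(ε ^ 2 / 16 * D / (1 + ε / 4)) := by
        field_simp
        ring
      have h4 : ε ^ 2 / 32 * D ≤ ε ^ 2 / 16 * D / (1 + ε / 4) := by
        rw [le_div_iff₀ (by positivity)]
        have : 0 < ε ^ 2 * D := by positivity
        nlinarith
      linarith
    have h5 := h.trans (Real.exp_le_exp.2 h')
    gcongr
  have t3 : (D : ℝ) * (1 - ((s - B : ℕ) : ℝ) / s) ^ (s - B) ≤ κ / 8 := by
    have hbr : ((s - B : ℕ) : ℝ) = s - B := by rw [Nat.cast_sub hBs]
    have h1 : ε / 2 * D ≤ ((s - B : ℕ) : ℝ) := by rw [hbr]; linarith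
    have h2 : (0 : ℝ) ≤ 1 - ((s - B : ℕ) : ℝ) / s := by
      rw [sub_nonneg]
      exact div_le_one_of_le₀ (by exact_mod_cast Nat.sub_le _ _) hs0.le
    have h3 : 1 - ((s - B : ℕ) : ℝ) / s ≤ Real.exp (-(ε / 4)) := by
      have h4 : ε / 4 ≤ ((s - B : ℕ) : ℝ) / s := by
        rw [le_div_iff₀ hs0]
        have h6 : ε * D ≤ 1 / 2 * D := by gcongr
        have h7 : ε / 4 * s ≤ ε / 4 * (2 * D) := by
          refine mul_le_mul_of_nonneg_left ?_ (by positivity)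
          linarith
        linarith
      linarith [Real.add_one_le_exp (-(ε / 4))]
    have h5 : (1 - ((s - B : ℕ) : ℝ) / s) ^ (s - B) ≤ Real.exp (-(ε ^ 2 / 32 * D)) := by
      refine (pow_le_pow_left₀ h2 h3 _).trans ?_
      rw [← Real.exp_nat_mul, Real.exp_le_exp]
      have h6 : ε / 2 * D * (ε / 4) ≤ ((s - B : ℕ) : ℝ) * (ε / 4) := by gcongr
      have h7 : 0 < ε ^ 2 * D := by positivity
      linarith
    calc (D : ℝ) * (1 - ((s - B : ℕ) : ℝ) / s) ^ (s - B) ≤ D * Real.exp (-(ε ^ 2 / 32 * D)) := by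
          gcongr
      _ ≤ _ := by linarith
  have t4 : (D : ℝ) * (1 / P) ≤ κ / 8 := by
    rw [mul_one_div, div_le_iff₀ hP0]
    rw [div_lt_iff₀ hκ8] at hP
    linarith
  have t5 : (D : ℝ) * (2 * (s * (1 - 1 / (P : ℝ)) ^ ℓ)) ≤ κ / 8 := by
    refine le_trans (le_of_eq ?_) hℓ
    ring
  have t6 : (D : ℝ) * (2 * (N * lam ^ (Nat.sqrt d))) ≤ κ / 8 := by
    refine le_trans ?_ (hd₁ d (by omega))
    calc (D : ℝ) * (2 * (N * lam ^ (Nat.sqrt d))) ≤ D * (2 * (ρ * d * lam ^ (Nat.sqrt d))) := by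
          gcongr
      _ = _ := by ring
  have t7 : (D : ℝ) * (2 * ∑ n ∈ Icc (n₁ + 1) (Nat.sqrt d + 1), ∑ w ∈ range (2 * R + 2),
      (N : ℝ) * (2 / d * D ^ w * lam ^ (n - 1))) ≤ κ / 8 := by
    refine le_trans ?_ hn₁
    have h1 : ∀ n ∈ Icc (n₁ + 1) (Nat.sqrt d + 1), ∑ w ∈ range (2 * R + 2),
        (N : ℝ) * (2 / d * D ^ w * lam ^ (n - 1)) ≤
        (2 * R + 2 : ℕ) * (ρ * (2 * D ^ (2 * R + 1))) * lam ^ (n - 1) := by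
      intro n _
      have h2 : ∀ w ∈ range (2 * R + 2), (N : ℝ) * (2 / d * D ^ w * lam ^ (n - 1)) ≤
          ρ * (2 * D ^ (2 * R + 1)) * lam ^ (n - 1) := by
        intro w hw
        rw [Finset.mem_range] at hw
        calc (N : ℝ) * (2 / d * D ^ w * lam ^ (n - 1))
            ≤ (ρ * d) * (2 / d * D ^ (2 * R + 1) * lam ^ (n - 1)) := by
              have : (D : ℝ) ^ w ≤ D ^ (2 * R + 1) :=
                pow_le_pow_right₀ (by linarith) (by omega)
              gcongr
          _ = _ := by field_simp
      refine (sum_le_sum h2).trans (le_of_eq ?_)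
      rw [sum_const, card_range, nsmul_eq_mul]
      ring
    have h3 := sum_le_sum h1
    rw [← mul_sum] at h3
    have h4 := sum_pow_le hlam0 hlam1 (n₁ + 1) (Nat.sqrt d + 1) (by omega)
    rw [Nat.add_sub_cancel] at h4
    calc _ ≤ (D : ℝ) * (2 * ((2 * R + 2 : ℕ) * (ρ * (2 * D ^ (2 * R + 1))) *
          (lam ^ n₁ * (1 - lam)⁻¹))) := by
          refine mul_le_mul_of_nonneg_left (mul_le_mul_of_nonneg_left
            (h3.trans (mul_le_mul_of_nonneg_left h4 (by positivity))) (by norm_num)) (by positivity)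
      _ = _ := by ring
  unfold failBound
  rw [← hlam]
  linarith [t1, t2, t3, t4, t5, t6, t7]

end Numerics
end AEC

namespace AEC
open scoped Classical
open Finset Filter Topology SimpleGraph

section Numerics

lemma eventually_ball_le {c ρ : ℝ} (hc : 0 < c) (C : ℕ) :
    ∀ᶠ d : ℕ in atTop,
      12 * ((⌊(ρ + 1) * d⌋₊ + 1 : ℕ) : ℝ) ^ (C + 4 * Nat.sqrt d) ≤ Real.exp (c * d) := by
  have hs : Tendsto Nat.sqrt atTop atTop :=
    tendsto_atTop_atTop.2 fun b => ⟨b * b, fun a ha => Nat.le_sqrt.2 ha⟩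
  have h := ((Real.tendsto_pow_mul_exp_neg_atTop_nhds_zero 26).comp
    ((tendsto_natCast_atTop_atTop (R := ℝ)).const_mul_atTop hc)).const_mul ((1 / c) ^ 26)
  rw [mul_zero] at h
  obtain ⟨M, hM⟩ := exists_nat_gt (ρ + 2)
  filter_upwards [hs.eventually (h.eventually_le_const one_pos), eventually_ge_atTop M,
    hs.eventually (eventually_ge_atTop 16), hs.eventually (eventually_ge_atTop C),
    eventually_ge_atTop 1] with d h1 h2 h3 h4 h5
  set K := Nat.sqrt d with hK
  have hKr : (16 : ℝ) ≤ K := by exact_mod_cast h3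
  have hKd : (K : ℝ) * K ≤ d := by exact_mod_cast Nat.sqrt_le d
  have hdK : (d : ℝ) ≤ 4 * K ^ 2 := by
    have := Nat.sqrt_le_add d
    have h6 : d ≤ 4 * K ^ 2 := by nlinarith
    exact_mod_cast h6
  have hd1 : (1 : ℝ) ≤ d := by exact_mod_cast h5
  have hdM : ρ + 2 ≤ d := hM.le.trans (by exact_mod_cast h2)
  have hfl : ((⌊(ρ + 1) * d⌋₊ + 1 : ℕ) : ℝ) ≤ (K : ℝ) ^ 5 := by
    have h7 : ((⌊(ρ + 1) * d⌋₊ + 1 : ℕ) : ℝ) ≤ (d : ℝ) ^ 2 := by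
      rcases le_or_gt 0 ((ρ + 1) * d) with h0 | h0
      · have := Nat.floor_le h0
        push_cast
        nlinarith
      · rw [Nat.floor_of_nonpos h0.le]
        push_cast
        nlinarith
    calc ((⌊(ρ + 1) * d⌋₊ + 1 : ℕ) : ℝ) ≤ (d : ℝ) ^ 2 := h7
      _ ≤ (4 * (K : ℝ) ^ 2) ^ 2 := by gcongr
      _ = 16 * (K : ℝ) ^ 4 := by ring
      _ ≤ K * (K : ℝ) ^ 4 := by gcongr
      _ = (K : ℝ) ^ 5 := by ring
  have h8 : (K : ℝ) ^ 26 ≤ Real.exp (c * K) := by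
    simp only [Function.comp_apply, mul_pow, Real.exp_neg] at h1
    have h9 : (1 / c) ^ 26 * (c ^ 26 * (K : ℝ) ^ 26 * (Real.exp (c * K))⁻¹) =
        (K : ℝ) ^ 26 / Real.exp (c * K) := by
      field_simp
    rw [h9, div_le_one (Real.exp_pos _)] at h1
    exact h1
  have hK1 : (1 : ℝ) ≤ K := by linarith
  calc 12 * ((⌊(ρ + 1) * d⌋₊ + 1 : ℕ) : ℝ) ^ (C + 4 * K)
      ≤ K * ((K : ℝ) ^ 5) ^ (C + 4 * K) := by gcongr; linarith
    _ ≤ (K : ℝ) ^ K * ((K : ℝ) ^ 5) ^ (5 * K) := by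
        have h10 : (K : ℝ) ≤ (K : ℝ) ^ K := le_self_pow₀ hK1 (by omega)
        have h11 : ((K : ℝ) ^ 5) ^ (C + 4 * K) ≤ ((K : ℝ) ^ 5) ^ (5 * K) :=
          pow_le_pow_right₀ (one_le_pow₀ hK1) (by omega)
        gcongr
    _ = ((K : ℝ) ^ 26) ^ K := by
        rw [← pow_mul, ← pow_mul, ← pow_add]
        congr 1
        ring
    _ ≤ (Real.exp (c * K)) ^ K := by gcongr
    _ = Real.exp (c * (K * K)) := by
        rw [← Real.exp_nat_mul]
        congr 1
        ring
    _ ≤ Real.exp (c * d) := by gcongr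

lemma half_pow_le (n : ℕ) : (1 / 2 : ℝ) ^ n ≤ Real.exp (-(n / 2)) := by
  have : -((n : ℝ) / 2) = n * (-(1 / 2)) := by ring
  rw [this, Real.exp_nat_mul]
  refine pow_le_pow_left₀ (by norm_num) ?_ _
  linarith [Real.add_one_le_exp (-(1 / 2 : ℝ))]

lemma one_sub_pow_le {ε : ℝ} (hε : 0 ≤ ε) (hε1 : ε ≤ 1 / 2) {D d m : ℕ} (hD : 0 < D) (hDd : D ≤ d)
    (hm : ε * d / D ≤ m) : (1 - (D : ℝ) / d) ^ m ≤ 1 - ε + ε ^ 2 / 2 := by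
  have hD' : (0 : ℝ) < D := by exact_mod_cast hD
  have hd' : (0 : ℝ) < d := by exact_mod_cast hD.trans_le hDd
  have h0 : 0 ≤ 1 - (D : ℝ) / d := by
    rw [sub_nonneg, div_le_one hd']
    exact_mod_cast hDd
  have h1 : (1 - (D : ℝ) / d) ^ m ≤ Real.exp (-ε) := by
    have h2 : 1 - (D : ℝ) / d ≤ Real.exp (-(D / d)) := by
      linarith [Real.add_one_le_exp (-((D : ℝ) / d))]
    refine (pow_le_pow_left₀ h0 h2 m).trans ?_
    rw [← Real.exp_nat_mul, Real.exp_le_exp]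
    have h3 : ε * d / D * (D / d) ≤ m * (D / d) := by gcongr
    have h4 : ε * d / D * (D / d) = ε := by field_simp
    linarith
  refine h1.trans ?_
  rw [Real.exp_neg]
  have h5 : 1 + ε + ε ^ 2 / 2 ≤ Real.exp ε := Real.quadratic_le_exp_of_nonneg hε
  rw [inv_le_comm₀ (Real.exp_pos _) (by nlinarith)]
  refine le_trans ?_ h5
  rw [inv_le_iff_one_le_mul₀ (by nlinarith)]
  nlinarith [sq_nonneg (ε ^ 2)]

lemma chernoff_unselected_le {p p' η : ℝ} (hp : 0 ≤ p) (hpp : p ≤ p') (hp1 : p' ≤ 1)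
    (hη : 0 < η) (hη1 : η ≤ 1) {d t : ℕ} (ht : (p' + η) * d ≤ t) :
    (1 + p * (1 + η / 2 - 1)) ^ d / (1 + η / 2) ^ t ≤ Real.exp (-(η ^ 2 / 8 * d)) := by
  have hp0 : 0 ≤ p' := hp.trans hpp
  have h1 : (1 + p * (1 + η / 2 - 1)) ^ d / (1 + η / 2) ^ t ≤
      (1 + p' * (η / 2)) ^ d / (1 + η / 2) ^ t := by
    rw [add_sub_cancel_left]
    gcongr
  refine (h1.trans (chernoff_exp_le hp0 (by positivity) d t)).trans (Real.exp_le_exp.2 ?_)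
  have h2 : (p' + η) * d * (η / 2 / (1 + η / 2)) ≤ t * (η / 2 / (1 + η / 2)) := by gcongr
  have h3 : p' * (η / 2) * d - (p' + η) * d * (η / 2 / (1 + η / 2)) =
      -((η - p' * (η / 2)) * (η / 2) * d / (1 + η / 2)) := by
    field_simp
    ring
  have h4 : η ^ 2 / 8 * d ≤ (η - p' * (η / 2)) * (η / 2) * d / (1 + η / 2) := by
    rw [le_div_iff₀ (by positivity)]
    have h5 : η / 2 ≤ η - p' * (η / 2) := by nlinarith
    calc η ^ 2 / 8 * d * (1 + η / 2) ≤ η ^ 2 / 8 * d * 2 := by gcongr; linarith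
      _ = η / 2 * (η / 2) * d := by ring
      _ ≤ _ := by gcongr
  linarith

end Numerics

section Degree
variable {V A : Type*} [Fintype V] [Fintype A] {G : SimpleGraph V} {χ : Sym2 V → Option A}

lemma card_inc_le_of_partialColouring (hχ : PartialColouring G χ) (v : V) :
    (inc G v).card ≤ Fintype.card A + (inc (edgeSub G fun e => χ e = none) v).card := by
  have h1 : inc G v ⊆ ((inc G v).filter fun e => χ e ≠ none) ∪
      inc (edgeSub G fun e => χ e = none) v := by
    intro e he
    rw [mem_union, mem_filter, mem_inc, mem_inc, mem_edgeSub]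
    rw [mem_inc] at he
    tauto
  have h2 : ((inc G v).filter fun e => χ e ≠ none).card ≤ Fintype.card A := by
    have h3 : ((inc G v).filter fun e => χ e ≠ none).card ≤
        ((univ : Finset A).map Function.Embedding.some).card := by
      refine card_le_card_of_injOn χ (fun e he => ?_) fun e he f hf hef => ?_
      · rw [mem_coe, mem_filter] at he
        obtain ⟨a, ha⟩ := Option.ne_none_iff_exists.1 he.2
        rw [← ha]
        simp
      · rw [mem_coe, mem_filter, mem_inc] at he hf
        obtain ⟨a, ha⟩ := Option.ne_none_iff_exists.1 he.2
        obtain ⟨y, rfl⟩ := Sym2.mem_iff_exists.1 he.1.2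
        obtain ⟨z, rfl⟩ := Sym2.mem_iff_exists.1 hf.1.2
        rw [hχ.proper a v y z ha.symm (hef ▸ ha.symm)]
    simpa using h3
  have := (card_le_card h1).trans (card_union_le _ _)
  omega

end Degree
end AEC

namespace AEC
open scoped Classical
open Finset Filter Topology SimpleGraph

section StageNumerics

lemma two_pow_mul_pow_le {ε : ℝ} {d D m h : ℕ} (hm : ε * d / D ≤ m) (hh : 0 < h) :
    (2 : ℝ) ^ m * ((1 / 4 : ℝ) ^ h) ^ (m / h + 1) ≤ Real.exp (-(ε / (2 * D) * d)) := by
  have h1 : m ≤ h * (m / h + 1) := by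
    have := Nat.div_add_mod m h
    have := Nat.mod_lt m hh
    linarith [mul_add h (m / h) 1]
  calc (2 : ℝ) ^ m * ((1 / 4 : ℝ) ^ h) ^ (m / h + 1)
      ≤ (2 : ℝ) ^ m * (1 / 4 : ℝ) ^ m := by
        rw [← pow_mul]
        gcongr ?_ * ?_
        exact pow_le_pow_of_le_one (by norm_num) (by norm_num) h1
    _ = (1 / 2 : ℝ) ^ m := by rw [← mul_pow]; norm_num
    _ ≤ Real.exp (-(m / 2)) := half_pow_le m
    _ ≤ _ := by
        refine Real.exp_le_exp.2 (neg_le_neg ?_)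
        have : ε / (2 * D) * d = ε * d / D / 2 := by
          rw [div_div, mul_comm (D : ℝ) 2, div_mul_eq_mul_div]
        rw [this]
        gcongr

lemma chernoff_failed_le {d m h tc : ℕ} {q : ℝ} (hmd : m ≤ d) (hq : 0 ≤ q)
    (hqh : q * 16 ^ h ≤ 1) (htc : d ≤ h * tc) :
    (2 : ℝ) ^ m * ((1 + q * (16 ^ h - 1)) ^ d / (16 ^ h) ^ tc) ≤ Real.exp (-(d / 2)) := by
  have h16 : (1 : ℝ) ≤ 16 ^ h := one_le_pow₀ (by norm_num)
  calc (2 : ℝ) ^ m * ((1 + q * (16 ^ h - 1)) ^ d / (16 ^ h) ^ tc)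
      ≤ 2 ^ d * (2 ^ d / 16 ^ d) := by
        have h1 : 1 + q * (16 ^ h - 1) ≤ 2 := by linarith [mul_sub q (16 ^ h) 1]
        have h2 : 0 ≤ 1 + q * (16 ^ h - 1) := by
          have := mul_nonneg hq (sub_nonneg.2 h16)
          linarith
        rw [← pow_mul]
        gcongr
        all_goals norm_num
    _ = (1 / 4 : ℝ) ^ d := by rw [← div_pow, ← mul_pow]; norm_num
    _ ≤ (1 / 2 : ℝ) ^ d := by gcongr; norm_num
    _ ≤ _ := half_pow_le d

lemma failed_prob_le {ε : ℝ} (hε1 : ε ≤ 1 / 2) {d D m h : ℕ} (hm : (m : ℝ) ≤ ε * d / D + 1)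
    (hh : 0 < h) (hD : 0 < D) (hd : 4 * (D * h) ≤ d) :
    ((m / h + 1 : ℕ) : ℝ) * ((D : ℝ) / d) * h ≤ 1 := by
  have hD' : (0 : ℝ) < D := by exact_mod_cast hD
  have hh' : (1 : ℝ) ≤ h := by exact_mod_cast hh
  have hd' : 4 * ((D : ℝ) * h) ≤ d := by exact_mod_cast hd
  have hDh : (D : ℝ) ≤ D * h := by nlinarith
  have hd0 : (0 : ℝ) < d := by linarith
  have h1 : ((m / h + 1 : ℕ) : ℝ) * h ≤ m + h := by
    have := Nat.div_mul_le_self m h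
    have h2 : (m / h + 1) * h ≤ m + h := by linarith [add_mul (m / h) 1 h]
    exact_mod_cast h2
  have h3 : ((m / h + 1 : ℕ) : ℝ) * ((D : ℝ) / d) * h = ((m / h + 1 : ℕ) : ℝ) * h * D / d := by
    ring
  rw [h3, div_le_one hd0]
  calc ((m / h + 1 : ℕ) : ℝ) * h * D ≤ (m + h) * D := by gcongr
    _ ≤ (ε * d / D + 1 + h) * D := by gcongr
    _ = ε * d + D + D * h := by field_simp
    _ ≤ 1 / 2 * d + D + D * h := by gcongr
    _ ≤ d := by linarith

end StageNumerics
end AEC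

namespace AEC
open scoped Classical
open Finset Filter Topology SimpleGraph

lemma stage_colours_le {ε : ℝ} (hε : 0 < ε) (hε1 : ε ≤ 1 / 2) {d D s m : ℕ}
    (hm : (m : ℝ) ≤ ε * d / D + 1) (hs : (s : ℝ) ≤ (1 + ε) * D + 1) (hD : 2 / ε ≤ D)
    (hd : 6 * D / ε ^ 2 ≤ d) : (m : ℝ) * s ≤ ε * (1 + 2 * ε) * d := by
  have hD0 : (0 : ℝ) < D := (by positivity : (0 : ℝ) < 2 / ε).trans_le hD
  have hd0 : (0 : ℝ) ≤ d := Nat.cast_nonneg d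
  have hD2 : 2 ≤ D * ε := (div_le_iff₀ hε).1 hD
  have hd2 : 6 * D ≤ d * ε ^ 2 := (div_le_iff₀ (by positivity)).1 hd
  have h1 : (m : ℝ) * s ≤ (ε * d / D + 1) * ((1 + ε) * D + 1) := by gcongr
  have h2 : (ε * d / D + 1) * ((1 + ε) * D + 1) =
      ε * (1 + ε) * d + ε * d / D + ((1 + ε) * D + 1) := by
    field_simp
  have h3 : ε * d / D ≤ ε ^ 2 / 2 * d := by
    rw [div_le_iff₀ hD0]
    calc ε * d = ε * d / 2 * 2 := by ring
      _ ≤ ε * d / 2 * (D * ε) := by gcongr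
      _ = _ := by ring
  have hDone : (1 : ℝ) ≤ D := by nlinarith
  have h4 : (1 + ε) * D + 1 ≤ 3 * D := by nlinarith
  nlinarith

set_option maxHeartbeats 1000000 in
/-- Given a partial colouring with few colours in which every uncoloured degree is at most `d`,
about `ε d` new colours suffice to reduce all uncoloured degrees by a factor of about `1 - ε`. -/
theorem exists_reduce_degree {ε ρ : ℝ} (hε : 0 < ε) (hε1 : ε ≤ 1 / 2) (hρ : 0 ≤ ρ) :
    ∃ g d₀ : ℕ, ∀ (V A : Type) [Fintype V] [Fintype A] (G : SimpleGraph V)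
      (χ : Sym2 V → Option A) (d : ℕ), PartialColouring G χ → GirthGe G g → d₀ ≤ d →
      (Fintype.card A : ℝ) ≤ ρ * d →
      (∀ v, (inc (edgeSub G fun e => χ e = none) v).card ≤ d) →
      ∃ (A' : Type) (_ : Fintype A') (χ' : Sym2 V → Option A'), PartialColouring G χ' ∧
        (Fintype.card A' : ℝ) ≤ Fintype.card A + ε * (1 + 2 * ε) * d ∧
        ∀ v, ((inc (edgeSub G fun e => χ' e = none) v).card : ℝ) ≤ (1 - ε + ε ^ 2) * d := by
  have hεε : ε ^ 2 ≤ ε / 2 := by nlinarith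
  have hεε1 : ε * (1 + 2 * ε) ≤ 1 := by nlinarith
  obtain ⟨h, hh⟩ := exists_nat_gt (8 / ε ^ 2)
  have hh0' : (0 : ℝ) < h := (by positivity : (0 : ℝ) < 8 / ε ^ 2).trans hh
  have hh0 : 0 < h := by exact_mod_cast hh0'
  obtain ⟨D₀, hD₀⟩ := exists_nat_gt (2 / ε)
  have hκ : (0 : ℝ) < (1 / 4) ^ (16 ^ h) := by positivity
  obtain ⟨D, R, P, s, ℓ, n₀, B, b, d₁, x, hDD₀, hD, hR, hP, hs, hℓ, hn₀, hbB, hx, hsD, hfail⟩ :=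
    exists_failBound_le hε hε1 (by linarith : 0 ≤ ρ + 1) hκ D₀
  have hD' : (0 : ℝ) < D := by exact_mod_cast hD
  obtain ⟨c, hc0, hc1, hc2, hc3⟩ : ∃ c : ℝ, 0 < c ∧ c ≤ (ε ^ 2 / 8) ^ 2 / 8 ∧
      c ≤ ε / (2 * D) ∧ c ≤ 1 / 2 :=
    ⟨min ((ε ^ 2 / 8) ^ 2 / 8) (min (ε / (2 * D)) (1 / 2)), by positivity, min_le_left _ _,
      (min_le_right _ _).trans (min_le_left _ _), (min_le_right _ _).trans (min_le_right _ _)⟩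
  obtain ⟨d₂, hd₂⟩ := eventually_atTop.1 (eventually_ball_le (ρ := ρ) hc0 (2 * ℓ + 4 * R + 11))
  obtain ⟨d₃, hd₃⟩ := exists_nat_gt (6 * D / ε ^ 2)
  obtain ⟨d₄, hd₄⟩ := exists_nat_gt (4 / ε ^ 2)
  refine ⟨2 * R + 2 + ℓ + 2 * n₀, d₁ + d₂ + d₃ + d₄ + 4 * (D * 16 ^ h) + 2, ?_⟩
  intro V A _ _ G χ d hχ hg hd hA hdeg
  have hd0 : 0 < d := by omega
  have hd0' : (0 : ℝ) < d := by exact_mod_cast hd0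
  have hd3' : 6 * D / ε ^ 2 ≤ (d : ℝ) := hd₃.le.trans (by exact_mod_cast (by omega : d₃ ≤ d))
  have hd4' : 4 / ε ^ 2 ≤ (d : ℝ) := hd₄.le.trans (by exact_mod_cast (by omega : d₄ ≤ d))
  have h16 : 4 * (D * 16 ^ h) ≤ d := by omega
  have hDd : D ≤ d := by
    have : D * 1 ≤ D * 16 ^ h := Nat.mul_le_mul_left D (Nat.one_le_pow _ _ (by norm_num))
    omega
  obtain ⟨m, hm, hm'⟩ : ∃ m : ℕ, ε * d / D ≤ m ∧ (m : ℝ) ≤ ε * d / D + 1 :=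
    ⟨⌈ε * d / D⌉₊, Nat.le_ceil _, (Nat.ceil_lt_add_one (by positivity)).le⟩
  have hDone : (1 : ℝ) ≤ D := by exact_mod_cast hD
  have hmd : m ≤ d := by
    have h1 : (m : ℝ) ≤ d := by
      have h2 : ε * d / D ≤ 1 / 2 * d := by
        rw [div_le_iff₀ hD']
        calc ε * d ≤ 1 / 2 * d := by gcongr
          _ = 1 / 2 * d * 1 := by ring
          _ ≤ 1 / 2 * d * D := by gcongr
      have h3 : (2 : ℝ) ≤ d := by exact_mod_cast (by omega : 2 ≤ d)
      linarith
    exact_mod_cast h1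
  have hms : (m : ℝ) * s ≤ ε * (1 + 2 * ε) * d :=
    stage_colours_le hε hε1 hm' hsD (hD₀.le.trans (by exact_mod_cast hDD₀)) hd3'
  have hN : ((Fintype.card A + m * s : ℕ) : ℝ) ≤ (ρ + 1) * d := by
    push_cast
    have : ε * (1 + 2 * ε) * d ≤ 1 * d := by gcongr
    linarith
  set η : ℝ := ε ^ 2 / 8 with hη
  have hη0 : 0 < η := by positivity
  obtain ⟨ta, hta, hta'⟩ : ∃ ta : ℕ, (1 - ε + ε ^ 2 / 2 + η) * d ≤ ta ∧
      (ta : ℝ) ≤ (1 - ε + ε ^ 2 / 2 + η) * d + 1 := by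
    refine ⟨⌈(1 - ε + ε ^ 2 / 2 + η) * d⌉₊, Nat.le_ceil _, (Nat.ceil_lt_add_one ?_).le⟩
    have : 0 ≤ 1 - ε := by linarith
    positivity
  obtain ⟨tc, htc, htc'⟩ : ∃ tc : ℕ, d ≤ h * tc ∧ (tc : ℝ) ≤ d / h + 1 := by
    refine ⟨⌈(d : ℝ) / h⌉₊, ?_, (Nat.ceil_lt_add_one (by positivity)).le⟩
    have := Nat.le_ceil ((d : ℝ) / h)
    rw [div_le_iff₀' hh0'] at this
    exact_mod_cast this
  have hf := hfail d (Fintype.card A + m * s) (by omega) hN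
  have hdD : (D : ℝ) / d ≤ 1 := (div_le_one hd0').2 (by exact_mod_cast hDd)
  have hΔ : ∀ x, (inc G x).card ≤ ⌊(ρ + 1) * d⌋₊ := by
    intro x
    have h1 := card_inc_le_of_partialColouring hχ x
    have h2 := hdeg x
    refine Nat.le_floor ?_
    have h3 : ((inc G x).card : ℝ) ≤ Fintype.card A + d := by exact_mod_cast h1.trans (by omega)
    linarith
  have hLa : (1 + (1 - (D : ℝ) / d) ^ m * (1 + η / 2 - 1)) ^ d / (1 + η / 2) ^ ta ≤
      Real.exp (-(c * d)) := by
    refine (chernoff_unselected_le (pow_nonneg (by linarith) m)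
      (one_sub_pow_le hε.le hε1 hD hDd hm) (by linarith) hη0 (by linarith) hta).trans ?_
    refine Real.exp_le_exp.2 (neg_le_neg ?_)
    gcongr
  have hLb : (2 : ℝ) ^ m * ((1 / 4 : ℝ) ^ (16 ^ h)) ^ (m / 16 ^ h + 1) ≤ Real.exp (-(c * d)) := by
    refine (two_pow_mul_pow_le hm (by positivity)).trans ?_
    refine Real.exp_le_exp.2 (neg_le_neg ?_)
    gcongr
  have hLc : (2 : ℝ) ^ m * ((1 + ((m / 16 ^ h + 1 : ℕ) : ℝ) * ((D : ℝ) / d) * (16 ^ h - 1)) ^ d /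
      (16 ^ h) ^ tc) ≤ Real.exp (-(c * d)) := by
    refine (chernoff_failed_le hmd (by positivity) ?_ htc).trans ?_
    · have := failed_prob_le hε1 hm' (by positivity : 0 < 16 ^ h) hD h16
      simpa using this
    · refine Real.exp_le_exp.2 (neg_le_neg ?_)
      rw [div_eq_inv_mul, ← one_div]
      gcongr
  have hball := hd₂ d (by omega)
  obtain ⟨χ', hχ', hχ'd⟩ := exists_stage (m := m) (K := Nat.sqrt d) hχ hg (by omega) (by omega)
    (by omega) hdeg hd0 hR hs hP hDd hℓ hn₀ hbB hx (κ := (1 / 4) ^ (16 ^ h))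
    (pow_le_one₀ (by norm_num) (by norm_num)) (failBound_nonneg hx (by omega) hP) hf
    (ta := ta) (tb := m / 16 ^ h + 1) (tc := tc) (xa := 1 + η / 2) (xc := 16 ^ h)
    (by linarith) (one_le_pow₀ (by norm_num)) hΔ (by
      refine le_trans (mul_le_mul_of_nonneg_right
        (mul_le_mul_of_nonneg_left (add_le_add hLa (add_le_add hLb hLc)) (by norm_num))
        (Nat.cast_nonneg _)) ?_
      have he : 2 * (ℓ + 2 * Nat.sqrt d + 2 * R + 5) + 1 = 2 * ℓ + 4 * R + 11 + 4 * Nat.sqrt d := by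
        ring
      rw [he, Nat.cast_pow]
      calc 4 * (Real.exp (-(c * d)) + (Real.exp (-(c * d)) + Real.exp (-(c * d)))) *
            ((⌊(ρ + 1) * d⌋₊ + 1 : ℕ) : ℝ) ^ (2 * ℓ + 4 * R + 11 + 4 * Nat.sqrt d)
          = Real.exp (-(c * d)) * (12 * ((⌊(ρ + 1) * d⌋₊ + 1 : ℕ) : ℝ) ^
            (2 * ℓ + 4 * R + 11 + 4 * Nat.sqrt d)) := by ring
        _ ≤ Real.exp (-(c * d)) * Real.exp (c * d) := by gcongr
        _ = 1 := by rw [← Real.exp_add]; simp)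
  refine ⟨A ⊕ (Fin m × Fin s), inferInstance, χ', hχ', ?_, fun v => ?_⟩
  · simp only [Fintype.card_sum, Fintype.card_prod, Fintype.card_fin]
    push_cast
    linarith
  · have h1 : ((inc (edgeSub G fun e => χ' e = none) v).card : ℝ) + 1 ≤ ta + tc := by
      exact_mod_cast hχ'd v
    have h2 : (d : ℝ) / h ≤ ε ^ 2 / 8 * d := by
      rw [div_le_iff₀ hh0']
      have h3 : 8 ≤ h * ε ^ 2 := ((div_lt_iff₀ (by positivity)).1 hh).le
      calc (d : ℝ) = d / 8 * 8 := by ring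
        _ ≤ d / 8 * (h * ε ^ 2) := by gcongr
        _ = _ := by ring
    have h4 : 1 ≤ ε ^ 2 / 4 * d := by
      rw [div_le_iff₀ (by positivity)] at hd4'
      linarith
    have h5 : (1 - ε + ε ^ 2) * d = (1 - ε + ε ^ 2 / 2 + η) * d + ε ^ 2 / 8 * d + ε ^ 2 / 4 * d := by
      rw [hη]
      ring
    linarith

end AEC

namespace AEC
open scoped Classical
open Finset SimpleGraph

section Periodic
variable {V A : Type*}

/-- An infinite alternating sequence of two proper colour classes closes up. -/
lemma exists_period [Finite V] {κ : Sym2 V → Option A} {a b : A}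
    (hp : ∀ c x y z, κ s(x, y) = some c → κ s(x, z) = some c → y = z)
    (hloop : ∀ x, κ s(x, x) = none) {v : ℕ → V}
    (h : ∀ t, κ s(v t, v (t + 1)) = some (if Even t then a else b)) :
    ∃ k, 0 < k ∧ v (2 * k) = v 0 ∧ Set.InjOn v (Set.Iio (2 * k)) := by
  have back : ∀ i j n, Even n → v (i + j) = v (i + j + n) → v i = v (i + n) := by
    intro i j n hn
    induction j with
    | zero => exact id
    | succ j ih =>
      refine fun he => ih ?_
      have h1 := h (i + j)
      have h2 := h (i + j + n)
      rw [Sym2.eq_swap] at h1 h2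
      have h3 : Even (i + j + n) ↔ Even (i + j) := by simp [Nat.even_add, hn]
      simp only [h3] at h2
      rw [show i + j + n + 1 = i + (j + 1) + n by omega, ← he] at h2
      exact hp _ _ _ _ h1 h2
  have fold : ∀ m i, v i ≠ v (i + (2 * m + 1)) := by
    intro m
    induction m with
    | zero =>
      intro i he
      have := h i
      rw [show i + 1 = i + (2 * 0 + 1) by omega, ← he, hloop] at this
      cases this
    | succ m ih =>
      intro i he
      refine ih (i + 1) ?_
      have h1 := h i
      have h2 := h (i + 2 * m + 2)
      have h3 : Even (i + 2 * m + 2) ↔ Even i := by simp [Nat.even_add]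
      simp only [h3] at h2
      rw [show i + 2 * m + 2 + 1 = i + (2 * (m + 1) + 1) by omega, ← he, Sym2.eq_swap] at h2
      rw [show i + 1 + (2 * m + 1) = i + 2 * m + 2 by omega]
      exact hp _ _ _ _ h1 h2
  have key : ∀ i j, i < j → v i = v j → Even (j - i) ∧ v 0 = v (j - i) := by
    intro i j hij he
    have hev : Even (j - i) := by
      by_contra ho
      obtain ⟨m, hm⟩ := Nat.not_even_iff_odd.1 ho
      refine fold m i ?_
      rw [he]
      congr 1
      omega
    refine ⟨hev, ?_⟩
    have := back 0 i (j - i) hev (by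
      rw [show 0 + i + (j - i) = j by omega, zero_add, he])
    simpa using this
  have hex : ∃ n, 0 < n ∧ v 0 = v n := by
    obtain ⟨i, j, hij, he⟩ := Finite.exists_ne_map_eq_of_infinite v
    rcases lt_or_gt_of_ne hij with hlt | hlt
    · exact ⟨j - i, by omega, (key i j hlt he).2⟩
    · exact ⟨i - j, by omega, (key j i hlt he.symm).2⟩
  obtain ⟨hn, he⟩ := Nat.find_spec hex
  set n := Nat.find hex with hndef
  have hev := (key 0 n hn he).1
  obtain ⟨k, hk⟩ := hev
  have hinj : ∀ i j, i < j → j < n → v i ≠ v j := fun i j hij hj hv =>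
    Nat.find_min hex (m := j - i) (by omega) ⟨by omega, (key i j hij hv).2⟩
  refine ⟨k, by omega, ?_, fun i hi j hj hv => ?_⟩
  · rw [he]
    congr 1
    omega
  · rw [Set.mem_Iio] at hi hj
    rcases lt_trichotomy i j with hlt | rfl | hlt
    · exact absurd hv (hinj i j hlt (by omega))
    · rfl
    · exact absurd hv.symm (hinj j i hlt (by omega))

/-- The edges of a closed sequence without repeated vertices are distinct. -/
lemma edge_ne_of_injOn {v : ℕ → V} {n : ℕ} (hn : 3 ≤ n) (hv : v n = v 0)
    (hinj : Set.InjOn v (Set.Iio n)) {i j : ℕ} (hij : i < j) (hj : j < n) :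
    s(v i, v (i + 1)) ≠ s(v j, v (j + 1)) := by
  intro he
  have h1 : v (j + 1) = v (if j + 1 = n then 0 else j + 1) := by
    split_ifs with h
    · rw [h, hv]
    · rfl
  rw [h1] at he
  rcases Sym2.eq_iff.1 he with ⟨h2, -⟩ | ⟨h2, h3⟩
  · have := hinj (Set.mem_Iio.2 (by omega)) (Set.mem_Iio.2 (by omega)) h2
    omega
  · have h4 := hinj (Set.mem_Iio.2 (by omega)) (Set.mem_Iio.2 (by split_ifs <;> omega)) h2
    have h5 := hinj (Set.mem_Iio.2 (by omega)) (Set.mem_Iio.2 (by omega)) h3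
    split_ifs at h4 <;> omega

end Periodic

section Completion
variable {V A B : Type*} {G : SimpleGraph V} {χ : Sym2 V → Option A}

lemma PartialColouring.of_le (hχ : PartialColouring G χ) {ψ : Sym2 V → Option A}
    (h : ∀ e a, ψ e = some a → χ e = some a) : PartialColouring G ψ where
  mem e a he := hχ.mem e a (h e a he)
  proper a x y z h1 h2 := hχ.proper a x y z (h _ _ h1) (h _ _ h2)
  noAlt v a b hab hv := hχ.noAlt v a b hab fun l => ⟨h _ _ (hv l).1, h _ _ (hv l).2⟩

/-- The edges in `S` are coloured by `φ`, the remaining edges by `χ`. -/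
noncomputable def comb (χ : Sym2 V → Option A) (S : Finset (Sym2 V)) (φ : Sym2 V → B) (e : Sym2 V) :
    Option (A ⊕ B) :=
  if e ∈ S then some (.inr (φ e)) else (χ e).map .inl

lemma comb_eq_inr {S : Finset (Sym2 V)} {φ : Sym2 V → B} {e : Sym2 V} {c : B} :
    comb χ S φ e = some (.inr c) ↔ e ∈ S ∧ φ e = c := by
  by_cases h : e ∈ S <;> simp [comb, h]

lemma comb_eq_inl {S : Finset (Sym2 V)} {φ : Sym2 V → B} {e : Sym2 V} {a : A} :
    comb χ S φ e = some (.inl a) ↔ e ∉ S ∧ χ e = some a := by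
  by_cases h : e ∈ S <;> simp [comb, h]

variable [Fintype V] [Fintype B]

/-- The colourings of `S` that extend the partial colouring `χ`, normalised outside `S`. -/
noncomputable def validExt (G : SimpleGraph V) (χ : Sym2 V → Option A) (c₀ : B)
    (S : Finset (Sym2 V)) : Finset (Sym2 V → B) :=
  univ.filter fun φ => (∀ e, e ∉ S → φ e = c₀) ∧ PartialColouring G (comb χ S φ)

lemma mem_validExt {c₀ : B} {S : Finset (Sym2 V)} {φ : Sym2 V → B} :
    φ ∈ validExt G χ c₀ S ↔ (∀ e, e ∉ S → φ e = c₀) ∧ PartialColouring G (comb χ S φ) := by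
  simp [validExt]

lemma restrict_mem_validExt {c₀ : B} {S T : Finset (Sym2 V)} (hS : ∀ e ∈ S, χ e = none)
    {φ : Sym2 V → B} (hφ : φ ∈ validExt G χ c₀ S) :
    (fun e => if e ∈ T then c₀ else φ e) ∈ validExt G χ c₀ (S \ T) := by
  rw [mem_validExt] at hφ ⊢
  refine ⟨fun e he => ?_, hφ.2.of_le ?_⟩
  · rw [mem_sdiff, not_and_or, not_not] at he
    split_ifs with h
    · rfl
    · exact hφ.1 e (he.resolve_right h)
  · rintro e (a | c) he
    · rw [comb_eq_inl, mem_sdiff] at he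
      refine comb_eq_inl.2 ⟨fun h => ?_, he.2⟩
      rw [hS e h] at he
      exact absurd he.2 (by simp)
    · rw [comb_eq_inr, mem_sdiff] at he
      refine comb_eq_inr.2 ⟨he.1.1, ?_⟩
      rw [← he.2, if_neg he.1.2]

/-- Colourings in which the edges of `T` repeat the colours of other edges are few. -/
lemma card_mul_pow_le {c₀ : B} {S T : Finset (Sym2 V)} (hS : ∀ e ∈ S, χ e = none) (hT : T ⊆ S)
    {L : ℕ} (hL : ∀ S' e, e ∉ S' → insert e S' ⊆ S →
      L * (validExt G χ c₀ S').card ≤ (validExt G χ c₀ (insert e S')).card)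
    {E : Finset (Sym2 V → B)} (hE : E ⊆ validExt G χ c₀ S)
    (hdet : ∀ f ∈ T, ∃ r, r ∈ S \ T ∧ ∀ φ ∈ E, φ f = φ r) :
    E.card * L ^ T.card ≤ (validExt G χ c₀ S).card := by
  have h1 : E.card ≤ (validExt G χ c₀ (S \ T)).card := by
    refine card_le_card_of_injOn (fun φ e => if e ∈ T then c₀ else φ e)
      (fun φ hφ => restrict_mem_validExt hS (hE hφ)) fun φ hφ ψ hψ he => ?_
    have h2 : ∀ e, e ∉ T → φ e = ψ e := fun e he' => by
      have := congrFun he e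
      simpa [he'] using this
    funext e
    by_cases heT : e ∈ T
    · obtain ⟨r, hr, hr'⟩ := hdet e heT
      rw [hr' φ hφ, hr' ψ hψ]
      exact h2 r (mem_sdiff.1 hr).2
    · exact h2 e heT
  have h2 : ∀ T' ⊆ T, (validExt G χ c₀ (S \ T)).card * L ^ T'.card ≤
      (validExt G χ c₀ ((S \ T) ∪ T')).card := by
    intro T'
    induction T' using Finset.induction_on with
    | empty => simp
    | insert e T' he ih =>
      intro hT'
      have h3 := ih ((subset_insert _ _).trans hT')
      have heT : e ∈ T := hT' (mem_insert_self _ _)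
      have h4 := hL ((S \ T) ∪ T') e (by simp [he, heT]) (by
        intro f hf
        rw [mem_insert, mem_union, mem_sdiff] at hf
        rcases hf with rfl | hf | hf
        · exact hT heT
        · exact hf.1
        · exact hT (hT' (mem_insert_of_mem hf)))
      rw [card_insert_of_notMem he, pow_succ, union_insert]
      refine le_trans ?_ h4
      rw [← mul_assoc, mul_comm]
      exact Nat.mul_le_mul_left L h3
  have h3 := h2 T subset_rfl
  rw [sdiff_union_of_subset hT] at h3
  exact (Nat.mul_le_mul_right _ h1).trans h3

end Completion
end AEC

namespace AEC
open scoped Classical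
open Finset SimpleGraph

section Completion
variable {V A B : Type*} [Fintype V] [Fintype B] {G : SimpleGraph V} {χ : Sym2 V → Option A}

/-- The extensions of `χ` to `S` that repeat colours with period two at the positions in `I` along
the sequence `u`. -/
noncomputable def cycleEvent (G : SimpleGraph V) (χ : Sym2 V → Option A) (c₀ : B)
    (S : Finset (Sym2 V)) (u : ℕ → V) (I : Finset ℕ) : Finset (Sym2 V → B) :=
  (validExt G χ c₀ S).filter fun φ => Set.InjOn (fun t => s(u t, u (t + 1))) I ∧
    ∀ t ∈ I, s(u t, u (t + 1)) ∈ S ∧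
      s(u (2 - t % 2), u (2 - t % 2 + 1)) ∈ S \ I.image (fun t => s(u t, u (t + 1))) ∧
      φ s(u t, u (t + 1)) = φ s(u (2 - t % 2), u (2 - t % 2 + 1))

lemma card_cycleEvent_le {c₀ : B} {S : Finset (Sym2 V)} (hS : ∀ e ∈ S, χ e = none)
    {L : ℕ} (hL : ∀ S' e, e ∉ S' → insert e S' ⊆ S →
      L * (validExt G χ c₀ S').card ≤ (validExt G χ c₀ (insert e S')).card)
    (u : ℕ → V) (I : Finset ℕ) :
    (cycleEvent G χ c₀ S u I).card * L ^ I.card ≤ (validExt G χ c₀ S).card := by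
  rcases (cycleEvent G χ c₀ S u I).eq_empty_or_nonempty with h | ⟨φ, hφ⟩
  · simp [h]
  obtain ⟨-, hinj, hI⟩ := mem_filter.1 hφ
  rw [← card_image_of_injOn hinj]
  refine card_mul_pow_le hS ?_ hL (filter_subset _ _) ?_
  · intro f hf
    obtain ⟨t, ht, rfl⟩ := mem_image.1 hf
    exact (hI t ht).1
  · intro f hf
    obtain ⟨t, ht, rfl⟩ := mem_image.1 hf
    exact ⟨_, (hI t ht).2.1, fun ψ hψ => ((mem_filter.1 hψ).2.2 t ht).2.2⟩

lemma cycleEvent_congr {c₀ : B} {S : Finset (Sym2 V)} {u v : ℕ → V} {I : Finset ℕ} {n : ℕ}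
    (h : ∀ t ≤ n, u t = v t) (hI : ∀ t ∈ I, 3 ≤ t ∧ t < n) :
    cycleEvent G χ c₀ S u I = cycleEvent G χ c₀ S v I := by
  have h1 : ∀ t < n, s(u t, u (t + 1)) = s(v t, v (t + 1)) := fun t ht => by
    rw [h t ht.le, h (t + 1) ht]
  have h2 : I.image (fun t => s(u t, u (t + 1))) = I.image (fun t => s(v t, v (t + 1))) :=
    image_congr fun t ht => h1 t (hI t ht).2
  have h3 : Set.InjOn (fun t => s(u t, u (t + 1))) (I : Set ℕ) ↔
      Set.InjOn (fun t => s(v t, v (t + 1))) (I : Set ℕ) :=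
    Set.EqOn.injOn_iff fun t ht => h1 t (hI t ht).2
  rw [cycleEvent, cycleEvent]
  refine filter_congr fun φ _ => ?_
  rw [h2, h3]
  refine and_congr_right fun _ => forall₂_congr fun t ht => ?_
  have := hI t ht
  rw [h1 t this.2, h1 (2 - t % 2) (by omega)]

/-- The even positions of a cycle of length `2 * k` from the fourth on. -/
def evenPos (k : ℕ) : Finset ℕ := (Ico 2 k).image fun l => 2 * l

lemma card_evenPos (k : ℕ) : (evenPos k).card = k - 2 := by
  rw [evenPos, card_image_of_injective _ fun a b h => by simpa using h, Nat.card_Ico]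

lemma mem_evenPos {k t : ℕ} : t ∈ evenPos k ↔ 3 ≤ t ∧ t < 2 * k ∧ Even t := by
  simp only [evenPos, mem_image, Finset.mem_Ico]
  constructor
  · rintro ⟨l, hl, rfl⟩
    exact ⟨by omega, by omega, by simp⟩
  · rintro ⟨h1, h2, l, rfl⟩
    exact ⟨l, by omega, by omega⟩

/-- A colour that cannot be used to extend a colouring to the edge `e` appears on an edge adjacent
to `e` or closes a two-coloured cycle. -/
lemma exists_cycle_of_not_valid {c₀ c : B} {S : Finset (Sym2 V)} {e : Sym2 V} (he : e ∉ S)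
    (heG : e ∈ G.edgeSet) {k₀ : ℕ} (hk₀ : 2 ≤ k₀) (hg : GirthGe G (2 * k₀)) {φ : Sym2 V → B}
    (hφ : φ ∈ validExt G χ c₀ S)
    (hn : ¬ PartialColouring G (comb χ (insert e S) (Function.update φ e c))) :
    (∃ f ∈ S, (∃ x, x ∈ f ∧ x ∈ e) ∧ φ f = c) ∨
    ∃ k, k₀ ≤ k ∧ k ≤ Fintype.card V ∧ ∃ v : ℕ → V, e = s(v 0, v 1) ∧ v (2 * k) = v 0 ∧
      c = φ s(v 2, v 3) ∧ (∀ t < 2 * k, Even t → s(v t, v (t + 1)) ∈ insert e S) ∧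
      ((∃ a, (∀ t < 2 * k, ¬ Even t → χ s(v t, v (t + 1)) = some a) ∧
          φ ∈ cycleEvent G χ c₀ S v (evenPos k)) ∨
        ((∀ t < 2 * k, s(v t, v (t + 1)) ∈ insert e S) ∧
          φ ∈ cycleEvent G χ c₀ S v (Ico 3 (2 * k)))) := by
  by_contra hcon
  rw [not_or] at hcon
  obtain ⟨hadj, hcyc⟩ := hcon
  push Not at hadj
  set ψ := comb χ (insert e S) (Function.update φ e c) with hψ
  obtain ⟨hφ0, hval⟩ := mem_validExt.1 hφ
  have hinr : ∀ {f b}, ψ f = some (.inr b) → (f = e ∧ b = c) ∨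
      (f ≠ e ∧ f ∈ S ∧ φ f = b ∧ comb χ S φ f = some (.inr b)) := by
    intro f b h
    obtain ⟨h1, h2⟩ := comb_eq_inr.1 h
    by_cases hfe : f = e
    · subst hfe
      exact Or.inl ⟨rfl, by simpa using h2.symm⟩
    · have h3 := (mem_insert.1 h1).resolve_left hfe
      rw [Function.update_of_ne hfe] at h2
      exact Or.inr ⟨hfe, h3, h2, comb_eq_inr.2 ⟨h3, h2⟩⟩
  have hinl : ∀ {f a}, ψ f = some (.inl a) → f ≠ e ∧ χ f = some a ∧
      comb χ S φ f = some (.inl a) := by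
    intro f a h
    obtain ⟨h1, h2⟩ := comb_eq_inl.1 h
    rw [mem_insert, not_or] at h1
    exact ⟨h1.1, h2, comb_eq_inl.2 ⟨h1.2, h2⟩⟩
  have hmem : ∀ f b, ψ f = some b → f ∈ G.edgeSet := by
    rintro f (a | b) h
    · exact hval.mem f _ (hinl h).2.2
    · rcases hinr h with h1 | h1
      · exact h1.1 ▸ heG
      · exact hval.mem f _ h1.2.2.2
  have hprop : ∀ a x y z, ψ s(x, y) = some a → ψ s(x, z) = some a → y = z := by
    rintro (a | b) x y z h1 h2
    · exact hval.proper _ x y z (hinl h1).2.2 (hinl h2).2.2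
    · rcases hinr h1 with h3 | h3 <;> rcases hinr h2 with h4 | h4
      · exact Sym2.congr_right.1 (h3.1.trans h4.1.symm)
      · exact absurd (h4.2.2.1.trans h3.2)
          (hadj _ h4.2.1 ⟨x, Sym2.mem_mk_left _ _, h3.1 ▸ Sym2.mem_mk_left _ _⟩)
      · exact absurd (h3.2.2.1.trans h4.2)
          (hadj _ h3.2.1 ⟨x, Sym2.mem_mk_left _ _, h4.1 ▸ Sym2.mem_mk_left _ _⟩)
      · exact hval.proper _ x y z h3.2.2.2 h4.2.2.2
  refine hn ⟨hmem, hprop, fun w a b hab hw => ?_⟩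
  have hw' : ∀ t, ψ s(w t, w (t + 1)) = some (if Even t then a else b) := by
    intro t
    rcases Nat.even_or_odd' t with ⟨l, rfl | rfl⟩
    · simpa using (hw l).1
    · simpa [Nat.even_add_one] using (hw l).2
  obtain ⟨t₀, ht₀⟩ : ∃ t, s(w t, w (t + 1)) = e := by
    by_contra hne
    push Not at hne
    refine hval.noAlt w a b hab fun l => ?_
    have : ∀ t b', ψ s(w t, w (t + 1)) = some b' → comb χ S φ s(w t, w (t + 1)) = some b' := by
      rintro t (a' | b') h
      · exact (hinl h).2.2
      · exact ((hinr h).resolve_left fun h1 => hne t h1.1).2.2.2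
    exact ⟨this _ _ (hw l).1, this _ _ (hw l).2⟩
  obtain ⟨v, b, hbc, hv, hve⟩ : ∃ (v : ℕ → V) (b : A ⊕ B), .inr c ≠ b ∧
      (∀ t, ψ s(v t, v (t + 1)) = some (if Even t then .inr c else b)) ∧ e = s(v 0, v 1) := by
    have hc : (if Even t₀ then a else b) = .inr c := by
      have h1 := hw' t₀
      have h2 : ψ e = some (.inr c) := comb_eq_inr.2 ⟨mem_insert_self _ _, by simp⟩
      rw [ht₀, h2] at h1
      exact (Option.some.inj h1).symm
    refine ⟨fun t => w (t₀ + t), if Even t₀ then b else a, ?_, fun t => ?_, ht₀.symm⟩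
    · rw [← hc]
      split_ifs
      · exact hab
      · exact hab.symm
    · have := hw' (t₀ + t)
      rw [← hc]
      refine this.trans ?_
      congr 1
      by_cases h1 : Even t₀ <;> by_cases h2 : Even t <;> simp [Nat.even_add, h1, h2]
  obtain ⟨k, hk, hvk, hinj⟩ := exists_period hprop (fun x => by
    rw [Option.eq_none_iff_forall_ne_some]
    intro b' hb'
    exact G.loopless.irrefl x (hmem _ _ hb')) hv
  have hGadj : ∀ t, G.Adj (v t) (v (t + 1)) := fun t => hmem _ _ (hv t)
  have hkk : k₀ ≤ k := by
    by_contra hlt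
    refine hg.seq_ne v (2 * k) (fun t _ => hGadj t) (fun t _ hback => ?_) (i := 0) (k := 2 * k)
      (by omega) (by omega) (by omega) (by rw [zero_add, hvk])
    have h1 := hv t
    have h2 := hv (t + 1)
    rw [show t + 1 + 1 = t + 2 by omega, hback, Sym2.eq_swap, h1] at h2
    by_cases ht : Even t
    · simp [ht, Nat.even_add_one, hbc] at h2
    · simp [ht, Nat.even_add_one, Ne.symm hbc] at h2
  have hne : ∀ {i j}, i < j → j < 2 * k → s(v i, v (i + 1)) ≠ s(v j, v (j + 1)) :=
    fun hij hj => edge_ne_of_injOn (by omega) hvk hinj hij hj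
  have hinjE : Set.InjOn (fun t => s(v t, v (t + 1))) (Set.Iio (2 * k)) := by
    intro i hi j hj hij
    rcases lt_trichotomy i j with hlt | rfl | hlt
    · exact absurd hij (hne hlt hj)
    · rfl
    · exact absurd hij.symm (hne hlt hi)
  have hev : ∀ t < 2 * k, Even t → ψ s(v t, v (t + 1)) = some (.inr c) := fun t _ h => by
    rw [hv t, if_pos h]
  have hodd : ∀ t < 2 * k, ¬ Even t → ψ s(v t, v (t + 1)) = some b := fun t _ h => by
    rw [hv t, if_neg h]
  have hnee : ∀ t < 2 * k, t ≠ 0 → s(v t, v (t + 1)) ≠ e := fun t ht h0 => by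
    rw [hve]
    exact (hne (Nat.pos_of_ne_zero h0) ht).symm
  have hS : ∀ t < 2 * k, t ≠ 0 → ∀ b', ψ s(v t, v (t + 1)) = some (.inr b') →
      s(v t, v (t + 1)) ∈ S ∧ φ s(v t, v (t + 1)) = b' := fun t ht h0 b' h => by
    have := (hinr h).resolve_left fun h1 => hnee t ht h0 h1.1
    exact ⟨this.2.1, this.2.2.1⟩
  have hins : ∀ t < 2 * k, ∀ b', ψ s(v t, v (t + 1)) = some (.inr b') →
      s(v t, v (t + 1)) ∈ insert e S := fun t _ b' h => (comb_eq_inr.1 h).1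
  have hmod : ∀ t, Even t → 2 - t % 2 = 2 := fun t ht => by
    have := Nat.even_iff.1 ht
    omega
  have hmod' : ∀ t, ¬ Even t → 2 - t % 2 = 1 := fun t ht => by
    have := Nat.not_even_iff.1 ht
    omega
  have hnotI : ∀ (I : Finset ℕ), (∀ t ∈ I, 3 ≤ t ∧ t < 2 * k) → ∀ i < 3,
      s(v i, v (i + 1)) ∉ I.image fun t => s(v t, v (t + 1)) := by
    intro I hI i hi hmem
    obtain ⟨t, ht, h⟩ := mem_image.1 hmem
    have := hI t ht
    exact hne (by omega : i < t) this.2 h.symm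
  refine hcyc ⟨k, hkk, ?_, v, hve, hvk, (hS 2 (by omega) (by omega) c (hev 2 (by omega) even_two)).2.symm,
    fun t ht h => hins t ht c (hev t ht h), ?_⟩
  · have h1 : (Finset.range (2 * k)).card ≤ (univ : Finset V).card :=
      card_le_card_of_injOn v (fun _ _ => mem_coe.2 (mem_univ _)) fun i hi j hj h =>
        hinj (by simpa using hi) (by simpa using hj) h
    rw [card_range] at h1
    exact le_trans (by omega) h1
  rcases b with a' | b'
  · refine Or.inl ⟨a', fun t ht h => (hinl (hodd t ht h)).2.1, mem_filter.2 ⟨hφ, ?_, ?_⟩⟩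
    · exact hinjE.mono fun t ht => (mem_evenPos.1 (mem_coe.1 ht)).2.1
    · intro t ht
      obtain ⟨h1, h2, h3⟩ := mem_evenPos.1 ht
      have h4 := hS t h2 (by omega) c (hev t h2 h3)
      have h5 := hS 2 (by omega) (by omega) c (hev 2 (by omega) even_two)
      rw [hmod t h3]
      exact ⟨h4.1, mem_sdiff.2 ⟨h5.1, hnotI _ (fun t ht => by
        have := mem_evenPos.1 ht
        exact ⟨this.1, this.2.1⟩) 2 (by omega)⟩, h4.2.trans h5.2.symm⟩
  · refine Or.inr ⟨fun t ht => ?_, mem_filter.2 ⟨hφ, ?_, ?_⟩⟩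
    · by_cases h : Even t
      · exact hins t ht c (hev t ht h)
      · exact hins t ht b' (hodd t ht h)
    · exact hinjE.mono fun t ht => (Finset.mem_Ico.1 (mem_coe.1 ht)).2
    · intro t ht
      obtain ⟨h1, h2⟩ := Finset.mem_Ico.1 ht
      have hI : ∀ t ∈ Ico 3 (2 * k), 3 ≤ t ∧ t < 2 * k := fun t ht => Finset.mem_Ico.1 ht
      by_cases h : Even t
      · have h4 := hS t h2 (by omega) c (hev t h2 h)
        have h5 := hS 2 (by omega) (by omega) c (hev 2 (by omega) even_two)
        rw [hmod t h]
        exact ⟨h4.1, mem_sdiff.2 ⟨h5.1, hnotI _ hI 2 (by omega)⟩, h4.2.trans h5.2.symm⟩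
      · have h4 := hS t h2 (by omega) b' (hodd t h2 h)
        have h5 := hS 1 (by omega) (by omega) b' (hodd 1 (by omega) (by simp))
        rw [hmod' t h]
        exact ⟨h4.1, mem_sdiff.2 ⟨h5.1, hnotI _ hI 1 (by omega)⟩, h4.2.trans h5.2.symm⟩

end Completion
end AEC

namespace AEC
open scoped Classical
open Finset SimpleGraph

section Completion
variable {V A B : Type*} [Fintype V] [Fintype A] [Fintype B] {G H : SimpleGraph V}
  {χ : Sym2 V → Option A} {d : ℕ}

/-- Decode a closed sequence that alternates between free steps and edges of colour `a`. -/
noncomputable def altCycle (χ : Sym2 V → Option A) (nb : V → Fin d → V) (hd : 0 < d) (k : ℕ) (x y : V)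
    (i : A × (Fin (k - 2) → Fin d)) (t : ℕ) : V :=
  if t ≤ 2 * k - 2 then decode (mate fun x y => χ s(x, y) = some i.1) nb x y (extend hd i.2) t
  else if t = 2 * k - 1 then mate (fun x y => χ s(x, y) = some i.1) x else x

/-- Decode a closed sequence of free steps. -/
def freeCycle (nb : V → Fin d → V) (hd : 0 < d) (k : ℕ) (x y : V)
    (i : Fin (2 * k - 2) → Fin d) (t : ℕ) : V :=
  if t = 0 ∨ t = 2 * k then x else stroll nb y (extend hd i) (t - 1)

omit [Fintype V] [Fintype A] in
lemma exists_altCycle (hχ : PartialColouring G χ) {nb : V → Fin d → V}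
    (hnb : ∀ x y, H.Adj x y → ∃ i, nb x i = y) (hd : 0 < d) {k : ℕ} (hk : 2 ≤ k) {v : ℕ → V}
    (hv : v (2 * k) = v 0) (h : ∀ t < 2 * k, Even t → H.Adj (v t) (v (t + 1))) {a : A}
    (h' : ∀ t < 2 * k, ¬ Even t → χ s(v t, v (t + 1)) = some a) :
    ∃ i, ∀ t ≤ 2 * k, altCycle χ nb hd k (v 0) (v 1) (a, i) t = v t := by
  obtain ⟨i, hi⟩ := exists_extend hd (k - 2) (fun l i => nb (v (2 * l + 2)) i = v (2 * l + 3))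
    fun l hl => hnb _ _ (h (2 * l + 2) (by omega) (by simp [Nat.even_add]))
  have hmate : ∀ x y, χ s(x, y) = some a → mate (fun x y => χ s(x, y) = some a) x = y :=
    fun x y hxy => mate_eq (fun x y z => hχ.proper a x y z) hxy
  have hdec := decode_eq (mt := mate fun x y => χ s(x, y) = some a) (nb := nb) (i := extend hd i)
    (v := v) (T := 2 * k - 2) (by
      intro t ht
      split_ifs with hev
      · exact (hmate _ _ (h' (t + 1) (by omega) (by simpa [Nat.even_add_one] using hev))).symm
      · obtain ⟨l, rfl⟩ := Nat.not_even_iff_odd.1 hev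
        have := hi l (by omega)
        rw [show (2 * l + 1) / 2 = l by omega]
        exact this.symm)
  refine ⟨i, fun t ht => ?_⟩
  rw [altCycle]
  split_ifs with h1 h2
  · exact hdec t h1
  · refine hmate _ _ ?_
    have := h' (2 * k - 1) (by omega) (by
      rw [Nat.not_even_iff_odd]
      exact ⟨k - 1, by omega⟩)
    rwa [show 2 * k - 1 + 1 = 2 * k by omega, hv, ← h2, Sym2.eq_swap] at this
  · rw [← hv, show t = 2 * k by omega]

omit [Fintype V] in
lemma exists_freeCycle {nb : V → Fin d → V} (hnb : ∀ x y, H.Adj x y → ∃ i, nb x i = y) (hd : 0 < d)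
    {k : ℕ} {v : ℕ → V} (hv : v (2 * k) = v 0) (h : ∀ t < 2 * k, H.Adj (v t) (v (t + 1))) :
    ∃ i, ∀ t ≤ 2 * k, freeCycle nb hd k (v 0) (v 1) i t = v t := by
  obtain ⟨i, hi⟩ := exists_extend hd (2 * k - 2) (fun l i => nb (v (l + 1)) i = v (l + 2))
    fun l hl => hnb _ _ (h (l + 1) (by omega))
  have hst := stroll_eq (nb := nb) (i := extend hd i) (v := fun t => v (t + 1)) (T := 2 * k - 2)
    fun t ht => (hi t ht).symm
  refine ⟨i, fun t ht => ?_⟩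
  rw [freeCycle]
  split_ifs with h1
  · rcases h1 with rfl | rfl
    · rfl
    · exact hv.symm
  · have := hst (t - 1) (by omega)
    simpa [show t - 1 + 1 = t by omega] using this

/-- The pairs of a colouring of `S` and a colour for `e` that repeats along a coded cycle. -/
noncomputable def cyclePairs (G : SimpleGraph V) (χ : Sym2 V → Option A) (c₀ : B)
    (S : Finset (Sym2 V)) (I : Finset ℕ) {κ : Type*} [Fintype κ] (u : κ → ℕ → V) :
    Finset ((Sym2 V → B) × B) :=
  univ.biUnion fun i => (cycleEvent G χ c₀ S (u i) I).image fun φ => (φ, φ s(u i 2, u i 3))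

omit [Fintype A] in
lemma card_cyclePairs_le {c₀ : B} {S : Finset (Sym2 V)} (hS : ∀ e ∈ S, χ e = none)
    {L : ℕ} (hL0 : 0 < L) (hL : ∀ S' e, e ∉ S' → insert e S' ⊆ S →
      L * (validExt G χ c₀ S').card ≤ (validExt G χ c₀ (insert e S')).card)
    (I : Finset ℕ) {κ : Type*} [Fintype κ] (u : κ → ℕ → V) :
    ((cyclePairs G χ c₀ S I u).card : ℝ) ≤
      Fintype.card κ * ((validExt G χ c₀ S).card / (L : ℝ) ^ I.card) := by
  have h1 : (cyclePairs G χ c₀ S I u).card ≤ ∑ i, (cycleEvent G χ c₀ S (u i) I).card :=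
    card_biUnion_le.trans (sum_le_sum fun i _ => card_image_le)
  have h2 : ((cyclePairs G χ c₀ S I u).card : ℝ) ≤
      ∑ i, ((cycleEvent G χ c₀ S (u i) I).card : ℝ) := by exact_mod_cast h1
  refine h2.trans ((sum_le_card_nsmul univ _ ((validExt G χ c₀ S).card / (L : ℝ) ^ I.card)
    fun i _ => ?_).trans (le_of_eq ?_))
  · rw [le_div_iff₀ (by positivity)]
    exact_mod_cast card_cycleEvent_le hS hL (u i) I
  · rw [nsmul_eq_mul, card_univ]

omit [Fintype A] in
lemma card_mul_le_of_cover {c₀ : B} {S : Finset (Sym2 V)} {e : Sym2 V} (he : e ∉ S)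
    {Q : Finset ((Sym2 V → B) × B)}
    (hQ : ∀ φ c, φ ∈ validExt G χ c₀ S →
      ¬ PartialColouring G (comb χ (insert e S) (Function.update φ e c)) → (φ, c) ∈ Q) :
    (validExt G χ c₀ S).card * Fintype.card B ≤ (validExt G χ c₀ (insert e S)).card + Q.card := by
  have h1 : validExt G χ c₀ S ×ˢ (univ : Finset B) ⊆ ((validExt G χ c₀ S ×ˢ univ).filter fun q =>
      PartialColouring G (comb χ (insert e S) (Function.update q.1 e q.2))) ∪ Q := by
    rintro ⟨φ, c⟩ h
    rw [mem_union, mem_filter]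
    by_cases hv : PartialColouring G (comb χ (insert e S) (Function.update φ e c))
    · exact Or.inl ⟨h, hv⟩
    · exact Or.inr (hQ φ c (mem_product.1 h).1 hv)
  have h2 : ((validExt G χ c₀ S ×ˢ (univ : Finset B)).filter fun q =>
      PartialColouring G (comb χ (insert e S) (Function.update q.1 e q.2))).card ≤
      (validExt G χ c₀ (insert e S)).card := by
    refine card_le_card_of_injOn (fun q => Function.update q.1 e q.2) (fun q hq => ?_)
      fun q hq q' hq' heq => ?_
    · obtain ⟨hq1, hq2⟩ := mem_filter.1 (mem_coe.1 hq)
      refine mem_coe.2 (mem_validExt.2 ⟨fun f hf => ?_, hq2⟩)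
      rw [mem_insert, not_or] at hf
      change Function.update q.1 e q.2 f = c₀
      rw [Function.update_of_ne hf.1]
      exact (mem_validExt.1 (mem_product.1 hq1).1).1 f hf.2
    · have h3 := mem_validExt.1 (mem_product.1 (mem_filter.1 (mem_coe.1 hq)).1).1
      have h3' := mem_validExt.1 (mem_product.1 (mem_filter.1 (mem_coe.1 hq')).1).1
      refine Prod.ext (funext fun f => ?_) ?_
      · by_cases hf : f = e
        · rw [hf, h3.1 e he, h3'.1 e he]
        · have := congrFun heq f
          simpa [Function.update_of_ne hf] using this
      · have := congrFun heq e
        simpa using this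
  have := (card_le_card h1).trans ((card_union_le _ _).trans (Nat.add_le_add_right h2 _))
  rwa [card_product, card_univ] at this

lemma sum_half_pow_le {k₀ : ℕ} (hk₀ : 2 ≤ k₀) (M : ℕ) :
    ∑ k ∈ Ico k₀ M, (1 / 2 : ℝ) ^ (k - 2) ≤ 8 / 2 ^ k₀ := by
  have h1 : ∑ k ∈ Ico k₀ M, (1 / 2 : ℝ) ^ (k - 2) = 4 * ∑ k ∈ Ico k₀ M, (1 / 2 : ℝ) ^ k := by
    rw [mul_sum]
    refine sum_congr rfl fun k hk => ?_
    obtain ⟨j, rfl⟩ : ∃ j, k = j + 2 := ⟨k - 2, by have := (Finset.mem_Ico.1 hk).1; omega⟩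
    rw [Nat.add_sub_cancel, pow_add]
    ring
  rw [h1]
  have := geom_sum_Ico_le_of_lt_one (x := (1 / 2 : ℝ)) (m := k₀) (n := M) (by norm_num) (by norm_num)
  calc 4 * ∑ k ∈ Ico k₀ M, (1 / 2 : ℝ) ^ k ≤ 4 * ((1 / 2) ^ k₀ / (1 - 1 / 2)) := by gcongr
    _ = 8 / 2 ^ k₀ := by rw [one_div, inv_pow]; field_simp; norm_num

end Completion
end AEC

namespace AEC
open scoped Classical
open Finset SimpleGraph

section Growth
variable {V A B : Type*} [Fintype V] [Fintype A] [Fintype B] {G : SimpleGraph V}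
  {χ : Sym2 V → Option A} {d : ℕ}

/-- The conflicting pairs caused by an edge of `S` adjacent to `e`. -/
noncomputable def adjPairs (G : SimpleGraph V) (χ : Sym2 V → Option A) (c₀ : B)
    (S : Finset (Sym2 V)) (e : Sym2 V) : Finset ((Sym2 V → B) × B) :=
  (S.filter fun f => ∃ x, x ∈ f ∧ x ∈ e).biUnion fun f =>
    (validExt G χ c₀ S).image fun φ => (φ, φ f)

omit [Fintype A] in
lemma card_adjPairs_le {c₀ : B} {S : Finset (Sym2 V)} {H : SimpleGraph V}
    (hS : ∀ f ∈ S, f ∈ H.edgeSet) (hH : ∀ v, (inc H v).card ≤ d) (e : Sym2 V) :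
    (adjPairs G χ c₀ S e).card ≤ 2 * d * (validExt G χ c₀ S).card := by
  have h1 : (S.filter fun f => ∃ x, x ∈ f ∧ x ∈ e).card ≤ 2 * d := by
    induction e with | _ x y =>
    have h2 : (S.filter fun f => ∃ z, z ∈ f ∧ z ∈ s(x, y)) ⊆ inc H x ∪ inc H y := by
      intro f hf
      obtain ⟨hfS, z, hzf, hz⟩ := mem_filter.1 hf
      rw [mem_union, mem_inc, mem_inc]
      rcases Sym2.mem_iff.1 hz with rfl | rfl
      · exact Or.inl ⟨hS f hfS, hzf⟩
      · exact Or.inr ⟨hS f hfS, hzf⟩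
    have := (card_le_card h2).trans (card_union_le _ _)
    have := hH x
    have := hH y
    omega
  calc _ ≤ ∑ f ∈ S.filter fun f => ∃ x, x ∈ f ∧ x ∈ e,
        ((validExt G χ c₀ S).image fun φ => (φ, φ f)).card := card_biUnion_le
    _ ≤ ∑ f ∈ S.filter fun f => ∃ x, x ∈ f ∧ x ∈ e, (validExt G χ c₀ S).card :=
        sum_le_sum fun f _ => card_image_le
    _ ≤ _ := by
        rw [sum_const, smul_eq_mul]
        exact Nat.mul_le_mul_right _ h1

omit [Fintype V] [Fintype B] in
lemma card_biUnion_pairs_le {X : Type*} [DecidableEq X] {k₀ : ℕ} (hk₀ : 2 ≤ k₀)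
    (hA : 8 * ((Fintype.card A : ℝ) + d) ≤ d * 2 ^ k₀) (M : ℕ) (Q₁ Q₂ : ℕ → Finset X) (N : ℕ)
    (hQ₁ : ∀ k, ((Q₁ k).card : ℝ) ≤ 2 * Fintype.card A * N * (1 / 2) ^ (k - 2))
    (hQ₂ : ∀ k, 2 ≤ k → ((Q₂ k).card : ℝ) ≤ 2 * d * N * (1 / 2) ^ (k - 2)) :
    ((Ico k₀ M).biUnion fun k => Q₁ k ∪ Q₂ k).card ≤ 2 * d * N := by
  have h1 : (((Ico k₀ M).biUnion fun k => Q₁ k ∪ Q₂ k).card : ℝ) ≤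
      ∑ k ∈ Ico k₀ M, (((Q₁ k).card : ℝ) + (Q₂ k).card) := by
    exact_mod_cast card_biUnion_le.trans (sum_le_sum fun k _ => card_union_le _ _)
  have h2 : ∑ k ∈ Ico k₀ M, (((Q₁ k).card : ℝ) + (Q₂ k).card) ≤
      ∑ k ∈ Ico k₀ M, 2 * (Fintype.card A + d) * N * (1 / 2 : ℝ) ^ (k - 2) := by
    refine sum_le_sum fun k hk => ?_
    have h3 := hQ₁ k
    have h4 := hQ₂ k (hk₀.trans (Finset.mem_Ico.1 hk).1)
    calc _ ≤ _ := add_le_add h3 h4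
      _ = _ := by ring
  have h5 : ((8 : ℝ) * ((Fintype.card A : ℝ) + d)) / 2 ^ k₀ ≤ d := by
    rw [div_le_iff₀ (by positivity)]
    exact hA
  have h6 : (((Ico k₀ M).biUnion fun k => Q₁ k ∪ Q₂ k).card : ℝ) ≤ 2 * d * N := by
    calc _ ≤ _ := h1.trans h2
      _ = 2 * (Fintype.card A + d) * N * ∑ k ∈ Ico k₀ M, (1 / 2 : ℝ) ^ (k - 2) := by rw [mul_sum]
      _ ≤ 2 * (Fintype.card A + d) * N * (8 / 2 ^ k₀) := by
          gcongr
          exact sum_half_pow_le hk₀ _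
      _ = 2 * N * ((8 * ((Fintype.card A : ℝ) + d)) / 2 ^ k₀) := by ring
      _ ≤ 2 * N * d := by gcongr
      _ = _ := by ring
  exact_mod_cast h6

set_option maxHeartbeats 400000 in
/-- Adding one edge to the coloured set multiplies the number of colourings by at least `2 * d`. -/
lemma card_validExt_insert (hχ : PartialColouring G χ) {k₀ : ℕ} (hd : 0 < d) (hk₀ : 2 ≤ k₀)
    (hA : 8 * ((Fintype.card A : ℝ) + d) ≤ d * 2 ^ k₀) (hg : GirthGe G (2 * k₀))
    (hdeg : ∀ v, (inc (edgeSub G fun e => χ e = none) v).card ≤ d) (hB : 6 * d ≤ Fintype.card B)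
    (c₀ : B) (S : Finset (Sym2 V)) :
    ∀ e, e ∉ S → (∀ f ∈ insert e S, f ∈ (edgeSub G fun e => χ e = none).edgeSet) →
      2 * d * (validExt G χ c₀ S).card ≤ (validExt G χ c₀ (insert e S)).card := by
  induction S using Finset.strongInduction with | _ S ih =>
  intro e he hin
  set H := edgeSub G fun e => χ e = none with hH
  have hSH : ∀ f ∈ S, f ∈ H.edgeSet := fun f hf => hin f (mem_insert_of_mem hf)
  have hS : ∀ f ∈ S, χ f = none := fun f hf => (mem_edgeSub.1 (hSH f hf)).2
  have hL : ∀ S' e, e ∉ S' → insert e S' ⊆ S →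
      2 * d * (validExt G χ c₀ S').card ≤ (validExt G χ c₀ (insert e S')).card :=
    fun S' e' he' hsub => ih S' ((ssubset_insert he').trans_subset hsub) e' he'
      fun f hf => hSH f (hsub hf)
  obtain ⟨nb, hnb⟩ := exists_neighbour_enum H (d := d) fun x => by
    have := hdeg x
    rwa [card_inc] at this
  obtain ⟨x, y, rfl⟩ : ∃ x y, e = s(x, y) := by
    induction e with | _ x y => exact ⟨x, y, rfl⟩
  have heG : s(x, y) ∈ G.edgeSet := (mem_edgeSub.1 (hin _ (mem_insert_self _ _))).1
  obtain ⟨N, hN⟩ : ∃ N, (validExt G χ c₀ S).card = N := ⟨_, rfl⟩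
  let Q₁ : ℕ → Finset ((Sym2 V → B) × B) := fun k => cyclePairs G χ c₀ S (evenPos k)
    fun i : Bool × A × (Fin (k - 2) → Fin d) =>
      altCycle χ nb hd k (cond i.1 x y) (cond i.1 y x) i.2
  let Q₂ : ℕ → Finset ((Sym2 V → B) × B) := fun k => cyclePairs G χ c₀ S (Ico 3 (2 * k))
    fun i : Bool × (Fin (2 * k - 2) → Fin d) =>
      freeCycle nb hd k (cond i.1 x y) (cond i.1 y x) i.2
  have hdR : (0 : ℝ) < d := by exact_mod_cast hd
  have hQ₁ : ∀ k, ((Q₁ k).card : ℝ) ≤ 2 * Fintype.card A * N * (1 / 2) ^ (k - 2) := by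
    intro k
    refine (card_cyclePairs_le hS (L := 2 * d) (by omega) hL _ _).trans (le_of_eq ?_)
    simp only [hN, Fintype.card_prod, Fintype.card_bool, Fintype.card_fun, Fintype.card_fin,
      card_evenPos, Nat.cast_mul, Nat.cast_pow, Nat.cast_ofNat, mul_pow, one_div, inv_pow]
    field_simp
  have hQ₂ : ∀ k, 2 ≤ k → ((Q₂ k).card : ℝ) ≤ 2 * d * N * (1 / 2) ^ (k - 2) := by
    intro k hk
    refine (card_cyclePairs_le hS (L := 2 * d) (by omega) hL _ _).trans ?_
    have h1 : ((Fintype.card (Bool × (Fin (2 * k - 2) → Fin d)) : ℕ) : ℝ) *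
        (N / ((2 * d : ℕ) : ℝ) ^ (Ico 3 (2 * k)).card) = 2 * d * N * (1 / 2) ^ (2 * k - 3) := by
      simp only [Fintype.card_prod, Fintype.card_bool, Fintype.card_fun, Fintype.card_fin,
        Nat.card_Ico, Nat.cast_mul, Nat.cast_pow, Nat.cast_ofNat, mul_pow, one_div, inv_pow]
      rw [show 2 * k - 2 = 2 * k - 3 + 1 by omega, pow_succ]
      field_simp
    rw [hN, h1]
    have : (1 / 2 : ℝ) ^ (2 * k - 3) ≤ (1 / 2) ^ (k - 2) :=
      pow_le_pow_of_le_one (by norm_num) (by norm_num) (by omega)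
    gcongr
  have hcov := card_mul_le_of_cover (G := G) (χ := χ) (c₀ := c₀) he
    (Q := adjPairs G χ c₀ S s(x, y) ∪ (Ico k₀ (Fintype.card V + 1)).biUnion fun k => Q₁ k ∪ Q₂ k) (by
      intro φ c hφ hn
      rw [mem_union]
      rcases exists_cycle_of_not_valid he heG hk₀ hg hφ hn with
        ⟨f, hf, hadj, hc⟩ | ⟨k, hk, hkV, v, hev, hv, hc, hev', hcase⟩
      · refine Or.inl (mem_biUnion.2 ⟨f, mem_filter.2 ⟨hf, hadj⟩, mem_image.2 ⟨φ, hφ, ?_⟩⟩)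
        rw [hc]
      · refine Or.inr (mem_biUnion.2 ⟨k, Finset.mem_Ico.2 ⟨hk, by omega⟩, ?_⟩)
        obtain ⟨β, hβ0, hβ1⟩ : ∃ β : Bool, cond β x y = v 0 ∧ cond β y x = v 1 := by
          rcases Sym2.eq_iff.1 hev with ⟨h0, h1⟩ | ⟨h0, h1⟩
          · exact ⟨true, h0, h1⟩
          · exact ⟨false, h1, h0⟩
        rw [mem_union]
        rcases hcase with ⟨a, ha, hE⟩ | ⟨hfree, hE⟩
        · obtain ⟨i, hi⟩ := exists_altCycle (H := H) hχ hnb hd (hk₀.trans hk) hv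
            (fun t ht hev => hin _ (hev' t ht hev)) ha
          refine Or.inl (mem_biUnion.2 ⟨(β, a, i), mem_univ _, mem_image.2 ⟨φ, ?_, ?_⟩⟩)
          · simp only [hβ0, hβ1]
            rw [cycleEvent_congr hi fun t ht => ?_]
            · exact hE
            · have := mem_evenPos.1 ht
              omega
          · simp only [hβ0, hβ1]
            rw [hi 2 (by omega), hi 3 (by omega), hc]
        · obtain ⟨i, hi⟩ := exists_freeCycle (H := H) hnb hd hv fun t ht => hin _ (hfree t ht)
          refine Or.inr (mem_biUnion.2 ⟨(β, i), mem_univ _, mem_image.2 ⟨φ, ?_, ?_⟩⟩)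
          · simp only [hβ0, hβ1]
            rw [cycleEvent_congr hi fun t ht => ?_]
            · exact hE
            · exact Finset.mem_Ico.1 ht
          · simp only [hβ0, hβ1]
            rw [hi 2 (by omega), hi 3 (by omega), hc])
  have hadj : (adjPairs G χ c₀ S s(x, y)).card ≤ 2 * d * N :=
    hN ▸ card_adjPairs_le hSH hdeg s(x, y)
  have hcyc := card_biUnion_pairs_le hk₀ hA (Fintype.card V + 1) Q₁ Q₂ N hQ₁ hQ₂
  rw [hN] at hcov ⊢
  have h1 : N * (6 * d) ≤ N * Fintype.card B := Nat.mul_le_mul_left _ hB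
  have h2 := h1.trans (hcov.trans (Nat.add_le_add_left
    ((card_union_le _ _).trans (Nat.add_le_add hadj hcyc)) _))
  have h3 : N * (6 * d) = 2 * d * N + (2 * d * N + 2 * d * N) := by ring
  rw [h3] at h2
  exact Nat.le_of_add_le_add_right h2

/-- A partial colouring extends to all edges using six new colours per uncoloured degree. -/
lemma exists_total (hχ : PartialColouring G χ) {k₀ : ℕ} (hd : 0 < d) (hk₀ : 2 ≤ k₀)
    (hA : 8 * ((Fintype.card A : ℝ) + d) ≤ d * 2 ^ k₀) (hg : GirthGe G (2 * k₀))
    (hdeg : ∀ v, (inc (edgeSub G fun e => χ e = none) v).card ≤ d) :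
    ∃ ψ : Sym2 V → Option (A ⊕ Fin (6 * d)), PartialColouring G ψ ∧
      ∀ e ∈ G.edgeSet, ψ e ≠ none := by
  let c₀ : Fin (6 * d) := ⟨0, by omega⟩
  have hpos : ∀ S : Finset (Sym2 V),
      (∀ f ∈ S, f ∈ (edgeSub G fun e => χ e = none).edgeSet) → 0 < (validExt G χ c₀ S).card := by
    intro S
    induction S using Finset.induction_on with
    | empty =>
      intro _
      refine card_pos.2 ⟨fun _ => c₀, mem_validExt.2 ⟨fun _ _ => rfl, ?_, ?_, ?_⟩⟩
      · rintro e (a | c) h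
        · exact hχ.mem e a (comb_eq_inl.1 h).2
        · exact absurd (comb_eq_inr.1 h).1 (by simp)
      · rintro (a | c) x y z h h'
        · exact hχ.proper a x y z (comb_eq_inl.1 h).2 (comb_eq_inl.1 h').2
        · exact absurd (comb_eq_inr.1 h).1 (by simp)
      · rintro v (a | c) (b | c') hab h
        · exact hχ.noAlt v a b (by simpa using hab) fun l =>
            ⟨(comb_eq_inl.1 (h l).1).2, (comb_eq_inl.1 (h l).2).2⟩
        · exact absurd (comb_eq_inr.1 (h 0).2).1 (by simp)
        all_goals exact absurd (comb_eq_inr.1 (h 0).1).1 (by simp)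
    | insert e S he ih =>
      intro hS
      have h1 := ih fun f hf => hS f (mem_insert_of_mem hf)
      exact (Nat.mul_pos (by omega) h1).trans_le (card_validExt_insert hχ hd hk₀ hA hg hdeg
        (by simp) c₀ S e he hS)
  obtain ⟨φ, hφ⟩ := card_pos.1 (hpos
    (univ.filter fun e => e ∈ (edgeSub G fun e => χ e = none).edgeSet) (by simp))
  refine ⟨_, (mem_validExt.1 hφ).2, fun e he hnone => ?_⟩
  by_cases h : e ∈ univ.filter fun e => e ∈ (edgeSub G fun e => χ e = none).edgeSet
  · rw [comb, if_pos h] at hnone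
    exact absurd hnone (by simp)
  · rw [comb, if_neg h, Option.map_eq_none_iff] at hnone
    exact h (mem_filter.2 ⟨mem_univ _, mem_edgeSub.2 ⟨he, hnone⟩⟩)

end Growth
end AEC

namespace AEC
open scoped Classical
open Finset SimpleGraph

/-- Iterating the degree reduction `T` times. -/
lemma exists_iterate_reduce_degree {ε K : ℝ} (hε : 0 < ε) (hε1 : ε ≤ 1 / 2)
    (hK : K * (1 - ε) = 1 + 2 * ε) (T : ℕ) :
    ∀ ρ : ℝ, 0 ≤ ρ → ∃ g d₀ : ℕ, ∀ (V A : Type) [Fintype V] [Fintype A] (G : SimpleGraph V)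
      (χ : Sym2 V → Option A) (d : ℕ), PartialColouring G χ → GirthGe G g → d₀ ≤ d →
      (Fintype.card A : ℝ) ≤ ρ * d →
      (∀ v, (inc (edgeSub G fun e => χ e = none) v).card ≤ d) →
      ∃ (A' : Type) (_ : Fintype A') (χ' : Sym2 V → Option A'), PartialColouring G χ' ∧
        (Fintype.card A' : ℝ) ≤ Fintype.card A + K * (1 - (1 - ε + ε ^ 2) ^ T) * d ∧
        ∀ v, ((inc (edgeSub G fun e => χ' e = none) v).card : ℝ) ≤ (1 - ε + ε ^ 2) ^ T * d := by
  have hr : (3 / 4 : ℝ) ≤ 1 - ε + ε ^ 2 := by nlinarith [sq_nonneg (ε - 1 / 2)]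
  have hr1 : 1 - ε + ε ^ 2 ≤ 1 := by nlinarith
  have hK0 : 0 ≤ K := by
    by_contra! h
    nlinarith
  have hKr : ε * (1 + 2 * ε) = K * (1 - (1 - ε + ε ^ 2)) := by
    rw [← hK]
    ring
  have hεε : ε * (1 + 2 * ε) ≤ 1 := by nlinarith
  have hstage := fun (ρ : ℝ) (hρ : 0 ≤ ρ) => exists_reduce_degree hε hε1 hρ
  obtain ⟨r, hrε⟩ : ∃ r, 1 - ε + ε ^ 2 = r := ⟨_, rfl⟩
  simp only [hrε] at hr hr1 hKr ⊢
  induction T with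
  | zero =>
    intro ρ _
    refine ⟨0, 0, fun V A _ _ G χ d hχ _ _ _ hd => ⟨A, inferInstance, χ, hχ, by simp, fun v => ?_⟩⟩
    rw [pow_zero, one_mul]
    exact_mod_cast hd v
  | succ T ih =>
    intro ρ hρ
    obtain ⟨g₁, d₁, h₁⟩ := exists_reduce_degree hε hε1 hρ
    obtain ⟨g₂, d₂, h₂⟩ := ih (2 * ρ + 2) (by positivity)
    refine ⟨max g₁ g₂, max d₁ (max (2 * d₂) 4), fun V A _ _ G χ d hχ hg hd hA hdeg => ?_⟩
    have hd₁ : d₁ ≤ d := (le_max_left _ _).trans hd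
    have hd₂ : 2 * d₂ ≤ d := (le_max_left _ _).trans ((le_max_right _ _).trans hd)
    have hd₄ : (4 : ℝ) ≤ d := by
      exact_mod_cast (le_max_right _ _).trans ((le_max_right _ _).trans hd)
    obtain ⟨A₁, _, χ₁, hχ₁, hA₁, hdeg₁⟩ := h₁ V A G χ d hχ
      (fun v w hw => (le_max_left _ _).trans (hg v w hw)) hd₁ hA hdeg
    have hlt := Nat.lt_floor_add_one (r * d)
    have hle : ((⌊r * (d : ℝ)⌋₊ : ℕ) : ℝ) ≤ r * d := Nat.floor_le (by positivity)
    have hrd : 3 / 4 * (d : ℝ) ≤ r * d := by gcongr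
    have hhalf : (d : ℝ) ≤ 2 * (⌊r * (d : ℝ)⌋₊ : ℕ) := by linarith
    have hε' : ε * (1 + 2 * ε) * d ≤ 1 * d := by gcongr
    have hρ' : ρ * d ≤ ρ * (2 * (⌊r * (d : ℝ)⌋₊ : ℕ)) := by gcongr
    obtain ⟨A', hfA, χ', hχ', hA', hdeg'⟩ := h₂ V A₁ G χ₁ ⌊r * (d : ℝ)⌋₊ hχ₁
      (fun v w hw => (le_max_right _ _).trans (hg v w hw))
      (by
        have : d ≤ 2 * ⌊r * (d : ℝ)⌋₊ := by exact_mod_cast hhalf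
        omega)
      (by linarith) fun v => Nat.le_floor (by
        rw [← hrε]
        exact hdeg₁ v)
    have hr0 : 0 ≤ r := by linarith
    have hrT : r ^ T ≤ 1 := pow_le_one₀ hr0 hr1
    refine ⟨A', hfA, χ', hχ', ?_, fun v => (hdeg' v).trans ?_⟩
    · have h3 : K * (1 - r ^ T) * (⌊r * (d : ℝ)⌋₊ : ℕ) ≤ K * (1 - r ^ T) * (r * d) :=
        mul_le_mul_of_nonneg_left hle (mul_nonneg hK0 (by linarith))
      have h4 : K * (1 - r ^ (T + 1)) * d =
          K * (1 - r) * d + K * (1 - r ^ T) * (r * d) := by ring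
      rw [hKr] at hA₁
      linarith
    · rw [pow_succ, mul_assoc]
      gcongr

lemma edgeSub_inc_card_le {V : Type*} [Fintype V] (G : SimpleGraph V) (p : Sym2 V → Prop) (v : V) :
    (inc (edgeSub G p) v).card ≤ (inc G v).card :=
  card_le_card fun _ he => mem_inc.2 ⟨(mem_edgeSub.1 (mem_inc.1 he).1).1, (mem_inc.1 he).2⟩

lemma PartialColouring.of_empty {V A : Type*} (G : SimpleGraph V) :
    PartialColouring G (fun _ => none : Sym2 V → Option A) where
  mem _ _ h := by simp at h
  proper _ _ _ _ h := by simp at h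
  noAlt _ _ _ _ h := by simpa using (h 0).1

/-- Graphs of large girth have total colourings with `(1 + ε) * d + C` colours. -/
theorem exists_total_of_girth {ε : ℝ} (hε : 0 < ε) : ∃ C g : ℕ, ∀ (V : Type) [Fintype V]
    (G : SimpleGraph V) (d : ℕ), GirthGe G g → (∀ v, (inc G v).card ≤ d) →
    ∃ (A : Type) (_ : Fintype A) (ψ : Sym2 V → Option A), PartialColouring G ψ ∧
      (∀ e ∈ G.edgeSet, ψ e ≠ none) ∧ (Fintype.card A : ℝ) ≤ (1 + ε) * d + C := by
  obtain ⟨δ, hδ0, hδ1, hδε⟩ : ∃ δ : ℝ, 0 < δ ∧ δ ≤ 1 / 2 ∧ 12 * δ ≤ ε :=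
    ⟨min (1 / 2) (ε / 12), by positivity, min_le_left _ _, by
      linarith [min_le_right (1 / 2) (ε / 12)]⟩
  obtain ⟨K, hK⟩ : ∃ K : ℝ, K * (1 - δ) = 1 + 2 * δ :=
    ⟨(1 + 2 * δ) / (1 - δ), div_mul_cancel₀ _ (by linarith)⟩
  have hKδ : K ≤ 1 + 6 * δ := by
    by_contra! h
    have h1 : (1 + 6 * δ) * (1 - δ) < K * (1 - δ) := mul_lt_mul_of_pos_right h (by linarith)
    nlinarith
  have hK0 : 0 ≤ K := by
    by_contra! h
    nlinarith
  have hr0 : 0 ≤ 1 - δ + δ ^ 2 := by nlinarith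
  obtain ⟨T, hT⟩ := exists_pow_lt_of_lt_one (show 0 < ε / 24 by positivity)
    (show 1 - δ + δ ^ 2 < 1 by nlinarith)
  have hrT := pow_nonneg hr0 T
  obtain ⟨g, d₀, h⟩ := exists_iterate_reduce_degree hδ0 hδ1 hK T 0 le_rfl
  generalize (1 - δ + δ ^ 2) ^ T = r at *
  obtain ⟨k₀, hk₀⟩ := pow_unbounded_of_one_lt (8 * (4 * 24 / ε) + 8) (one_lt_two (α := ℝ))
  have hk2 : 2 ≤ k₀ := by
    by_contra! hk
    have h1 : (2 : ℝ) ^ k₀ ≤ 2 ^ 1 := pow_le_pow_right₀ (by norm_num) (by omega)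
    have h2 : 0 < 4 * 24 / ε := by positivity
    linarith
  refine ⟨6 * d₀ + 6, max g (2 * k₀ + 6), fun V _ G d hg hd => ?_⟩
  have hdeg : ∀ A : Type, ∀ v, (inc (edgeSub G fun e =>
      (fun _ => none : Sym2 V → Option A) e = none) v).card ≤ d :=
    fun A v => (edgeSub_inc_card_le _ _ v).trans (hd v)
  rcases Nat.lt_or_ge d d₀ with hsmall | hlarge
  · obtain ⟨ψ, hψ, htot⟩ := exists_total (A := Empty) (.of_empty G) (k₀ := 3) (d := d + 1)
      (Nat.succ_pos d) (by norm_num) (by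
        rw [Fintype.card_empty]
        norm_num
        linarith)
      (fun v w hw => ((by omega : 2 * 3 ≤ 2 * k₀ + 6).trans (le_max_right _ _)).trans (hg v w hw))
      fun v => (hdeg Empty v).trans (Nat.le_succ d)
    refine ⟨_, inferInstance, ψ, hψ, htot, ?_⟩
    have h1 : Fintype.card (Empty ⊕ Fin (6 * (d + 1))) ≤ 6 * d₀ + 6 := by
      rw [Fintype.card_sum, Fintype.card_empty, Fintype.card_fin]
      omega
    have h2 : (Fintype.card (Empty ⊕ Fin (6 * (d + 1))) : ℝ) ≤ (6 * d₀ + 6 : ℕ) := by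
      exact_mod_cast h1
    have h3 : 0 ≤ (1 + ε) * (d : ℝ) := by positivity
    linarith
  · obtain ⟨A, hfA, χ, hχ, hA, hdegA⟩ := h V Empty G (fun _ => none) d (.of_empty G)
      (fun v w hw => (le_max_left _ _).trans (hg v w hw)) hlarge (by simp) (hdeg Empty)
    rw [Fintype.card_empty, Nat.cast_zero, zero_add] at hA
    have hdR : (0 : ℝ) ≤ d := Nat.cast_nonneg d
    have hA1 : (Fintype.card A : ℝ) ≤ K * d := hA.trans (by
      have h1 : K * (1 - r) ≤ K * 1 := by
        gcongr
        linarith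
      have := mul_le_mul_of_nonneg_right h1 hdR
      linarith)
    have hA2 : K * (d : ℝ) ≤ (1 + 6 * δ) * d := by gcongr
    have hA3 : 12 * δ * (d : ℝ) ≤ ε * d := by gcongr
    have hA4 : δ * (d : ℝ) ≤ 1 / 2 * d := by gcongr
    have hle : ((⌊ε / 24 * (d : ℝ)⌋₊ : ℕ) : ℝ) ≤ ε / 24 * d := Nat.floor_le (by positivity)
    have hlt := Nat.lt_floor_add_one (ε / 24 * (d : ℝ))
    generalize ⌊ε / 24 * (d : ℝ)⌋₊ = m at hle hlt
    have hm : ((m + 1 : ℕ) : ℝ) = m + 1 := by push_cast; rfl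
    have hcap : 8 * ((Fintype.card A : ℝ) + (m + 1 : ℕ)) ≤ (m + 1 : ℕ) * 2 ^ k₀ := by
      have h1 : ((m + 1 : ℕ) : ℝ) * (8 * (4 * 24 / ε) + 8) ≤ (m + 1 : ℕ) * 2 ^ k₀ := by gcongr
      have h2 : 4 * 24 / ε * (ε / 24 * d) ≤ 4 * 24 / ε * ((m : ℝ) + 1) := by gcongr
      have h3 : 4 * 24 / ε * (ε / 24 * (d : ℝ)) = 4 * d := by field_simp
      rw [hm] at h1 ⊢
      linarith
    obtain ⟨ψ, hψ, htot⟩ := exists_total hχ (k₀ := k₀) (d := m + 1) (Nat.succ_pos m) hk2 hcap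
      (fun v w hw => ((by omega : 2 * k₀ ≤ 2 * k₀ + 6).trans (le_max_right _ _)).trans (hg v w hw))
      fun v => by
        have h1 := hdegA v
        have h2 : r * (d : ℝ) ≤ ε / 24 * d := by gcongr
        have h3 : ((inc (edgeSub G fun e => χ e = none) v).card : ℝ) ≤ (m + 1 : ℕ) := by
          rw [hm]
          linarith
        exact_mod_cast h3
    refine ⟨_, inferInstance, ψ, hψ, htot, ?_⟩
    rw [Fintype.card_sum, Fintype.card_fin]
    push_cast
    have h0 : (0 : ℝ) ≤ d₀ := Nat.cast_nonneg _
    linarith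

end AEC

namespace AEC
open scoped Classical
open Finset SimpleGraph

/-- A closed walk that is a cycle, read periodically. -/
lemma exists_periodic_of_isCycle {V : Type*} {G : SimpleGraph V} {x : V} {w : G.Walk x x}
    (hw : w.IsCycle) : ∃ v : ℕ → V, ∀ t, s(v t, v (t + 1)) ∈ w.edges ∧ v t ≠ v (t + 2) := by
  have h3 := hw.three_le_length
  have hn : 0 < w.length := by omega
  refine ⟨fun t => w.getVert (t % w.length), fun t => ⟨?_, fun h => ?_⟩⟩
  · have hlt := Nat.mod_lt t hn
    have h1 : w.getVert ((t + 1) % w.length) = w.getVert (t % w.length + 1) := by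
      rw [Nat.add_mod, Nat.mod_eq_of_lt (show 1 < w.length by omega)]
      rcases Nat.lt_or_ge (t % w.length + 1) w.length with h | h
      · rw [Nat.mod_eq_of_lt h]
      · rw [show t % w.length + 1 = w.length by omega]
        simp
    change s(w.getVert (t % w.length), w.getVert ((t + 1) % w.length)) ∈ w.edges
    rw [h1]
    exact Walk.adj_toSubgraph_iff_mem_edges.1 (w.toSubgraph_adj_getVert hlt)
  · have h1 := Nat.mod_lt t hn
    have h2 := Nat.mod_lt (t + 2) hn
    have := hw.getVert_injOn' (show t % w.length ≤ w.length - 1 by omega)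
      (show (t + 2) % w.length ≤ w.length - 1 by omega) h
    have h4 : t ≡ t + 2 [MOD w.length] := this
    have := (Nat.modEq_iff_dvd' (by omega)).1 h4
    have := Nat.le_of_dvd (by omega) this
    omega

/-- If every two consecutive terms differ and only two values occur, the sequence alternates. -/
lemma alternating_of_card_le_two {f : ℕ → ℕ} {s : Finset ℕ} (hs : s.card ≤ 2) (hf : ∀ t, f t ∈ s)
    (hne : ∀ t, f t ≠ f (t + 1)) (l : ℕ) : f (2 * l) = f 0 ∧ f (2 * l + 1) = f 1 := by
  have h2 : ∀ t, f (t + 2) = f t := by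
    intro t
    by_contra h
    have h3 : ({f t, f (t + 1), f (t + 2)} : Finset ℕ).card = 3 :=
      card_eq_three.2 ⟨_, _, _, hne t, fun h' => h h'.symm, hne (t + 1), rfl⟩
    have h4 : ({f t, f (t + 1), f (t + 2)} : Finset ℕ) ⊆ s := by
      intro y hy
      simp only [mem_insert, mem_singleton] at hy
      rcases hy with rfl | rfl | rfl <;> exact hf _
    have := card_le_card h4
    omega
  induction l with
  | zero => exact ⟨rfl, rfl⟩
  | succ l ih => exact ⟨(h2 _).trans ih.1, (h2 _).trans ih.2⟩

/-- A total colouring without alternating sequences, read as a colouring by natural numbers. -/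
lemma PartialColouring.exists_acyclic {V A : Type} [Fintype A] {G : SimpleGraph V}
    {ψ : Sym2 V → Option A} (hψ : PartialColouring G ψ) (htot : ∀ e ∈ G.edgeSet, ψ e ≠ none)
    {n : ℕ} (hn : Fintype.card A ≤ n) : ∃ c : Sym2 V → ℕ, IsAcyclicEdgeColoring G n c := by
  let c : Sym2 V → ℕ := fun e => (ψ e).elim 0 fun a => Fintype.equivFin A a
  have hc : ∀ e ∈ G.edgeSet, ∃ a, ψ e = some a ∧ c e = Fintype.equivFin A a := by
    intro e he
    obtain ⟨a, ha⟩ := Option.ne_none_iff_exists'.1 (htot e he)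
    exact ⟨a, ha, by simp [c, ha]⟩
  have hinj : ∀ e ∈ G.edgeSet, ∀ f ∈ G.edgeSet, c e = c f → ψ e = ψ f := by
    intro e he f hf hef
    obtain ⟨a, ha, ha'⟩ := hc e he
    obtain ⟨b, hb, hb'⟩ := hc f hf
    rw [ha', hb'] at hef
    rw [ha, hb, (Fintype.equivFin A).injective (Fin.ext hef)]
  have hprop : ∀ x y z, s(x, y) ∈ G.edgeSet → s(x, z) ∈ G.edgeSet → c s(x, y) = c s(x, z) →
      y = z := by
    intro x y z hy hz h
    obtain ⟨a, ha, -⟩ := hc _ hy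
    exact hψ.proper a x y z ha (hinj _ hy _ hz h ▸ ha)
  refine ⟨c, fun e he => ?_, fun e he f hf hne hx hcol => ?_, fun x w hw => ?_⟩
  · obtain ⟨a, -, ha⟩ := hc e he
    rw [ha]
    exact (Fintype.equivFin A a).2.trans_le hn
  · obtain ⟨x, hxe, hxf⟩ := hx
    obtain ⟨y, rfl⟩ := hxe
    obtain ⟨z, rfl⟩ := hxf
    exact hne (by rw [hprop x y z he hf hcol])
  · by_contra! hcard
    obtain ⟨v, hv⟩ := exists_periodic_of_isCycle hw
    have hvG : ∀ t, s(v t, v (t + 1)) ∈ G.edgeSet := fun t => w.edges_subset_edgeSet (hv t).1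
    have hne : ∀ t, c s(v t, v (t + 1)) ≠ c s(v (t + 1), v (t + 1 + 1)) := by
      intro t h
      have h1 := hvG t
      rw [Sym2.eq_swap] at h h1
      exact (hv t).2 (hprop _ _ _ h1 (hvG (t + 1)) h)
    have halt := alternating_of_card_le_two (f := fun t => c s(v t, v (t + 1)))
      (Nat.le_of_lt_succ hcard) (fun t => List.mem_toFinset.2 (List.mem_map_of_mem (hv t).1)) hne
    obtain ⟨a, ha, -⟩ := hc _ (hvG 0)
    obtain ⟨b, hb, -⟩ := hc _ (hvG 1)
    refine hψ.noAlt v a b (fun hab => ?_) fun l => ⟨?_, ?_⟩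
    · subst hab
      have h1 := hvG 0
      rw [Sym2.eq_swap] at ha h1
      exact (hv 0).2 (hψ.proper a _ _ _ ha hb)
    · rw [hinj _ (hvG _) _ (hvG 0) (halt l).1, ha]
    · rw [hinj _ (hvG _) _ (hvG 1) (halt l).2, hb]

end AEC

/-- For every `ε > 0` there exist constants `C = C(ε)` and `g = g(ε)` such that every
finite simple graph `G` with maximum degree `Δ` and girth at least `g` satisfies
`a'(G) ≤ (1+ε)Δ + C`, i.e. `G` admits an acyclic edge colouring with at most
`⌊(1+ε)Δ + C⌋` colours. -/
theorem statement1 :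
    ∀ ε : ℝ, 0 < ε →
      ∃ (C : ℝ) (g : ℕ),
        ∀ (V : Type) [Fintype V] [DecidableEq V] (G : SimpleGraph V) [DecidableRel G.Adj],
          (g : ℕ∞) ≤ G.girth →
            ∃ c : Sym2 V → ℕ,
              IsAcyclicEdgeColoring G (⌊(1 + ε) * (G.maxDegree : ℝ) + C⌋₊) c := by
  intro ε hε
  obtain ⟨C, g, h⟩ := AEC.exists_total_of_girth hε
  refine ⟨C, g, fun V _ _ G _ hg => ?_⟩
  obtain ⟨A, _, ψ, hψ, htot, hcard⟩ := h V G G.maxDegree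
    (fun v w hw => (Nat.cast_le.1 hg).trans (girth_le_length hw)) fun v => by
      rw [AEC.card_inc]
      refine le_trans (le_of_eq ?_) (G.degree_le_maxDegree v)
      rw [← card_neighborFinset_eq_degree]
      congr 1
      ext y
      simp
  exact hψ.exists_acyclic htot (Nat.le_floor hcard)
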